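/- arXiv:math/0503086 — 16 statements merged into one kernel-verified Lean document; each statement's English description precedes it below -/
import Mathlib

section
/- Suppose f : Dₙ → ℝⁿ satisfies inequality (1). If x ∈ Dₙ and f(x) = 0, then x = 0. In particular, if 0 < c < 1 then f(x) ≠ 0 for every x ∈ Dₙ. -/
open scoped RealInnerProductSpace

/-- If `‖x‖² |l| ≤ φ (l x, x)` and `φ (l x, x) / |l| ≤ C / |log |l||`, then `|log |l||` is at most
`C / ‖x‖²`. -/
lemma sq_norm_mul_abs_log_le {E : Type*} [NormedAddCommGroup E] [InnerProductSpace ℝ E]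
    {f : E → E} {φ : E → E → ℝ} (hφsymm : ∀ x y, φ x y = φ y x) {x : E} {l C : ℝ}
    (hl : 0 < |l|) (hlog : 0 < |Real.log (|l|)|) (hfx : f x = 0)
    (hf : |abs ⟪f x, f (l • x)⟫ - abs ⟪x, l • x⟫| ≤ φ x (l • x))
    (hφ : (1 / |l|) * φ (l • x) x ≤ C / |Real.log (|l|)|) :
    ‖x‖ ^ 2 * |Real.log (|l|)| ≤ C := by
  rw [hfx, inner_zero_left, abs_zero, zero_sub, abs_neg, abs_abs, inner_smul_right,
    real_inner_self_eq_norm_sq, abs_mul, abs_of_nonneg (sq_nonneg ‖x‖), hφsymm] at hf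
  rw [← le_div_iff₀ hlog]
  refine le_trans ?_ hφ
  rwa [one_div_mul_eq_div, le_div_iff₀ hl, mul_comm]

theorem stmt_1
    (n : ℕ) (hn : 2 ≤ n)
    (c d : ℝ) (hc : 0 < c) (hc1 : c ≠ 1) (hd : 0 < d)
    (D : Set (EuclideanSpace ℝ (Fin n)))
    (hD : D = if c < 1 then {x : EuclideanSpace ℝ (Fin n) | d ≤ ‖x‖} else {x : EuclideanSpace ℝ (Fin n) | ‖x‖ < d})
    (φ : EuclideanSpace ℝ (Fin n) → EuclideanSpace ℝ (Fin n) → ℝ)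
    (hφnonneg : ∀ x y, 0 ≤ φ x y)
    (hφsymm : ∀ x y, φ x y = φ y x)
    (hφi : ∃ φ₀ : ℝ → ℝ → ℝ, ∀ x y, φ x y = φ₀ ‖x‖ ‖y‖)
    (hφii : ∀ x y : EuclideanSpace ℝ (Fin n), ∃ C : ℝ, 0 < C ∧ ∃ T : ℝ, 1 < T ∧
      ∀ l : ℝ, (if c < 1 then T ≤ |l| else 0 < |l| ∧ |l| ≤ 1 / T) →
        (1 / |l|) * φ (l • x) y ≤ C / abs (Real.log |l|))
    (hφiii : ∀ x y : EuclideanSpace ℝ (Fin n), ∃ C : ℝ, 0 < C ∧ ∃ T : ℝ, 1 < T ∧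
      ∀ l m : ℝ, |l| ≠ 1 → |m| ≠ 1 →
        (if c < 1 then T ≤ |l * m| else 0 < |l * m| ∧ |l * m| ≤ 1 / T) →
        (1 / |l * m|) * φ (l • x) (m • y) ≤ C / (abs (Real.log |l|) * abs (Real.log |m|)))
    (f : EuclideanSpace ℝ (Fin n) → EuclideanSpace ℝ (Fin n))
    (hf : ∀ x ∈ D, ∀ y ∈ D, |abs ⟪f x, f y⟫ - abs ⟪x, y⟫| ≤ φ x y)
 :
    (∀ x ∈ D, f x = 0 → x = 0) ∧ (c < 1 → ∀ x ∈ D, f x ≠ 0) := by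
  have hzero : ∀ x ∈ D, f x = 0 → x = 0 := by
    intro x hx hfx
    by_contra hx0
    have hnorm : 0 < ‖x‖ ^ 2 := by positivity
    obtain ⟨C, hC, T, hT, h⟩ := hφii x x
    have hlogT : 0 < Real.log T := Real.log_pos hT
    have hs : 0 < Real.log T + C / ‖x‖ ^ 2 := by positivity
    have hTs : T ≤ Real.exp (Real.log T + C / ‖x‖ ^ 2) := by
      rw [← Real.log_le_iff_le_exp (by linarith)]
      exact le_add_of_nonneg_right (by positivity)
    have hlarge : C < ‖x‖ ^ 2 * (Real.log T + C / ‖x‖ ^ 2) := by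
      rw [mul_add, mul_div_cancel₀ _ hnorm.ne']
      exact lt_add_of_pos_left _ (by positivity)
    generalize Real.log T + C / ‖x‖ ^ 2 = s at hs hTs hlarge
    suffices hl : ∃ l : ℝ, 0 < l ∧ |Real.log l| = s ∧ l • x ∈ D ∧
        (if c < 1 then T ≤ |l| else 0 < |l| ∧ |l| ≤ 1 / T) by
      obtain ⟨l, hl, hlog, hlD, hlT⟩ := hl
      have hle := sq_norm_mul_abs_log_le hφsymm (abs_pos.2 hl.ne')
        (by rwa [abs_of_pos hl, hlog]) hfx (hf x hx _ hlD) (h l hlT)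
      rw [abs_of_pos hl, hlog] at hle
      exact hle.not_gt hlarge
    by_cases hc' : c < 1
    · simp only [hD, hc', if_true, Set.mem_ofPred_eq] at hx ⊢
      refine ⟨Real.exp s, Real.exp_pos s, by rw [Real.log_exp, abs_of_pos hs], ?_, ?_⟩
      · rw [norm_smul, Real.norm_eq_abs, Real.abs_exp]
        exact hx.trans (le_mul_of_one_le_left (norm_nonneg x) (Real.one_le_exp hs.le))
      · rwa [Real.abs_exp]
    · simp only [hD, hc', if_false, Set.mem_ofPred_eq] at hx ⊢
      refine ⟨Real.exp (-s), Real.exp_pos _, by rw [Real.log_exp, abs_neg, abs_of_pos hs], ?_, ?_⟩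
      · rw [norm_smul, Real.norm_eq_abs, Real.abs_exp]
        exact (mul_le_of_le_one_left (norm_nonneg x)
          (Real.exp_le_one_iff.2 (by linarith))).trans_lt hx
      · rw [Real.abs_exp, Real.exp_neg, ← one_div]
        exact ⟨by positivity, one_div_le_one_div_of_le (by linarith) hTs⟩
  refine ⟨hzero, fun hc' x hx hfx => ?_⟩
  have hx0 := hzero x hx hfx
  simp only [hD, hc', if_true, Set.mem_ofPred_eq, hx0, norm_zero] at hx
  exact hx.not_gt hd
end

section
/- Suppose f : Dₙ → ℝⁿ satisfies inequality (1). Then for each x ∈ Dₙ with x ≠ 0 there exists a function μₓ : ℝ → ℝ such that f(λx) = μₓ(λ)·f(x) for every real λ ≠ 0 with λx ∈ Dₙ, and moreover the quotient |μₓ(λ)|/|λ| does not converge to 0 as |λ| → ∞ when 0 < c < 1, respectively does not converge to 0 as λ → 0 with λ ≠ 0 when c > 1. -/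
open scoped RealInnerProductSpace

open Filter Topology

section AsymptoticIsometry

variable {E : Type*} [NormedAddCommGroup E] [InnerProductSpace ℝ E]
  {D : Set E} {φ : E → E → ℝ} {f : E → E} {F : Filter ℝ}

theorem tendsto_abs_inner_smul_smul
    (hpos : ∀ᶠ m in F, 0 < m) (hD : ∀ y ≠ 0, ∀ᶠ m in F, m • y ∈ D)
    (hφ : ∀ y z, Tendsto (fun m : ℝ => (1 / (m * m)) * φ (m • y) (m • z)) F (𝓝 0))
    (hf : ∀ x ∈ D, ∀ y ∈ D, |abs ⟪f x, f y⟫ - abs ⟪x, y⟫| ≤ φ x y)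
    {y z : E} (hy : y ≠ 0) (hz : z ≠ 0) :
    Tendsto (fun m : ℝ => |⟪m⁻¹ • f (m • y), m⁻¹ • f (m • z)⟫|) F (𝓝 |⟪y, z⟫|) := by
  rw [tendsto_iff_dist_tendsto_zero]
  refine squeeze_zero' (Eventually.of_forall fun _ => dist_nonneg) ?_ (hφ y z)
  filter_upwards [hpos, hD y hy, hD z hz] with m hm hmy hmz
  have h := mul_le_mul_of_nonneg_left (hf _ hmy _ hmz) (by positivity : 0 ≤ 1 / (m * m))
  refine le_trans (le_of_eq ?_) h
  have hc : (0 : ℝ) < 1 / (m * m) := by positivity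
  conv_rhs => rw [← abs_of_pos hc, ← abs_mul]
  rw [Real.dist_eq]
  simp only [real_inner_smul_left, real_inner_smul_right, abs_mul, abs_inv, abs_of_pos hm]
  rw [← abs_mul]
  congr 1
  field_simp

theorem tendsto_abs_inner_smul_right
    (hpos : ∀ᶠ m in F, 0 < m) (hD : ∀ y ≠ 0, ∀ᶠ m in F, m • y ∈ D)
    (hφ : ∀ y z, Tendsto (fun m : ℝ => (1 / m) * φ (m • y) z) F (𝓝 0))
    (hf : ∀ x ∈ D, ∀ y ∈ D, |abs ⟪f x, f y⟫ - abs ⟪x, y⟫| ≤ φ x y)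
    {y z : E} (hy : y ≠ 0) (hz : z ∈ D) :
    Tendsto (fun m : ℝ => |⟪m⁻¹ • f (m • y), f z⟫|) F (𝓝 |⟪y, z⟫|) := by
  rw [tendsto_iff_dist_tendsto_zero]
  refine squeeze_zero' (Eventually.of_forall fun _ => dist_nonneg) ?_ (hφ y z)
  filter_upwards [hpos, hD y hy] with m hm hmy
  have h := mul_le_mul_of_nonneg_left (hf _ hmy _ hz) (by positivity : 0 ≤ 1 / m)
  refine le_trans (le_of_eq ?_) h
  have hc : (0 : ℝ) < 1 / m := by positivity
  conv_rhs => rw [← abs_of_pos hc, ← abs_mul]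
  rw [Real.dist_eq]
  simp only [real_inner_smul_left, abs_mul, abs_inv, abs_of_pos hm]
  rw [← abs_mul]
  congr 1
  field_simp

/-- Ultrafilter limits of the rescalings of `f` form a map preserving absolute values of inner
products, both among themselves and against `f`. -/
theorem exists_limit_map_abs_inner_eq [FiniteDimensional ℝ E] [NeBot F]
    (hpos : ∀ᶠ m in F, 0 < m) (hD : ∀ y ≠ 0, ∀ᶠ m in F, m • y ∈ D)
    (hφ₁ : ∀ y z, Tendsto (fun m : ℝ => (1 / m) * φ (m • y) z) F (𝓝 0))
    (hφ₂ : ∀ y z, Tendsto (fun m : ℝ => (1 / (m * m)) * φ (m • y) (m • z)) F (𝓝 0))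
    (hf : ∀ x ∈ D, ∀ y ∈ D, |abs ⟪f x, f y⟫ - abs ⟪x, y⟫| ≤ φ x y) :
    ∃ G : E → E, (∀ y ≠ 0, ∀ z ≠ 0, |⟪G y, G z⟫| = |⟪y, z⟫|) ∧
      ∀ y ≠ 0, ∀ z ∈ D, |⟪G y, f z⟫| = |⟪y, z⟫| := by
  have hU : (Ultrafilter.of F : Filter ℝ) ≤ F := Ultrafilter.of_le F
  have hlim : ∀ y : E, ∃ g : E, y ≠ 0 →
      Tendsto (fun m : ℝ => m⁻¹ • f (m • y)) (Ultrafilter.of F) (𝓝 g) := by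
    intro y
    by_cases hy : y = 0
    · exact ⟨0, fun h => absurd hy h⟩
    have hb : ∀ᶠ m in (Ultrafilter.of F : Filter ℝ),
        m⁻¹ • f (m • y) ∈ Metric.closedBall (0 : E) (‖y‖ + 1) := by
      have h := (tendsto_abs_inner_smul_smul hpos hD hφ₂ hf hy hy).mono_left hU
      filter_upwards [h.eventually_lt_const (lt_add_one _)] with m hm
      rw [mem_closedBall_zero_iff]
      rw [real_inner_self_eq_norm_sq, real_inner_self_eq_norm_sq, abs_of_nonneg (sq_nonneg _),
        abs_of_nonneg (sq_nonneg _)] at hm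
      nlinarith [norm_nonneg y, norm_nonneg (m⁻¹ • f (m • y))]
    obtain ⟨g, -, hg⟩ := (isCompact_closedBall (0 : E) (‖y‖ + 1)).ultrafilter_le_nhds
      ((Ultrafilter.of F).map fun m : ℝ => m⁻¹ • f (m • y)) (le_principal_iff.2 hb)
    exact ⟨g, fun _ => hg⟩
  choose G hG using hlim
  refine ⟨G, fun y hy z hz => ?_, fun y hy z hz => ?_⟩
  · exact tendsto_nhds_unique ((hG y hy).inner (hG z hz)).abs
      ((tendsto_abs_inner_smul_smul hpos hD hφ₂ hf hy hz).mono_left hU)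
  · exact tendsto_nhds_unique ((hG y hy).inner tendsto_const_nhds).abs
      ((tendsto_abs_inner_smul_right hpos hD hφ₁ hf hy hz).mono_left hU)

/-- On each line, a map with a limit map as above takes values in a line and scales norms
homogeneously. -/
theorem exists_smul_eq_of_limit_map {n : ℕ}
    {D : Set (EuclideanSpace ℝ (Fin n))}
    {f G : EuclideanSpace ℝ (Fin n) → EuclideanSpace ℝ (Fin n)}
    (hG : ∀ y ≠ 0, ∀ z ≠ 0, |⟪G y, G z⟫| = |⟪y, z⟫|)
    (hGf : ∀ y ≠ 0, ∀ z ∈ D, |⟪G y, f z⟫| = |⟪y, z⟫|)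
    {x : EuclideanSpace ℝ (Fin n)} (hx : x ∈ D) (hx0 : x ≠ 0) :
    ∃ μ : ℝ → ℝ, ∀ l : ℝ, l • x ∈ D → f (l • x) = μ l • f x ∧ |μ l| = |l| := by
  have hn : 0 < n := by
    rcases Nat.eq_zero_or_pos n with rfl | h
    · exact absurd (Subsingleton.elim x 0) hx0
    · exact h
  have hxn : ‖x‖ ≠ 0 := norm_ne_zero_iff.2 hx0
  let k : Fin n := ⟨0, hn⟩
  obtain ⟨b, hb⟩ := Orthonormal.exists_orthonormalBasis_extension_of_card_eq (𝕜 := ℝ)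
    (E := EuclideanSpace ℝ (Fin n)) (ι := Fin n) (by simp)
    (v := fun _ => ‖x‖⁻¹ • x) (s := {k}) (by
      refine ⟨fun i => ?_, fun i j hij => absurd (Subsingleton.elim i j) hij⟩
      simp [norm_smul, hxn])
  have hbk : x = ‖x‖ • b k := by
    rw [hb k rfl, smul_smul, mul_inv_cancel₀ hxn, one_smul]
  have hb0 : ∀ i, b i ≠ 0 := fun i => b.orthonormal.ne_zero i
  have hGb : Orthonormal ℝ fun i => G (b i) := by
    refine ⟨fun i => ?_, fun i j hij => ?_⟩
    · have h := hG _ (hb0 i) _ (hb0 i)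
      rw [real_inner_self_eq_norm_sq, real_inner_self_eq_norm_sq, b.orthonormal.1 i,
        abs_of_nonneg (sq_nonneg _)] at h
      simpa [pow_eq_one_iff_of_nonneg] using h
    · have h := hG _ (hb0 i) _ (hb0 j)
      rw [b.orthonormal.2 hij, abs_zero, abs_eq_zero] at h
      exact h
  obtain ⟨b', hb'⟩ := Orthonormal.exists_orthonormalBasis_extension_of_card_eq (𝕜 := ℝ)
    (E := EuclideanSpace ℝ (Fin n)) (ι := Fin n) (by simp)
    (v := fun i => G (b i)) (s := Set.univ)
    (hGb.comp _ Subtype.val_injective)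
  have hb' : ∀ i, b' i = G (b i) := fun i => hb' i trivial
  have hinner : ∀ l : ℝ, ∀ i, ⟪b i, l • x⟫ = if i = k then l * ‖x‖ else 0 := by
    intro l i
    rw [hbk, real_inner_smul_right, real_inner_smul_right, orthonormal_iff_ite.1 b.orthonormal,
      ← hbk]
    split_ifs <;> simp
  have hline : ∀ l : ℝ, l • x ∈ D → f (l • x) = ⟪b' k, f (l • x)⟫ • b' k ∧
      |⟪b' k, f (l • x)⟫| = |l| * ‖x‖ := by
    intro l hl
    constructor
    · conv_lhs => rw [← b'.sum_repr' (f (l • x))]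
      refine Finset.sum_eq_single k (fun i _ hi => ?_) (by simp)
      have h := hGf _ (hb0 i) _ hl
      rw [hinner, if_neg hi, abs_zero, abs_eq_zero] at h
      rw [hb', h, zero_smul]
    · rw [hb', hGf _ (hb0 k) _ hl, hinner, if_pos rfl, abs_mul, abs_norm]
  obtain ⟨h₁, h₂⟩ := hline 1 (by simpa using hx)
  rw [one_smul] at h₁ h₂
  have hne : ⟪b' k, f x⟫ ≠ 0 := by
    intro h
    rw [h] at h₂
    exact hxn (by simpa using h₂.symm)
  refine ⟨fun l => ⟪b' k, f (l • x)⟫ / ⟪b' k, f x⟫, fun l hl => ⟨?_, ?_⟩⟩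
  · conv_rhs => rw [h₁]
    rw [smul_smul, real_inner_smul_right, real_inner_self_eq_norm_sq, b'.orthonormal.1 k, one_pow,
      mul_one, div_mul_cancel₀ _ hne]
    exact (hline l hl).1
  · rw [abs_div, h₂, (hline l hl).2]
    simp [hxn]

theorem not_tendsto_abs_div_abs_zero [NeBot F] {L : Filter ℝ} (hFL : F ≤ L)
    (hpos : ∀ᶠ m in F, 0 < m) {μ : ℝ → ℝ} (hμ : ∀ᶠ m in F, |μ m| = |m|) :
    ¬ Tendsto (fun l : ℝ => |μ l| / |l|) L (𝓝 0) := by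
  intro h
  refine zero_ne_one (tendsto_nhds_unique (h.mono_left hFL) (tendsto_const_nhds.congr' ?_))
  filter_upwards [hpos, hμ] with m hm h
  rw [h, div_self (abs_pos.2 hm.ne').ne']

end AsymptoticIsometry

theorem stmt_2
    (n : ℕ) (hn : 2 ≤ n)
    (c d : ℝ) (hc : 0 < c) (hc1 : c ≠ 1) (hd : 0 < d)
    (D : Set (EuclideanSpace ℝ (Fin n)))
    (hD : D = if c < 1 then {x : EuclideanSpace ℝ (Fin n) | d ≤ ‖x‖} else {x : EuclideanSpace ℝ (Fin n) | ‖x‖ < d})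
    (φ : EuclideanSpace ℝ (Fin n) → EuclideanSpace ℝ (Fin n) → ℝ)
    (hφnonneg : ∀ x y, 0 ≤ φ x y)
    (hφsymm : ∀ x y, φ x y = φ y x)
    (hφi : ∃ φ₀ : ℝ → ℝ → ℝ, ∀ x y, φ x y = φ₀ ‖x‖ ‖y‖)
    (hφii : ∀ x y : EuclideanSpace ℝ (Fin n), ∃ C : ℝ, 0 < C ∧ ∃ T : ℝ, 1 < T ∧
      ∀ l : ℝ, (if c < 1 then T ≤ |l| else 0 < |l| ∧ |l| ≤ 1 / T) →
        (1 / |l|) * φ (l • x) y ≤ C / abs (Real.log |l|))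
    (hφiii : ∀ x y : EuclideanSpace ℝ (Fin n), ∃ C : ℝ, 0 < C ∧ ∃ T : ℝ, 1 < T ∧
      ∀ l m : ℝ, |l| ≠ 1 → |m| ≠ 1 →
        (if c < 1 then T ≤ |l * m| else 0 < |l * m| ∧ |l * m| ≤ 1 / T) →
        (1 / |l * m|) * φ (l • x) (m • y) ≤ C / (abs (Real.log |l|) * abs (Real.log |m|)))
    (f : EuclideanSpace ℝ (Fin n) → EuclideanSpace ℝ (Fin n))
    (hf : ∀ x ∈ D, ∀ y ∈ D, |abs ⟪f x, f y⟫ - abs ⟪x, y⟫| ≤ φ x y)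
 :
    ∀ x ∈ D, x ≠ 0 →
      ∃ μ : ℝ → ℝ,
        (∀ l : ℝ, l ≠ 0 → l • x ∈ D → f (l • x) = μ l • f x) ∧
        (c < 1 →
          ¬ Filter.Tendsto (fun l : ℝ => |μ l| / |l|)
              (Filter.comap (fun l : ℝ => |l|) Filter.atTop) (nhds 0)) ∧
        (1 < c →
          ¬ Filter.Tendsto (fun l : ℝ => |μ l| / |l|)
              (nhdsWithin (0 : ℝ) {(0 : ℝ)}ᶜ) (nhds 0)) := by

  have key : ∀ F : Filter ℝ, F.NeBot → (∀ᶠ m in F, 0 < m) →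
      (∀ y ≠ 0, ∀ᶠ m in F, m • y ∈ D) →
      Tendsto (fun m : ℝ => abs (Real.log |m|)) F atTop →
      (∀ T : ℝ, 1 < T → ∀ᶠ m in F, if c < 1 then T ≤ |m| else 0 < |m| ∧ |m| ≤ 1 / T) →
      ∀ x ∈ D, x ≠ 0 → ∃ μ : ℝ → ℝ,
        (∀ l : ℝ, l ≠ 0 → l • x ∈ D → f (l • x) = μ l • f x) ∧
        ∀ L : Filter ℝ, F ≤ L → ¬ Tendsto (fun l : ℝ => |μ l| / |l|) L (𝓝 0) := by
    intro F hF hpos hDF hlog hdom x hx hx0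
    have hφ₁ : ∀ y z, Tendsto (fun m : ℝ => (1 / m) * φ (m • y) z) F (𝓝 0) := by
      intro y z
      obtain ⟨C, -, T, hT, h⟩ := hφii y z
      refine squeeze_zero' ?_ ?_ (tendsto_const_nhds.div_atTop hlog : Tendsto (fun m =>
        C / abs (Real.log |m|)) F (𝓝 0))
      · filter_upwards [hpos] with m hm
        exact mul_nonneg (by positivity) (hφnonneg _ _)
      · filter_upwards [hpos, hdom T hT] with m hm hmT
        simpa only [abs_of_pos hm] using h m hmT
    have hφ₂ : ∀ y z, Tendsto (fun m : ℝ => (1 / (m * m)) * φ (m • y) (m • z)) F (𝓝 0) := by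
      intro y z
      obtain ⟨C, -, T, hT, h⟩ := hφiii y z
      refine squeeze_zero' ?_ ?_ (tendsto_const_nhds.div_atTop (hlog.atTop_mul_atTop₀ hlog) :
        Tendsto (fun m => C / (abs (Real.log |m|) * abs (Real.log |m|))) F (𝓝 0))
      · filter_upwards [hpos] with m hm
        exact mul_nonneg (by positivity) (hφnonneg _ _)
      · filter_upwards [hpos, hdom T hT, hlog.eventually_gt_atTop 0] with m hm hmT hl
        have hm1 : |m| ≠ 1 := by
          intro h1
          simp [h1] at hl
        have h' := h m m hm1 hm1 (by
          rw [abs_mul]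
          split_ifs at hmT ⊢
          · nlinarith
          · have : 1 / T ≤ 1 := by rw [div_le_one (by linarith)]; exact hT.le
            exact ⟨mul_pos hmT.1 hmT.1, by nlinarith⟩)
        rwa [abs_of_pos (mul_pos hm hm)] at h'
    obtain ⟨G, hG, hGf⟩ := exists_limit_map_abs_inner_eq hpos hDF hφ₁ hφ₂ hf
    obtain ⟨μ, hμ⟩ := exists_smul_eq_of_limit_map hG hGf hx hx0
    refine ⟨μ, fun l _ hl => (hμ l hl).1, fun L hL => ?_⟩
    exact not_tendsto_abs_div_abs_zero hL hpos ((hDF x hx0).mono fun m hm => (hμ m hm).2)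
  intro x hx hx0
  rcases hc1.lt_or_gt with h | h
  · obtain ⟨μ, hμ, hL⟩ := key atTop inferInstance (eventually_gt_atTop 0)
      (fun y hy => by
        rw [hD, if_pos h]
        filter_upwards [eventually_ge_atTop (d / ‖y‖), eventually_ge_atTop 0] with m hm hm0
        rw [div_le_iff₀ (norm_pos_iff.2 hy)] at hm
        simpa [norm_smul, abs_of_nonneg hm0] using hm)
      (tendsto_abs_atTop_atTop.comp (Real.tendsto_log_atTop.comp tendsto_abs_atTop_atTop))
      (fun T _ => by
        filter_upwards [eventually_ge_atTop T] with m hm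
        rw [if_pos h]
        exact hm.trans (le_abs_self m)) x hx hx0
    exact ⟨μ, hμ, fun _ => hL _ (map_le_iff_le_comap.1 tendsto_abs_atTop_atTop),
      fun h' => absurd h' h.not_gt⟩
  · obtain ⟨μ, hμ, hL⟩ := key (𝓝[>] 0) inferInstance self_mem_nhdsWithin
      (fun y hy => by
        rw [hD, if_neg h.not_gt]
        have hy := norm_pos_iff.2 hy
        filter_upwards [Ioo_mem_nhdsGT (div_pos hd hy)] with m hm
        have h2 := hm.2
        rw [lt_div_iff₀ hy] at h2
        simpa [norm_smul, abs_of_pos hm.1] using h2)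
      (by
        simpa only [Real.log_abs, Function.comp_def] using
          tendsto_abs_atBot_atTop.comp Real.tendsto_log_nhdsGT_zero)
      (fun T hT => by
        filter_upwards [Ioo_mem_nhdsGT (by positivity : 0 < 1 / T)] with m hm
        rw [if_neg h.not_gt, abs_of_pos hm.1]
        exact ⟨hm.1, hm.2.le⟩) x hx hx0
    exact ⟨μ, hμ, fun h' => absurd h' h.not_gt,
      fun _ => hL _ (nhdsWithin_mono _ fun m hm => ne_of_gt hm)⟩
end

section
/- Suppose f : Dₙ → ℝⁿ satisfies inequality (1). Then for every x ∈ Dₙ with x ≠ 0 and every y ∈ Dₙ, one has ⟨x, y⟩ = 0 if and only if ⟨f(x), f(y)⟩ = 0. -/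
open scoped RealInnerProductSpace

open Filter Topology

/-- A map that asymptotically preserves absolute values of inner products along rescalings of one
argument preserves them exactly. -/
theorem abs_inner_eq_of_tendsto_rescaled {n : ℕ} [Nonempty (Fin n)]
    {D : Set (EuclideanSpace ℝ (Fin n))}
    {f : EuclideanSpace ℝ (Fin n) → EuclideanSpace ℝ (Fin n)} {l : ℕ → ℝ} {r : ℝ} (hr : 0 < r)
    (hrD : ∀ x, ‖x‖ = r → x ∈ D) (hl : ∀ k, 0 < l k) (hlD : ∀ k, ∀ x ∈ D, l k • x ∈ D)
    (hlim : ∀ x ∈ D, ∀ y ∈ D,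
      Tendsto (fun k => |⟪(l k)⁻¹ • f (l k • x), f y⟫|) atTop (𝓝 |⟪x, y⟫|))
    (hbdd : ∀ x ∈ D, ∃ R, ∀ᶠ k in atTop, ‖(l k)⁻¹ • f (l k • x)‖ ≤ R) :
    ∀ x ∈ D, ∀ y ∈ D, |⟪f x, f y⟫| = |⟪x, y⟫| := by
  have hex : ∀ x, ∃ a, x ∈ D → ∃ s : ℕ → ℕ, StrictMono s ∧
      Tendsto (fun k => (l (s k))⁻¹ • f (l (s k) • x)) atTop (𝓝 a) := by
    intro x
    by_cases hx : x ∈ D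
    · obtain ⟨R, hR⟩ := hbdd x hx
      obtain ⟨a, -, s, hs, ha⟩ := tendsto_subseq_of_frequently_bounded
        (Metric.isBounded_closedBall (x := (0 : EuclideanSpace ℝ (Fin n))) (r := R))
        (x := fun k => (l k)⁻¹ • f (l k • x))
        ((hR.mono fun k hk => by simpa using hk).frequently)
      exact ⟨a, fun _ => ⟨s, hs, ha⟩⟩
    · exact ⟨0, fun h => absurd h hx⟩
  choose h hh using hex
  have hhf : ∀ x ∈ D, ∀ y ∈ D, |⟪h x, f y⟫| = |⟪x, y⟫| := by
    intro x hx y hy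
    obtain ⟨s, hs, ha⟩ := hh x hx
    exact tendsto_nhds_unique ((ha.inner tendsto_const_nhds).abs)
      ((hlim x hx y hy).comp hs.tendsto_atTop)
  have hhh : ∀ x ∈ D, ∀ y ∈ D, |⟪h x, h y⟫| = |⟪x, y⟫| := by
    intro x hx y hy
    obtain ⟨s, hs, ha⟩ := hh y hy
    refine tendsto_nhds_unique (((tendsto_const_nhds (x := h x)).inner ha).abs) ?_
    refine tendsto_const_nhds.congr fun k => ?_
    rw [real_inner_smul_right, abs_mul, hhf x hx _ (hlD _ y hy), real_inner_smul_right, abs_mul,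
      abs_inv, inv_mul_cancel_left₀ (abs_pos.2 (hl _).ne').ne']
  let e := EuclideanSpace.basisFun (Fin n) ℝ
  have heD : ∀ i, r • e i ∈ D := fun i => hrD _ (by
    rw [norm_smul, e.orthonormal.1 i, mul_one, Real.norm_of_nonneg hr.le])
  have hnormh : ∀ x ∈ D, ‖h x‖ = ‖x‖ := by
    intro x hx
    have := hhh x hx x hx
    rw [real_inner_self_eq_norm_sq, real_inner_self_eq_norm_sq, abs_of_nonneg (by positivity),
      abs_of_nonneg (by positivity)] at this
    exact (sq_eq_sq₀ (norm_nonneg _) (norm_nonneg _)).1 this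
  have hon : Orthonormal ℝ fun i => r⁻¹ • h (r • e i) := by
    refine ⟨fun i => ?_, fun i j hij => ?_⟩
    · rw [norm_smul, hnormh _ (heD i), norm_smul, e.orthonormal.1 i, mul_one, norm_inv,
        inv_mul_cancel₀ (norm_pos_iff.2 hr.ne').ne']
    · have h0 : ⟪h (r • e i), h (r • e j)⟫ = 0 := by
        rw [← abs_eq_zero, hhh _ (heD i) _ (heD j), real_inner_smul_left, real_inner_smul_right,
          e.orthonormal.2 hij]
        simp
      simp only [real_inner_smul_left, real_inner_smul_right, h0, mul_zero]
  let b := (basisOfOrthonormalOfCardEqFinrank hon (by simp)).toOrthonormalBasis (by simpa using hon)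
  have hb : ∀ i, b i = r⁻¹ • h (r • e i) := fun i => by simp [b]
  have hnormf : ∀ x ∈ D, ‖f x‖ ^ 2 = ‖x‖ ^ 2 := by
    intro x hx
    rw [← b.sum_sq_norm_inner_right (f x), ← e.sum_sq_norm_inner_right x]
    refine Finset.sum_congr rfl fun i _ => ?_
    congr 1
    rw [hb, real_inner_smul_left, norm_mul, Real.norm_eq_abs ⟪h _, f x⟫, hhf _ (heD i) x hx,
      real_inner_smul_left, abs_mul, norm_inv, Real.norm_eq_abs, Real.norm_eq_abs,
      inv_mul_cancel_left₀ (abs_pos.2 hr.ne').ne']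
  intro x hx y hy
  have hfh : f x = h x ∨ f x = -h x := by
    have h1 := hhf x hx x hx
    have h2 := hnormf x hx
    have h3 := hnormh x hx
    rw [real_inner_self_eq_norm_sq, abs_of_nonneg (sq_nonneg ‖x‖), real_inner_comm] at h1
    rcases (abs_eq (sq_nonneg _)).1 h1 with h4 | h4
    · left
      rw [← sub_eq_zero, ← norm_eq_zero, ← sq_eq_zero_iff, norm_sub_sq_real, h2, h3, h4]
      ring
    · right
      rw [← add_eq_zero_iff_eq_neg, ← norm_eq_zero, ← sq_eq_zero_iff, norm_add_sq_real, h2, h3, h4]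
      ring
  rcases hfh with h1 | h1
  · rw [h1, hhf x hx y hy]
  · rw [h1, inner_neg_left, abs_neg, hhf x hx y hy]

theorem stmt_3
    (n : ℕ) (hn : 2 ≤ n)
    (c d : ℝ) (hc : 0 < c) (hc1 : c ≠ 1) (hd : 0 < d)
    (D : Set (EuclideanSpace ℝ (Fin n)))
    (hD : D = if c < 1 then {x : EuclideanSpace ℝ (Fin n) | d ≤ ‖x‖} else {x : EuclideanSpace ℝ (Fin n) | ‖x‖ < d})
    (φ : EuclideanSpace ℝ (Fin n) → EuclideanSpace ℝ (Fin n) → ℝ)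
    (hφnonneg : ∀ x y, 0 ≤ φ x y)
    (hφsymm : ∀ x y, φ x y = φ y x)
    (hφi : ∃ φ₀ : ℝ → ℝ → ℝ, ∀ x y, φ x y = φ₀ ‖x‖ ‖y‖)
    (hφii : ∀ x y : EuclideanSpace ℝ (Fin n), ∃ C : ℝ, 0 < C ∧ ∃ T : ℝ, 1 < T ∧
      ∀ l : ℝ, (if c < 1 then T ≤ |l| else 0 < |l| ∧ |l| ≤ 1 / T) →
        (1 / |l|) * φ (l • x) y ≤ C / abs (Real.log |l|))
    (hφiii : ∀ x y : EuclideanSpace ℝ (Fin n), ∃ C : ℝ, 0 < C ∧ ∃ T : ℝ, 1 < T ∧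
      ∀ l m : ℝ, |l| ≠ 1 → |m| ≠ 1 →
        (if c < 1 then T ≤ |l * m| else 0 < |l * m| ∧ |l * m| ≤ 1 / T) →
        (1 / |l * m|) * φ (l • x) (m • y) ≤ C / (abs (Real.log |l|) * abs (Real.log |m|)))
    (f : EuclideanSpace ℝ (Fin n) → EuclideanSpace ℝ (Fin n))
    (hf : ∀ x ∈ D, ∀ y ∈ D, |abs ⟪f x, f y⟫ - abs ⟪x, y⟫| ≤ φ x y)
 :
    ∀ x ∈ D, x ≠ 0 → ∀ y ∈ D, (⟪x, y⟫ = 0 ↔ ⟪f x, f y⟫ = 0) := by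
  obtain ⟨l, hl, hl1, hlog, hlD, hcond, hcond2⟩ : ∃ l : ℕ → ℝ, (∀ k, 0 < l k) ∧ (∀ k, |l k| ≠ 1) ∧
      Tendsto (fun k => abs (Real.log |l k|)) atTop atTop ∧ (∀ k, ∀ x ∈ D, l k • x ∈ D) ∧
      (∀ T : ℝ, 1 < T → ∀ᶠ k in atTop,
        if c < 1 then T ≤ |l k| else 0 < |l k| ∧ |l k| ≤ 1 / T) ∧
      (∀ T : ℝ, 1 < T → ∀ᶠ k in atTop,
        if c < 1 then T ≤ |l k * l k| else 0 < |l k * l k| ∧ |l k * l k| ≤ 1 / T) := by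
    have hpos : ∀ k : ℕ, (1 : ℝ) < k + 2 := fun k => by linarith [(Nat.cast_nonneg k : (0 : ℝ) ≤ k)]
    have htop : Tendsto (fun k : ℕ => (k : ℝ) + 2) atTop atTop :=
      tendsto_atTop_add_const_right _ _ tendsto_natCast_atTop_atTop
    have hlogtop : Tendsto (fun k : ℕ => |Real.log ((k : ℝ) + 2)|) atTop atTop :=
      tendsto_abs_atTop_atTop.comp (Real.tendsto_log_atTop.comp htop)
    by_cases h : c < 1
    · simp only [h, if_true] at hD ⊢
      refine ⟨fun k => k + 2, fun k => by linarith [hpos k], fun k => ?_, ?_, ?_, ?_, ?_⟩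
      · rw [abs_of_pos (by linarith [hpos k])]
        exact (hpos k).ne'
      · simpa only [Real.log_abs] using hlogtop
      · intro k x hx
        simp only [hD, Set.mem_ofPred_eq] at hx ⊢
        rw [norm_smul, Real.norm_of_nonneg (by linarith [hpos k])]
        nlinarith [hpos k, norm_nonneg x]
      · intro T hT
        filter_upwards [htop.eventually_ge_atTop T] with k hk
        exact hk.trans (le_abs_self _)
      · intro T hT
        filter_upwards [htop.eventually_ge_atTop T] with k hk
        refine le_trans ?_ (le_abs_self _)
        nlinarith [hpos k]
    · simp only [h, if_false] at hD ⊢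
      have hinv : ∀ k : ℕ, 0 < ((k : ℝ) + 2)⁻¹ := fun k => inv_pos.2 (by linarith [hpos k])
      have hinv1 : ∀ k : ℕ, ((k : ℝ) + 2)⁻¹ < 1 := fun k => inv_lt_one_of_one_lt₀ (hpos k)
      have hle : ∀ T : ℝ, 1 < T → ∀ᶠ k : ℕ in atTop, ((k : ℝ) + 2)⁻¹ ≤ 1 / T := by
        intro T hT
        filter_upwards [htop.eventually_ge_atTop T] with k hk
        rw [one_div]
        exact inv_anti₀ (by linarith) hk
      refine ⟨fun k => ((k : ℝ) + 2)⁻¹, hinv, fun k => ?_, ?_, ?_, ?_, ?_⟩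
      · rw [abs_of_pos (hinv k)]
        exact (hinv1 k).ne
      · simpa only [Real.log_abs, Real.log_inv, abs_neg] using hlogtop
      · intro k x hx
        simp only [hD, Set.mem_ofPred_eq] at hx ⊢
        rw [norm_smul, Real.norm_of_nonneg (hinv k).le]
        nlinarith [hinv k, hinv1 k, norm_nonneg x]
      · intro T hT
        filter_upwards [hle T hT] with k hk
        rw [abs_of_pos (hinv k)]
        exact ⟨hinv k, hk⟩
      · intro T hT
        filter_upwards [hle T hT] with k hk
        rw [abs_of_pos (mul_pos (hinv k) (hinv k))]
        exact ⟨mul_pos (hinv k) (hinv k), by nlinarith [hinv k, hinv1 k]⟩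
  obtain ⟨r, hr, hrD⟩ : ∃ r : ℝ, 0 < r ∧ ∀ x, ‖x‖ = r → x ∈ D := by
    refine ⟨if c < 1 then d else d / 2, by split_ifs <;> linarith, fun x hx => ?_⟩
    rw [hD]
    split_ifs at hx ⊢
    · exact hx.ge
    · simp only [Set.mem_ofPred_eq]
      linarith
  have : Nonempty (Fin n) := ⟨⟨0, by omega⟩⟩
  have key := abs_inner_eq_of_tendsto_rescaled hr hrD hl hlD (f := f) ?_ ?_
  · intro x hx _ y hy
    rw [← abs_eq_zero, ← key x hx y hy, abs_eq_zero]
  · intro x hx y hy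
    obtain ⟨C, -, T, hT, hC⟩ := hφii x y
    rw [tendsto_iff_norm_sub_tendsto_zero]
    refine squeeze_zero' (Eventually.of_forall fun k => norm_nonneg _) ?_
      ((tendsto_const_nhds (x := C)).div_atTop hlog)
    filter_upwards [hcond T hT] with k hk
    refine le_trans ?_ (hC _ hk)
    have hk0 := hl k
    have h1 := hf _ (hlD k x hx) y hy
    rw [real_inner_smul_left x, abs_mul, abs_of_pos hk0] at h1
    rw [real_inner_smul_left, abs_mul, abs_of_pos (inv_pos.2 hk0), Real.norm_eq_abs, abs_of_pos hk0,
      one_div]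
    calc abs ((l k)⁻¹ * |⟪f (l k • x), f y⟫| - |⟪x, y⟫|)
        = abs ((l k)⁻¹ * (|⟪f (l k • x), f y⟫| - l k * |⟪x, y⟫|)) := by
          rw [mul_sub, inv_mul_cancel_left₀ hk0.ne']
      _ = (l k)⁻¹ * abs (|⟪f (l k • x), f y⟫| - l k * |⟪x, y⟫|) := by
          rw [abs_mul, abs_of_pos (inv_pos.2 hk0)]
      _ ≤ (l k)⁻¹ * φ (l k • x) y := mul_le_mul_of_nonneg_left h1 (inv_pos.2 hk0).le
  · intro x hx
    obtain ⟨C, hC0, T, hT, hC⟩ := hφiii x x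
    refine ⟨√(‖x‖ ^ 2 + C), ?_⟩
    filter_upwards [hcond2 T hT, hlog.eventually_ge_atTop 1] with k hk hk1
    have hk0 := hl k
    have h1 := (abs_le.1 (hf _ (hlD k x hx) _ (hlD k x hx))).2
    have h2 := hC _ _ (hl1 k) (hl1 k) hk
    have h3 : C / (abs (Real.log |l k|) * abs (Real.log |l k|)) ≤ C :=
      div_le_self hC0.le (by nlinarith)
    rw [abs_of_pos (mul_pos hk0 hk0)] at h2
    rw [real_inner_self_eq_norm_sq, real_inner_self_eq_norm_sq, abs_of_nonneg (sq_nonneg _),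
      abs_of_nonneg (sq_nonneg _), norm_smul, Real.norm_of_nonneg hk0.le] at h1
    refine Real.le_sqrt_of_sq_le ?_
    rw [norm_smul, norm_inv, Real.norm_of_nonneg hk0.le]
    calc ((l k)⁻¹ * ‖f (l k • x)‖) ^ 2
        = 1 / (l k * l k) * ‖f (l k • x)‖ ^ 2 := by field_simp
      _ ≤ 1 / (l k * l k) * ((l k * ‖x‖) ^ 2 + φ (l k • x) (l k • x)) :=
          mul_le_mul_of_nonneg_left (by linarith) (by positivity)
      _ = ‖x‖ ^ 2 + 1 / (l k * l k) * φ (l k • x) (l k • x) := by field_simp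
      _ ≤ ‖x‖ ^ 2 + C := by linarith
end

section
/- Suppose c > 1 (so that 0 ∈ Dₙ) and f : Dₙ → ℝⁿ satisfies inequality (1). Then f(0) = 0. -/
open scoped RealInnerProductSpace

theorem stmt_4
    (n : ℕ) (hn : 2 ≤ n)
    (c d : ℝ) (hc : 0 < c) (hc1 : c ≠ 1) (hd : 0 < d)
    (D : Set (EuclideanSpace ℝ (Fin n)))
    (hD : D = if c < 1 then {x : EuclideanSpace ℝ (Fin n) | d ≤ ‖x‖} else {x : EuclideanSpace ℝ (Fin n) | ‖x‖ < d})
    (φ : EuclideanSpace ℝ (Fin n) → EuclideanSpace ℝ (Fin n) → ℝ)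
    (hφnonneg : ∀ x y, 0 ≤ φ x y)
    (hφsymm : ∀ x y, φ x y = φ y x)
    (hφi : ∃ φ₀ : ℝ → ℝ → ℝ, ∀ x y, φ x y = φ₀ ‖x‖ ‖y‖)
    (hφii : ∀ x y : EuclideanSpace ℝ (Fin n), ∃ C : ℝ, 0 < C ∧ ∃ T : ℝ, 1 < T ∧
      ∀ l : ℝ, (if c < 1 then T ≤ |l| else 0 < |l| ∧ |l| ≤ 1 / T) →
        (1 / |l|) * φ (l • x) y ≤ C / abs (Real.log |l|))
    (hφiii : ∀ x y : EuclideanSpace ℝ (Fin n), ∃ C : ℝ, 0 < C ∧ ∃ T : ℝ, 1 < T ∧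
      ∀ l m : ℝ, |l| ≠ 1 → |m| ≠ 1 →
        (if c < 1 then T ≤ |l * m| else 0 < |l * m| ∧ |l * m| ≤ 1 / T) →
        (1 / |l * m|) * φ (l • x) (m • y) ≤ C / (abs (Real.log |l|) * abs (Real.log |m|)))
    (f : EuclideanSpace ℝ (Fin n) → EuclideanSpace ℝ (Fin n))
    (hcgt : 1 < c)
    (hf : ∀ x ∈ D, ∀ y ∈ D, |abs ⟪f x, f y⟫ - abs ⟪x, y⟫| ≤ φ x y)
 :
    f 0 = 0 := by
  have hφ0 : φ 0 0 = 0 := by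
    by_contra hne
    have hp : 0 < φ 0 0 := lt_of_le_of_ne (hφnonneg 0 0) (Ne.symm hne)
    obtain ⟨C, hC, T, hT, h⟩ := hφii 0 0
    have hlogT : 0 < Real.log T := Real.log_pos hT
    obtain ⟨s, hs⟩ : ∃ s, s = Real.log T + C / φ 0 0 := ⟨_, rfl⟩
    have hCp : 0 < C / φ 0 0 := div_pos hC hp
    have hs0 : 0 < s := by linarith
    have hle : Real.exp (-s) ≤ 1 / T := by
      rw [one_div, ← Real.exp_log (by linarith : 0 < T), ← Real.exp_neg]
      exact Real.exp_le_exp.mpr (by linarith)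
    have key := h (Real.exp (-s)) (by
      rw [if_neg hcgt.not_gt, abs_of_pos (Real.exp_pos _)]
      exact ⟨Real.exp_pos _, hle⟩)
    rw [smul_zero, abs_of_pos (Real.exp_pos _), Real.log_exp, abs_neg, abs_of_pos hs0,
      Real.exp_neg, one_div, inv_inv, le_div_iff₀ hs0] at key
    have hexp : 1 ≤ Real.exp s := Real.one_le_exp hs0.le
    have hps : C < φ 0 0 * s := by
      rw [hs, mul_add, mul_div_cancel₀ _ hp.ne']
      linarith [mul_pos hp hlogT]
    nlinarith [mul_le_mul_of_nonneg_right hexp (mul_pos hp hs0).le]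
  have h0 : (0 : EuclideanSpace ℝ (Fin n)) ∈ D := by
    rw [hD, if_neg hcgt.not_gt]
    simpa using hd
  have h := hf 0 h0 0 h0
  rw [hφ0, inner_zero_left, abs_zero, sub_zero, abs_abs] at h
  exact inner_self_eq_zero.mp (abs_nonpos_iff.mp h)
end

section
/- Suppose f : Dₙ → ℝⁿ satisfies inequality (1). Let k be an integer with 2 ≤ k ≤ n and let x₁, …, x_k ∈ Dₙ. Then x₁, …, x_k are linearly independent over ℝ if and only if f(x₁), …, f(x_k) are linearly independent over ℝ. -/
open scoped RealInnerProductSpace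
open Filter Topology

section

variable {E : Type*} [NormedAddCommGroup E] [InnerProductSpace ℝ E] [FiniteDimensional ℝ E]

/-- A map preserving absolute values of inner products up to an error that is negligible after
rescaling has a rescaled limit which preserves them exactly. -/
theorem exists_rescaled_limit_abs_inner_eq {D : Set E} {φ : E → E → ℝ} {f : E → E}
    (hf : ∀ x ∈ D, ∀ y ∈ D, |abs ⟪f x, f y⟫ - abs ⟪x, y⟫| ≤ φ x y)
    {L : Filter ℝ} [L.NeBot] (hpos : ∀ᶠ l in L, 0 < l)
    (hD : ∀ y, y ≠ 0 → ∀ᶠ l in L, l • y ∈ D)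
    (hφ₁ : ∀ x y, Tendsto (fun l => l⁻¹ * φ (l • x) y) L (𝓝 0))
    (hφ₂ : ∀ x y, Tendsto (fun l => (l * l)⁻¹ * φ (l • x) (l • y)) L (𝓝 0)) :
    ∃ F : E → E, (∀ x, x ≠ 0 → ∀ y ∈ D, |⟪F x, f y⟫| = |⟪x, y⟫|) ∧
      ∀ x, x ≠ 0 → ∀ y, y ≠ 0 → |⟪F x, F y⟫| = |⟪x, y⟫| := by
  have key₂ : ∀ x, x ≠ 0 → ∀ y, y ≠ 0 →
      Tendsto (fun l => |⟪l⁻¹ • f (l • x), l⁻¹ • f (l • y)⟫|) L (𝓝 |⟪x, y⟫|) := by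
    intro x hx y hy
    rw [tendsto_iff_dist_tendsto_zero]
    refine squeeze_zero' (Eventually.of_forall fun _ => dist_nonneg) ?_ (hφ₂ x y)
    filter_upwards [hpos, hD x hx, hD y hy] with l hl hlx hly
    have h := hf _ hlx _ hly
    have h₁ : |⟪l⁻¹ • f (l • x), l⁻¹ • f (l • y)⟫| - |⟪x, y⟫| =
        (l * l)⁻¹ * (|⟪f (l • x), f (l • y)⟫| - |⟪l • x, l • y⟫|) := by
      simp only [real_inner_smul_left, real_inner_smul_right, abs_mul, abs_inv, abs_of_pos hl]
      field_simp
    rw [Real.dist_eq, h₁, abs_mul, abs_of_pos (by positivity)]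
    gcongr
  have key₁ : ∀ x, x ≠ 0 → ∀ y ∈ D,
      Tendsto (fun l => |⟪l⁻¹ • f (l • x), f y⟫|) L (𝓝 |⟪x, y⟫|) := by
    intro x hx y hy
    rw [tendsto_iff_dist_tendsto_zero]
    refine squeeze_zero' (Eventually.of_forall fun _ => dist_nonneg) ?_ (hφ₁ x y)
    filter_upwards [hpos, hD x hx] with l hl hlx
    have h := hf _ hlx _ hy
    have h₁ : |⟪l⁻¹ • f (l • x), f y⟫| - |⟪x, y⟫| =
        l⁻¹ * (|⟪f (l • x), f y⟫| - |⟪l • x, y⟫|) := by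
      simp only [real_inner_smul_left, abs_mul, abs_inv, abs_of_pos hl]
      field_simp
    rw [Real.dist_eq, h₁, abs_mul, abs_of_pos (by positivity)]
    gcongr
  have hlim : ∀ x, ∃ z, x ≠ 0 →
      Tendsto (fun l => l⁻¹ • f (l • x)) (Ultrafilter.of L : Filter ℝ) (𝓝 z) := by
    intro x
    by_cases hx : x = 0
    · exact ⟨0, fun h => absurd hx h⟩
    have hb : ∀ᶠ l in L, l⁻¹ • f (l • x) ∈ Metric.closedBall (0 : E) (‖x‖ + 1) := by
      have h := (key₂ x hx x hx).eventually (gt_mem_nhds (lt_add_one _))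
      filter_upwards [h] with l hl
      rw [mem_closedBall_zero_iff]
      simp only [real_inner_self_eq_norm_sq, abs_of_nonneg (sq_nonneg ‖_‖)] at hl
      nlinarith [norm_nonneg x, norm_nonneg (l⁻¹ • f (l • x))]
    obtain ⟨z, -, hz⟩ := (isCompact_closedBall (0 : E) (‖x‖ + 1)).ultrafilter_le_nhds
      ((Ultrafilter.of L).map fun l => l⁻¹ • f (l • x))
      (le_principal_iff.2 (Ultrafilter.of_le L hb))
    exact ⟨z, fun _ => hz⟩
  choose F hF using hlim
  refine ⟨F, fun x hx y hy => ?_, fun x hx y hy => ?_⟩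
  · exact tendsto_nhds_unique (((hF x hx).inner tendsto_const_nhds).abs)
      ((key₁ x hx y hy).mono_left (Ultrafilter.of_le L))
  · exact tendsto_nhds_unique (((hF x hx).inner (hF y hy)).abs)
      ((key₂ x hx y hy).mono_left (Ultrafilter.of_le L))

/-- Two finite families whose inner products agree in absolute value against all nonzero vectors,
up to a map `F` that itself preserves inner products in absolute value, are simultaneously
linearly independent. -/
theorem linearIndependent_iff_of_abs_inner_eq {ι : Type*} [Fintype ι] {x z : ι → E} {F : E → E}
    (hFz : ∀ y, y ≠ 0 → ∀ i, |⟪F y, z i⟫| = |⟪y, x i⟫|)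
    (hFF : ∀ y, y ≠ 0 → ∀ w, w ≠ 0 → |⟪F y, F w⟫| = |⟪y, w⟫|) :
    LinearIndependent ℝ x ↔ LinearIndependent ℝ z := by
  constructor
  · intro hx
    rw [Fintype.linearIndependent_iff]
    intro g hg i
    have hi := linearIndependent_iff_notMem_span.1 hx i
    rw [← Submodule.orthogonal_orthogonal (Submodule.span ℝ _), Submodule.mem_orthogonal] at hi
    push Not at hi
    obtain ⟨y, hy, hyi⟩ := hi
    have hy0 : y ≠ 0 := by
      rintro rfl
      simp at hyi
    have hj : ∀ j, j ≠ i → ⟪F y, z j⟫ = 0 := by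
      intro j hji
      rw [← abs_eq_zero, hFz y hy0, abs_eq_zero]
      exact (Submodule.mem_orthogonal' _ _).1 hy _
        (Submodule.subset_span ⟨j, by simpa using hji, rfl⟩)
    have h := congrArg (fun v => ⟪F y, v⟫) hg
    simp only [inner_sum, inner_zero_right, real_inner_smul_right] at h
    rw [Finset.sum_eq_single i (fun j _ hji => by rw [hj j hji, mul_zero]) (by simp)] at h
    refine (mul_eq_zero.1 h).resolve_right fun h0 => hyi ?_
    rw [← abs_eq_zero, ← hFz y hy0, h0, abs_zero]
  · intro hz
    rw [linearIndependent_iff_card_le_finrank_span]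
    let S := Submodule.span ℝ (Set.range x)
    let b := stdOrthonormalBasis ℝ Sᗮ
    have hb0 : ∀ j, (b j : E) ≠ 0 := fun j h =>
      b.orthonormal.ne_zero j (Subtype.ext h)
    have hO : Orthonormal ℝ fun j => F (b j) := by
      refine ⟨fun j => ?_, fun j j' hjj => ?_⟩
      · have h := hFF _ (hb0 j) _ (hb0 j)
        have h1 : ‖(b j : E)‖ = 1 := b.orthonormal.1 j
        rw [real_inner_self_eq_norm_sq, real_inner_self_eq_norm_sq, h1,
          abs_of_nonneg (sq_nonneg _)] at h
        rwa [one_pow, abs_one, pow_eq_one_iff_of_nonneg (norm_nonneg _) two_ne_zero] at h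
      · have h1 : ⟪(b j : E), (b j' : E)⟫ = 0 := b.orthonormal.2 hjj
        change ⟪F (b j), F (b j')⟫ = 0
        rw [← abs_eq_zero, hFF _ (hb0 j) _ (hb0 j'), h1, abs_zero]
    let K := Submodule.span ℝ (Set.range fun j => F (b j))
    have hK : Module.finrank ℝ K = Module.finrank ℝ Sᗮ := by
      rw [finrank_span_eq_card hO.linearIndependent, Fintype.card_fin]
    have hzK : Submodule.span ℝ (Set.range z) ≤ Kᗮ := by
      rw [← Submodule.le_orthogonal_iff_le_orthogonal, Submodule.span_le]
      rintro _ ⟨j, rfl⟩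
      rw [SetLike.mem_coe, ← Submodule.span_singleton_le_iff_mem,
        Submodule.le_orthogonal_iff_le_orthogonal, Submodule.span_le]
      rintro _ ⟨i, rfl⟩
      rw [SetLike.mem_coe, Submodule.mem_orthogonal_singleton_iff_inner_right,
        ← abs_eq_zero, hFz _ (hb0 j), abs_eq_zero]
      exact (Submodule.mem_orthogonal' _ _).1 (b j).2 _ (Submodule.subset_span ⟨i, rfl⟩)
    have h₁ := Submodule.finrank_mono hzK
    rw [finrank_span_eq_card hz] at h₁
    have h₂ := K.finrank_add_finrank_orthogonal
    have h₃ := S.finrank_add_finrank_orthogonal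
    change Fintype.card ι ≤ Module.finrank ℝ S
    omega

end

theorem stmt_5
    (n : ℕ) (hn : 2 ≤ n)
    (c d : ℝ) (hc : 0 < c) (hc1 : c ≠ 1) (hd : 0 < d)
    (D : Set (EuclideanSpace ℝ (Fin n)))
    (hD : D = if c < 1 then {x : EuclideanSpace ℝ (Fin n) | d ≤ ‖x‖} else {x : EuclideanSpace ℝ (Fin n) | ‖x‖ < d})
    (φ : EuclideanSpace ℝ (Fin n) → EuclideanSpace ℝ (Fin n) → ℝ)
    (hφnonneg : ∀ x y, 0 ≤ φ x y)
    (hφsymm : ∀ x y, φ x y = φ y x)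
    (hφi : ∃ φ₀ : ℝ → ℝ → ℝ, ∀ x y, φ x y = φ₀ ‖x‖ ‖y‖)
    (hφii : ∀ x y : EuclideanSpace ℝ (Fin n), ∃ C : ℝ, 0 < C ∧ ∃ T : ℝ, 1 < T ∧
      ∀ l : ℝ, (if c < 1 then T ≤ |l| else 0 < |l| ∧ |l| ≤ 1 / T) →
        (1 / |l|) * φ (l • x) y ≤ C / abs (Real.log |l|))
    (hφiii : ∀ x y : EuclideanSpace ℝ (Fin n), ∃ C : ℝ, 0 < C ∧ ∃ T : ℝ, 1 < T ∧
      ∀ l m : ℝ, |l| ≠ 1 → |m| ≠ 1 →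
        (if c < 1 then T ≤ |l * m| else 0 < |l * m| ∧ |l * m| ≤ 1 / T) →
        (1 / |l * m|) * φ (l • x) (m • y) ≤ C / (abs (Real.log |l|) * abs (Real.log |m|)))
    (f : EuclideanSpace ℝ (Fin n) → EuclideanSpace ℝ (Fin n))
    (hf : ∀ x ∈ D, ∀ y ∈ D, |abs ⟪f x, f y⟫ - abs ⟪x, y⟫| ≤ φ x y)
    (k : ℕ) (hk2 : 2 ≤ k) (hkn : k ≤ n)
    (x : Fin k → EuclideanSpace ℝ (Fin n)) (hx : ∀ i, x i ∈ D) :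
    LinearIndependent ℝ x ↔ LinearIndependent ℝ (fun i => f (x i)) := by
  have main : ∀ L : Filter ℝ, L.NeBot → (∀ᶠ l in L, 0 < l) →
      (∀ y : EuclideanSpace ℝ (Fin n), y ≠ 0 → ∀ᶠ l in L, l • y ∈ D) →
      (∀ T : ℝ, 1 < T → ∀ᶠ l in L, if c < 1 then T ≤ |l| else 0 < |l| ∧ |l| ≤ 1 / T) →
      Tendsto (fun l : ℝ => l * l) L L → Tendsto (fun l => |Real.log l|) L atTop →
      (LinearIndependent ℝ x ↔ LinearIndependent ℝ (fun i => f (x i))) := by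
    intro L hL hpos hLD hT hsq hlog
    have hφ₁ : ∀ x y, Tendsto (fun l => l⁻¹ * φ (l • x) y) L (𝓝 0) := by
      intro x y
      obtain ⟨C, -, T, hT1, h⟩ := hφii x y
      refine squeeze_zero' ?_ ?_ (hlog.const_div_atTop C)
      · filter_upwards [hpos] with l hl
        exact mul_nonneg (inv_nonneg.2 hl.le) (hφnonneg _ _)
      · filter_upwards [hpos, hT T hT1] with l hl hlT
        simpa only [abs_of_pos hl, one_div] using h l hlT
    have hφ₂ : ∀ x y, Tendsto (fun l => (l * l)⁻¹ * φ (l • x) (l • y)) L (𝓝 0) := by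
      intro x y
      obtain ⟨C, -, T, hT1, h⟩ := hφiii x y
      refine squeeze_zero' ?_ ?_ ((hlog.atTop_mul_atTop₀ hlog).const_div_atTop C)
      · filter_upwards with l
        exact mul_nonneg (inv_nonneg.2 (mul_self_nonneg l)) (hφnonneg _ _)
      · filter_upwards [hpos, hsq.eventually (hT T hT1), hlog.eventually_gt_atTop 0]
          with l hl hlT hl0
        have hl1 : |l| ≠ 1 := by
          intro h1
          rw [← Real.log_abs, h1, Real.log_one, abs_zero] at hl0
          exact lt_irrefl _ hl0
        simpa only [abs_of_pos hl, abs_of_pos (mul_pos hl hl), one_div] using h l l hl1 hl1 hlT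
    obtain ⟨F, hF, hFF⟩ := exists_rescaled_limit_abs_inner_eq hf hpos hLD hφ₁ hφ₂
    exact linearIndependent_iff_of_abs_inner_eq (fun y hy i => hF y hy _ (hx i)) hFF
  by_cases hlt : c < 1
  · simp only [if_pos hlt] at hD main
    refine main atTop inferInstance (eventually_gt_atTop 0) ?_ ?_
      (tendsto_id.atTop_mul_atTop₀ tendsto_id)
      (tendsto_abs_atTop_atTop.comp Real.tendsto_log_atTop)
    · intro y hy
      filter_upwards [eventually_ge_atTop (d / ‖y‖), eventually_gt_atTop 0] with l hl hl0
      rw [hD, Set.mem_ofPred_eq, norm_smul, Real.norm_of_nonneg hl0.le]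
      exact (div_le_iff₀ (norm_pos_iff.2 hy)).1 hl
    · intro T _
      filter_upwards [eventually_ge_atTop T] with l hl using hl.trans (le_abs_self l)
  · simp only [if_neg hlt] at hD main
    have hpos : ∀ᶠ l : ℝ in 𝓝[>] 0, 0 < l := eventually_mem_nhdsWithin
    refine main (𝓝[>] 0) inferInstance hpos ?_ ?_ ?_
      (tendsto_abs_atBot_atTop.comp Real.tendsto_log_nhdsGT_zero)
    · intro y _
      have h : Tendsto (fun l : ℝ => ‖l • y‖) (𝓝 0) (𝓝 0) :=
        Continuous.tendsto' (by fun_prop) _ _ (by simp)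
      rw [hD]
      exact (h.mono_left nhdsWithin_le_nhds).eventually (gt_mem_nhds hd)
    · intro T hT
      have hT0 : 0 < 1 / T := by positivity
      filter_upwards [hpos, Ioc_mem_nhdsGT hT0] with l hl hlT
      rw [abs_of_pos hl]
      exact ⟨hl, hlT.2⟩
    · refine tendsto_nhdsWithin_iff.2 ⟨?_, ?_⟩
      · exact (Continuous.tendsto' (by fun_prop) _ _ (by simp)).mono_left nhdsWithin_le_nhds
      · filter_upwards [hpos] with l hl using mul_pos hl hl
end

section
/- Suppose f : Dₙ → ℝⁿ satisfies inequality (1). Let k be an integer with 2 ≤ k ≤ n, let 𝒫 be a k-dimensional linear subspace of ℝⁿ, and let y₁, …, y_k ∈ 𝒫 ∩ Dₙ be a basis of 𝒫. Then f maps 𝒫 ∩ Dₙ into the subspace span{f(y₁), …, f(y_k)} of ℝⁿ, and span{f(y₁), …, f(y_k)} has dimension k. -/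
open scoped RealInnerProductSpace

open Filter Topology

/-- Families whose matrix of inner products vanishes exactly off the diagonal are
linearly independent. -/
lemma linearIndependent_of_inner_eq_zero_iff {ι E : Type*} [NormedAddCommGroup E]
    [InnerProductSpace ℝ E] (a b : ι → E) (hdiag : ∀ i, ⟪a i, b i⟫ ≠ 0)
    (hoff : ∀ i j, i ≠ j → ⟪a i, b j⟫ = 0) : LinearIndependent ℝ b := by
  rw [linearIndependent_iff']
  intro s g hg i hi
  have h : ⟪a i, ∑ j ∈ s, g j • b j⟫ = g i * ⟪a i, b i⟫ := by
    rw [inner_sum, Finset.sum_eq_single i]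
    · rw [inner_smul_right]
    · intro j _ hj
      rw [inner_smul_right, hoff i j hj.symm, mul_zero]
    · exact fun h => absurd hi h
  rw [hg, inner_zero_right] at h
  exact (mul_eq_zero.1 h.symm).resolve_right (hdiag i)

/-- A linearly independent family in a finite-dimensional inner product space has a
biorthogonal family. -/
lemma exists_biorthogonal {ι E : Type*} [Finite ι] [DecidableEq ι] [NormedAddCommGroup E]
    [InnerProductSpace ℝ E] [FiniteDimensional ℝ E] (y : ι → E) (hy : LinearIndependent ℝ y) :
    ∃ z : ι → E, ∀ i j, ⟪z i, y j⟫ = if i = j then 1 else 0 := by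
  let B := Module.Basis.sumExtend hy
  refine ⟨fun i => (InnerProductSpace.toDual ℝ E).symm
    (LinearMap.toContinuousLinearMap (B.coord (Sum.inl i))), fun i j => ?_⟩
  have hB : B (Sum.inl j) = y j := by
    simp [B, Module.Basis.sumExtend]
    rfl
  rw [InnerProductSpace.toDual_symm_apply, ← hB]
  classical simp [Finsupp.single_apply, eq_comm (a := j)]

/-- If a bounded sequence `u` has inner products with the values of `f` on `D` whose moduli
tend to those of `⟪x, y⟫`, then some vector attains exactly these moduli. -/
lemma exists_abs_inner_eq_of_tendsto {E : Type*} [NormedAddCommGroup E] [InnerProductSpace ℝ E]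
    [FiniteDimensional ℝ E] (D : Set E) (f : E → E) (x : E) (u : ℕ → E) (R : ℝ)
    (hu : ∀ᶠ m in atTop, ‖u m‖ ≤ R)
    (h : ∀ y ∈ D, Tendsto (fun m => |⟪u m, f y⟫|) atTop (𝓝 |⟪x, y⟫|)) :
    ∃ g : E, ∀ y ∈ D, |⟪g, f y⟫| = |⟪x, y⟫| := by
  obtain ⟨g, -, ψ, hψ, hg⟩ := tendsto_subseq_of_frequently_bounded
    (Metric.isBounded_closedBall (x := (0 : E)) (r := R))
    (hu.mono fun m hm => by simpa using hm).frequently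
  refine ⟨g, fun y hy => ?_⟩
  have h1 : Tendsto (fun m => |⟪(u ∘ ψ) m, f y⟫|) atTop (𝓝 |⟪g, f y⟫|) :=
    (hg.inner tendsto_const_nhds).abs
  exact tendsto_nhds_unique h1 ((h y hy).comp hψ.tendsto_atTop)

/-- Scaling factors that tend to the end of the positive half-line in whose direction `D`
is invariant. -/
lemma exists_scaling {E : Type*} [NormedAddCommGroup E] [InnerProductSpace ℝ E]
    (c d : ℝ) (hd : 0 < d) (D : Set E)
    (hD : D = if c < 1 then {x : E | d ≤ ‖x‖} else {x : E | ‖x‖ < d}) :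
    ∃ l : ℕ → ℝ, (∀ m, 0 < l m) ∧ (∀ m, |Real.log (l m)| = m + 1) ∧
      (∀ T : ℝ, 1 < T → ∀ᶠ m in atTop, if c < 1 then T ≤ |l m| else 0 < |l m| ∧ |l m| ≤ 1 / T) ∧
      (∀ T : ℝ, 1 < T → ∀ᶠ m in atTop,
        if c < 1 then T ≤ |l m * l m| else 0 < |l m * l m| ∧ |l m * l m| ≤ 1 / T) ∧
      ∀ x : E, x ≠ 0 → ∀ᶠ m in atTop, l m • x ∈ D := by
  have hpos (m : ℕ) : (0 : ℝ) < m + 1 := by positivity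
  have htop : Tendsto (fun m : ℕ => (m : ℝ) + 1) atTop atTop :=
    tendsto_atTop_add_const_right _ _ tendsto_natCast_atTop_atTop
  by_cases hc : c < 1
  · have hl := Real.tendsto_exp_atTop.comp htop
    refine ⟨fun m => Real.exp (m + 1), fun m => Real.exp_pos _, fun m => ?_, fun T _ => ?_,
      fun T _ => ?_, fun x hx => ?_⟩
    · rw [Real.log_exp, abs_of_pos (hpos m)]
    · simp only [hc, if_true, Real.abs_exp]
      exact hl.eventually_ge_atTop T
    · simp only [hc, if_true, abs_mul, Real.abs_exp]
      exact (hl.atTop_mul_atTop₀ hl).eventually_ge_atTop T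
    · simp only [hD, hc, if_true, Set.mem_ofPred_eq, norm_smul, Real.norm_eq_abs, Real.abs_exp]
      exact (hl.atTop_mul_const (norm_pos_iff.2 hx)).eventually_ge_atTop d
  · have hl : Tendsto (fun m : ℕ => Real.exp (-((m : ℝ) + 1))) atTop (𝓝 0) :=
      Real.tendsto_exp_neg_atTop_nhds_zero.comp htop
    refine ⟨fun m => Real.exp (-((m : ℝ) + 1)), fun m => Real.exp_pos _, fun m => ?_,
      fun T hT => ?_, fun T hT => ?_, fun x hx => ?_⟩
    · rw [Real.log_exp, abs_neg, abs_of_pos (hpos m)]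
    · simp only [hc, if_false, Real.abs_exp, Real.exp_pos, true_and]
      exact hl.eventually_le_const (by positivity)
    · simp only [hc, if_false, abs_mul, Real.abs_exp, Real.exp_pos, mul_pos, true_and]
      exact (hl.mul hl).eventually_le_const (by rw [mul_zero]; positivity)
    · simp only [hD, hc, if_false, Set.mem_ofPred_eq, norm_smul, Real.norm_eq_abs, Real.abs_exp]
      exact (hl.mul_const ‖x‖).eventually_lt_const (by simpa using hd)

/-- An approximately Wigner-type map admits, for each nonzero `x`, a vector whose inner products
with the values of the map have exactly the right moduli. -/
lemma exists_abs_inner_eq {E : Type*} [NormedAddCommGroup E] [InnerProductSpace ℝ E]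
    [FiniteDimensional ℝ E] (c d : ℝ) (hd : 0 < d) (D : Set E)
    (hD : D = if c < 1 then {x : E | d ≤ ‖x‖} else {x : E | ‖x‖ < d})
    (φ : E → E → ℝ)
    (hφii : ∀ x y : E, ∃ C : ℝ, 0 < C ∧ ∃ T : ℝ, 1 < T ∧
      ∀ l : ℝ, (if c < 1 then T ≤ |l| else 0 < |l| ∧ |l| ≤ 1 / T) →
        (1 / |l|) * φ (l • x) y ≤ C / abs (Real.log |l|))
    (hφiii : ∀ x y : E, ∃ C : ℝ, 0 < C ∧ ∃ T : ℝ, 1 < T ∧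
      ∀ l m : ℝ, |l| ≠ 1 → |m| ≠ 1 →
        (if c < 1 then T ≤ |l * m| else 0 < |l * m| ∧ |l * m| ≤ 1 / T) →
        (1 / |l * m|) * φ (l • x) (m • y) ≤ C / (abs (Real.log |l|) * abs (Real.log |m|)))
    (f : E → E) (hf : ∀ x ∈ D, ∀ y ∈ D, |abs ⟪f x, f y⟫ - abs ⟪x, y⟫| ≤ φ x y)
    (x : E) (hx : x ≠ 0) :
    ∃ g : E, ∀ y ∈ D, |⟪g, f y⟫| = |⟪x, y⟫| := by
  obtain ⟨l, hl, hlog, hT, hTT, hlD⟩ := exists_scaling c d hd D hD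
  have hl1 (m : ℕ) : l m ≠ 1 := by
    intro h
    have := hlog m
    rw [h, Real.log_one, abs_zero] at this
    linarith [(Nat.cast_nonneg m : (0 : ℝ) ≤ m)]
  obtain ⟨C', hC', T', hT', h'⟩ := hφiii x x
  refine exists_abs_inner_eq_of_tendsto D f x (fun m => (l m)⁻¹ • f (l m • x))
    (√(‖x‖ ^ 2 + C')) ?_ fun y hy => ?_
  · filter_upwards [hTT T' hT', hlD x hx] with m hm hmD
    have h1 := h' (l m) (l m) (by rw [abs_of_pos (hl m)]; exact hl1 m)
      (by rw [abs_of_pos (hl m)]; exact hl1 m) hm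
    rw [abs_of_pos (mul_pos (hl m) (hl m)), abs_of_pos (hl m), hlog] at h1
    have h2 : C' / (((m : ℝ) + 1) * (m + 1)) ≤ C' :=
      div_le_self hC'.le (by nlinarith [(Nat.cast_nonneg m : (0 : ℝ) ≤ m)])
    have h3 := (abs_le.1 (hf _ hmD _ hmD)).2
    rw [real_inner_self_eq_norm_sq, real_inner_self_eq_norm_sq, abs_of_nonneg (sq_nonneg _),
      abs_of_nonneg (sq_nonneg _), norm_smul, Real.norm_eq_abs, abs_of_pos (hl m)] at h3
    have h4 := h1.trans h2
    rw [one_div, inv_mul_le_iff₀ (mul_pos (hl m) (hl m))] at h4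
    apply Real.le_sqrt_of_sq_le
    rw [norm_smul, norm_inv, Real.norm_eq_abs, abs_of_pos (hl m), mul_pow, inv_pow,
      inv_mul_le_iff₀ (pow_pos (hl m) 2)]
    nlinarith
  · obtain ⟨C, -, T, hT1, h⟩ := hφii x y
    rw [tendsto_iff_norm_sub_tendsto_zero]
    have hz : Tendsto (fun m : ℕ => C / ((m : ℝ) + 1)) atTop (𝓝 0) :=
      tendsto_const_nhds.div_atTop
        (tendsto_atTop_add_const_right _ _ tendsto_natCast_atTop_atTop)
    refine squeeze_zero' (Eventually.of_forall fun _ => norm_nonneg _) ?_ hz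
    filter_upwards [hT T hT1, hlD x hx] with m hm hmD
    have h1 := h (l m) hm
    rw [abs_of_pos (hl m), hlog] at h1
    refine le_trans ?_ h1
    have h3 := hf _ hmD y hy
    rw [real_inner_smul_left, abs_mul, abs_of_pos (hl m)] at h3
    rw [one_div, real_inner_smul_left, abs_mul, abs_of_pos (inv_pos.2 (hl m)), Real.norm_eq_abs,
      le_inv_mul_iff₀ (hl m)]
    calc l m * abs ((l m)⁻¹ * |⟪f (l m • x), f y⟫| - |⟪x, y⟫|)
        = abs (l m * ((l m)⁻¹ * |⟪f (l m • x), f y⟫| - |⟪x, y⟫|)) := by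
          rw [abs_mul, abs_of_pos (hl m)]
      _ = abs (|⟪f (l m • x), f y⟫| - l m * |⟪x, y⟫|) := by
          rw [mul_sub, mul_inv_cancel_left₀ (hl m).ne']
      _ ≤ _ := h3

theorem stmt_6
    (n : ℕ) (hn : 2 ≤ n)
    (c d : ℝ) (hc : 0 < c) (hc1 : c ≠ 1) (hd : 0 < d)
    (D : Set (EuclideanSpace ℝ (Fin n)))
    (hD : D = if c < 1 then {x : EuclideanSpace ℝ (Fin n) | d ≤ ‖x‖} else {x : EuclideanSpace ℝ (Fin n) | ‖x‖ < d})
    (φ : EuclideanSpace ℝ (Fin n) → EuclideanSpace ℝ (Fin n) → ℝ)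
    (hφnonneg : ∀ x y, 0 ≤ φ x y)
    (hφsymm : ∀ x y, φ x y = φ y x)
    (hφi : ∃ φ₀ : ℝ → ℝ → ℝ, ∀ x y, φ x y = φ₀ ‖x‖ ‖y‖)
    (hφii : ∀ x y : EuclideanSpace ℝ (Fin n), ∃ C : ℝ, 0 < C ∧ ∃ T : ℝ, 1 < T ∧
      ∀ l : ℝ, (if c < 1 then T ≤ |l| else 0 < |l| ∧ |l| ≤ 1 / T) →
        (1 / |l|) * φ (l • x) y ≤ C / abs (Real.log |l|))
    (hφiii : ∀ x y : EuclideanSpace ℝ (Fin n), ∃ C : ℝ, 0 < C ∧ ∃ T : ℝ, 1 < T ∧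
      ∀ l m : ℝ, |l| ≠ 1 → |m| ≠ 1 →
        (if c < 1 then T ≤ |l * m| else 0 < |l * m| ∧ |l * m| ≤ 1 / T) →
        (1 / |l * m|) * φ (l • x) (m • y) ≤ C / (abs (Real.log |l|) * abs (Real.log |m|)))
    (f : EuclideanSpace ℝ (Fin n) → EuclideanSpace ℝ (Fin n))
    (hf : ∀ x ∈ D, ∀ y ∈ D, |abs ⟪f x, f y⟫ - abs ⟪x, y⟫| ≤ φ x y)
    (k : ℕ) (hk2 : 2 ≤ k) (hkn : k ≤ n)
    (P : Submodule ℝ (EuclideanSpace ℝ (Fin n))) (hPdim : Module.finrank ℝ P = k)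
    (y : Fin k → EuclideanSpace ℝ (Fin n)) (hyP : ∀ i, y i ∈ P) (hyD : ∀ i, y i ∈ D)
    (hyli : LinearIndependent ℝ y)
    (hyspan : Submodule.span ℝ (Set.range y) = P) :
    (∀ x, x ∈ P → x ∈ D → f x ∈ Submodule.span ℝ (Set.range (fun i => f (y i)))) ∧
      Module.finrank ℝ (Submodule.span ℝ (Set.range (fun i => f (y i)))) = k := by
  have hg := exists_abs_inner_eq c d hd D hD φ hφii hφiii f hf
  have hg' (x : EuclideanSpace ℝ (Fin n)) : ∃ g, ∀ y ∈ D, |⟪g, f y⟫| = |⟪x, y⟫| := by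
    by_cases hx : x = 0
    · exact ⟨0, fun y _ => by simp [hx]⟩
    · exact hg x hx
  choose g hg using hg'
  have hg0 {x z : EuclideanSpace ℝ (Fin n)} (hz : z ∈ D) : ⟪g x, f z⟫ = 0 ↔ ⟪x, z⟫ = 0 := by
    rw [← abs_eq_zero, hg x z hz, abs_eq_zero]
  obtain ⟨z, hz⟩ := exists_biorthogonal y hyli
  have hfy : LinearIndependent ℝ fun i => f (y i) := by
    refine linearIndependent_of_inner_eq_zero_iff (fun i => g (z i)) _ (fun i => ?_)
      fun i j hij => ?_
    · rw [Ne, hg0 (hyD i), hz]; simp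
    · rw [hg0 (hyD j), hz, if_neg hij]
  have hfin : Module.finrank ℝ (Submodule.span ℝ (Set.range fun i => f (y i))) = k := by
    rw [finrank_span_eq_card hfy, Fintype.card_fin]
  refine ⟨fun x hxP hxD => ?_, hfin⟩
  let w := stdOrthonormalBasis ℝ Pᗮ
  have hw (i) : (w i : EuclideanSpace ℝ (Fin n)) ≠ 0 := fun h =>
    w.orthonormal.ne_zero i (Subtype.ext h)
  obtain ⟨l, hl, -, -, -, hlD⟩ := exists_scaling c d hd D hD
  choose s hs using fun i => (hlD (w i) (hw i)).exists
  have hgw : LinearIndependent ℝ fun i => g (w i) := by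
    refine linearIndependent_of_inner_eq_zero_iff (fun i => f (l (s i) • (w i))) _ (fun i => ?_)
      fun i j hij => ?_
    · rw [real_inner_comm, Ne, hg0 (hs i), inner_smul_right, real_inner_self_eq_norm_sq]
      exact mul_ne_zero (hl _).ne' (pow_ne_zero _ (norm_ne_zero_iff.2 (hw i)))
    · rw [real_inner_comm, hg0 (hs i), inner_smul_right, ← Submodule.coe_inner,
        w.orthonormal.2 hij.symm, mul_zero]
  let W := (Submodule.span ℝ (Set.range fun i => g (w i)))ᗮ
  have hW : ∀ x ∈ P, x ∈ D → f x ∈ W := by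
    intro x hxP hxD
    refine (Submodule.mem_orthogonal _ _).2 fun u hu => ?_
    induction hu using Submodule.span_induction with
    | mem u hu =>
      obtain ⟨i, rfl⟩ := hu
      exact (hg0 hxD).2 ((Submodule.mem_orthogonal' _ _).1 (w i).2 x hxP)
    | zero => exact inner_zero_left _
    | add u v _ _ hu hv => rw [inner_add_left, hu, hv, add_zero]
    | smul a u _ hu => rw [inner_smul_left, hu, mul_zero]
  have hWdim : Module.finrank ℝ W = k := by
    have h1 := Submodule.finrank_add_finrank_orthogonal
      (Submodule.span ℝ (Set.range fun i => g (w i)))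
    have h2 := Submodule.finrank_add_finrank_orthogonal P
    rw [finrank_span_eq_card hgw, Fintype.card_fin] at h1
    change _ + Module.finrank ℝ W = _ at h1
    omega
  have hle : Submodule.span ℝ (Set.range fun i => f (y i)) ≤ W := by
    rw [Submodule.span_le]
    rintro _ ⟨i, rfl⟩
    exact hW _ (hyP i) (hyD i)
  rw [Submodule.eq_of_le_of_finrank_eq hle (hfin.trans hWdim.symm)]
  exact hW x hxP hxD
end

section
/- Suppose f : Dₙ → ℝⁿ satisfies inequality (1). Then for all x, y ∈ Dₙ (note that c^{−k}x ∈ Dₙ and c^{−k}y ∈ Dₙ for every k ∈ ℕ), the sequence k ↦ c^{2k}·‖f(c^{−k}x)‖·‖f(c^{−k}y)‖ converges to ‖x‖·‖y‖ as k → ∞. -/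
open scoped RealInnerProductSpace

theorem stmt_7
    (n : ℕ) (hn : 2 ≤ n)
    (c d : ℝ) (hc : 0 < c) (hc1 : c ≠ 1) (hd : 0 < d)
    (D : Set (EuclideanSpace ℝ (Fin n)))
    (hD : D = if c < 1 then {x : EuclideanSpace ℝ (Fin n) | d ≤ ‖x‖} else {x : EuclideanSpace ℝ (Fin n) | ‖x‖ < d})
    (φ : EuclideanSpace ℝ (Fin n) → EuclideanSpace ℝ (Fin n) → ℝ)
    (hφnonneg : ∀ x y, 0 ≤ φ x y)
    (hφsymm : ∀ x y, φ x y = φ y x)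
    (hφi : ∃ φ₀ : ℝ → ℝ → ℝ, ∀ x y, φ x y = φ₀ ‖x‖ ‖y‖)
    (hφii : ∀ x y : EuclideanSpace ℝ (Fin n), ∃ C : ℝ, 0 < C ∧ ∃ T : ℝ, 1 < T ∧
      ∀ l : ℝ, (if c < 1 then T ≤ |l| else 0 < |l| ∧ |l| ≤ 1 / T) →
        (1 / |l|) * φ (l • x) y ≤ C / abs (Real.log |l|))
    (hφiii : ∀ x y : EuclideanSpace ℝ (Fin n), ∃ C : ℝ, 0 < C ∧ ∃ T : ℝ, 1 < T ∧
      ∀ l m : ℝ, |l| ≠ 1 → |m| ≠ 1 →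
        (if c < 1 then T ≤ |l * m| else 0 < |l * m| ∧ |l * m| ≤ 1 / T) →
        (1 / |l * m|) * φ (l • x) (m • y) ≤ C / (abs (Real.log |l|) * abs (Real.log |m|)))
    (f : EuclideanSpace ℝ (Fin n) → EuclideanSpace ℝ (Fin n))
    (hf : ∀ x ∈ D, ∀ y ∈ D, |abs ⟪f x, f y⟫ - abs ⟪x, y⟫| ≤ φ x y)
 :
    ∀ x ∈ D, ∀ y ∈ D,
      Filter.Tendsto
        (fun k : ℕ => c ^ (2 * k) * ‖f ((c ^ k)⁻¹ • x)‖ * ‖f ((c ^ k)⁻¹ • y)‖)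
        Filter.atTop (nhds (‖x‖ * ‖y‖)) := by
  have hmem : ∀ x ∈ D, ∀ k : ℕ, (c ^ k)⁻¹ • x ∈ D := by
    intro x hx k
    have hk : 0 < c ^ k := pow_pos hc k
    have hnorm : ‖(c ^ k)⁻¹ • x‖ = (c ^ k)⁻¹ * ‖x‖ := by
      rw [norm_smul, Real.norm_eq_abs, abs_of_pos (inv_pos.2 hk)]
    by_cases h : c < 1
    · simp only [hD, h, if_true, Set.mem_ofPred_eq, hnorm] at hx ⊢
      exact hx.trans (le_mul_of_one_le_left (norm_nonneg x)
        ((one_le_inv₀ hk).2 (pow_le_one₀ hc.le h.le)))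
    · simp only [hD, h, if_false, Set.mem_ofPred_eq, hnorm] at hx ⊢
      exact (mul_le_of_le_one_left (norm_nonneg x)
        (inv_le_one_of_one_le₀ (one_le_pow₀ (not_lt.1 h)))).trans_lt hx
  have hlim : ∀ x ∈ D, Filter.Tendsto (fun k : ℕ => c ^ k * ‖f ((c ^ k)⁻¹ • x)‖)
      Filter.atTop (nhds ‖x‖) := by
    intro x hx
    obtain ⟨C, hC, T, hT, hb⟩ := hφiii x x
    have hlog : Real.log c ≠ 0 := Real.log_ne_zero_of_pos_of_ne_one hc hc1
    have hlogk : ∀ k : ℕ, abs (Real.log |(c ^ k)⁻¹|) = k * |Real.log c| := by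
      intro k
      rw [Real.log_abs, Real.log_inv, Real.log_pow, abs_neg, abs_mul, Nat.abs_cast]
    have hscale : ∀ᶠ k : ℕ in Filter.atTop,
        if c < 1 then T ≤ |(c ^ k)⁻¹ * (c ^ k)⁻¹|
        else 0 < |(c ^ k)⁻¹ * (c ^ k)⁻¹| ∧ |(c ^ k)⁻¹ * (c ^ k)⁻¹| ≤ 1 / T := by
      have habs : ∀ k : ℕ, |(c ^ k)⁻¹ * (c ^ k)⁻¹| = ((c * c)⁻¹) ^ k := by
        intro k
        rw [abs_of_pos (by positivity), ← mul_inv, ← mul_pow, inv_pow]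
      simp only [habs]
      by_cases h : c < 1
      · simp only [h, if_true]
        exact (tendsto_pow_atTop_atTop_of_one_lt
          ((one_lt_inv₀ (mul_pos hc hc)).2 (by nlinarith))).eventually_ge_atTop T
      · simp only [h, if_false]
        have h1 : 1 < c := lt_of_le_of_ne (not_lt.1 h) hc1.symm
        have h0 := tendsto_pow_atTop_nhds_zero_of_lt_one (r := (c * c)⁻¹) (by positivity)
          (inv_lt_one_of_one_lt₀ (by nlinarith))
        filter_upwards [h0.eventually (ge_mem_nhds (show (0 : ℝ) < 1 / T by positivity))] with k hk
        exact ⟨by positivity, hk⟩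
    have hsq : Filter.Tendsto (fun k : ℕ => (c ^ k * ‖f ((c ^ k)⁻¹ • x)‖) ^ 2)
        Filter.atTop (nhds (‖x‖ ^ 2)) := by
      rw [tendsto_iff_dist_tendsto_zero]
      have hlog_top : Filter.Tendsto (fun k : ℕ => (k : ℝ) * |Real.log c|)
          Filter.atTop Filter.atTop :=
        tendsto_natCast_atTop_atTop.atTop_mul_const (abs_pos.2 hlog)
      refine squeeze_zero' (Filter.Eventually.of_forall fun k => dist_nonneg) ?_
        ((hlog_top.atTop_mul_atTop₀ hlog_top).const_div_atTop C)
      filter_upwards [hscale, Filter.eventually_ge_atTop 1] with k hk hk1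
      have hne : |(c ^ k)⁻¹| ≠ 1 := by
        intro h
        have hz := hlogk k
        rw [h, Real.log_one, abs_zero] at hz
        have : (0 : ℝ) < k := by exact_mod_cast hk1
        exact (mul_pos this (abs_pos.2 hlog)).ne hz
      have hbk := hb _ _ hne hne hk
      rw [hlogk] at hbk
      refine le_trans ?_ hbk
      have hp : 0 < c ^ k := pow_pos hc k
      have hfk := hf _ (hmem x hx k) _ (hmem x hx k)
      rw [real_inner_self_eq_norm_sq, real_inner_self_eq_norm_sq, abs_sq, abs_sq, norm_smul, Real.norm_eq_abs,
        abs_of_pos (inv_pos.2 hp)] at hfk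
      have hcoef : 1 / |(c ^ k)⁻¹ * (c ^ k)⁻¹| = (c ^ k) ^ 2 := by
        rw [abs_of_pos (by positivity)]
        field_simp
      rw [hcoef, Real.dist_eq]
      calc |(c ^ k * ‖f ((c ^ k)⁻¹ • x)‖) ^ 2 - ‖x‖ ^ 2|
          = (c ^ k) ^ 2 * |‖f ((c ^ k)⁻¹ • x)‖ ^ 2 - ((c ^ k)⁻¹ * ‖x‖) ^ 2| := by
            rw [← abs_of_pos (pow_pos hp 2), ← abs_mul]
            congr 1
            field_simp
        _ ≤ _ := mul_le_mul_of_nonneg_left hfk (by positivity)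
    have hroot := hsq.sqrt
    rw [Real.sqrt_sq (norm_nonneg x)] at hroot
    refine hroot.congr fun k => Real.sqrt_sq (by positivity)
  intro x hx y hy
  refine ((hlim x hx).mul (hlim y hy)).congr fun k => ?_
  ring
end

section
/- Suppose f : Dₙ → ℝⁿ satisfies inequality (1). Then for all x, y ∈ Dₙ with x ≠ 0 and y ≠ 0, the absolute values of the cosines of the angles agree: ‖x‖·‖y‖·|⟨f(x), f(y)⟩| = ‖f(x)‖·‖f(y)‖·|⟨x, y⟩| (equivalently, |cos A(f(x), f(y))| = |cos A(x, y)|, where A denotes the angle between two nonzero vectors). -/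
open scoped RealInnerProductSpace

open Filter Topology

section RescaledLimit

variable {E : Type*} [NormedAddCommGroup E] [InnerProductSpace ℝ E]

/-- Vectors of equal norm attaining equality in Cauchy–Schwarz agree up to sign. -/
lemma eq_or_eq_neg_of_abs_inner_eq {u v : E} {r : ℝ} (hu : ‖u‖ = r) (hv : ‖v‖ = r)
    (h : |⟪u, v⟫| = r * r) : v = u ∨ v = -u := by
  rcases abs_choice ⟪u, v⟫ with h' | h' <;> rw [h'] at h
  · left
    have : ‖v - u‖ ^ 2 = 0 := by
      rw [norm_sub_sq_real, real_inner_comm, h, hu, hv]; ring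
    exact sub_eq_zero.1 (norm_eq_zero.1 (pow_eq_zero_iff two_ne_zero |>.1 this))
  · right
    have : ‖v + u‖ ^ 2 = 0 := by
      rw [norm_add_sq_real, real_inner_comm, hu, hv]; linarith
    exact add_eq_zero_iff_eq_neg.1 (norm_eq_zero.1 (pow_eq_zero_iff two_ne_zero |>.1 this))

variable [FiniteDimensional ℝ E]

/-- If `U` preserves absolute values of inner products, and so does the pair `U`, `f`, then `f`
preserves norms. -/
lemma norm_eq_of_abs_inner_eq {U : E → E}
    (hUU : ∀ x y, x ≠ 0 → y ≠ 0 → |⟪U x, U y⟫| = |⟪x, y⟫|) {y z : E}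
    (hUz : ∀ x, x ≠ 0 → |⟪U x, z⟫| = |⟪x, y⟫|) : ‖z‖ = ‖y‖ := by
  let b := stdOrthonormalBasis ℝ E
  have hb : ∀ i, b i ≠ 0 := fun i => b.orthonormal.ne_zero i
  have hU : Orthonormal ℝ (fun i => U (b i)) := by
    refine ⟨fun i => ?_, fun i j hij => ?_⟩
    · have := hUU (b i) (b i) (hb i) (hb i)
      simp only [real_inner_self_eq_norm_sq, abs_pow, abs_norm, b.orthonormal.1 i, abs_one] at this
      exact (sq_eq_sq₀ (norm_nonneg _) zero_le_one).1 this
    · have := hUU (b i) (b j) (hb i) (hb j)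
      rw [b.orthonormal.2 hij, abs_zero] at this
      exact abs_eq_zero.1 this
  let b' := OrthonormalBasis.mk hU
    (hU.linearIndependent.span_eq_top_of_card_eq_finrank' (by simp)).ge
  have hb' : ∀ i, b' i = U (b i) := fun i => by simp [b']
  have h : ‖z‖ ^ 2 = ‖y‖ ^ 2 := by
    rw [← b'.sum_sq_norm_inner_right z, ← b.sum_sq_norm_inner_right y]
    refine Finset.sum_congr rfl fun i _ => ?_
    rw [hb', Real.norm_eq_abs, Real.norm_eq_abs, hUz _ (hb i)]
  exact (sq_eq_sq₀ (norm_nonneg _) (norm_nonneg _)).1 h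

/-- A map whose rescalings `l⁻¹ • f (l • x)` asymptotically preserve absolute values of inner
products, both with each other and with values of `f` on `D`, preserves norms and absolute values
of inner products on `D`. -/
lemma abs_inner_eq_of_tendsto_rescaled_s8 {L : Filter ℝ} [L.NeBot] {D : Set E} {f : E → E}
    (h₂ : ∀ x y, x ≠ 0 → y ∈ D →
      Tendsto (fun l : ℝ => |⟪l⁻¹ • f (l • x), f y⟫|) L (𝓝 |⟪x, y⟫|))
    (h₃ : ∀ x y, x ≠ 0 → y ≠ 0 →
      Tendsto (fun l : ℝ => |⟪l⁻¹ • f (l • x), l⁻¹ • f (l • y)⟫|) L (𝓝 |⟪x, y⟫|)) :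
    (∀ y ∈ D, ‖f y‖ = ‖y‖) ∧
      ∀ x ∈ D, x ≠ 0 → ∀ y ∈ D, y ≠ 0 → |⟪f x, f y⟫| = |⟪x, y⟫| := by
  let F : Ultrafilter ℝ := Ultrafilter.of L
  have hF : (F : Filter ℝ) ≤ L := Ultrafilter.of_le L
  have hlim : ∀ x : E, ∃ u : E, x ≠ 0 → Tendsto (fun l : ℝ => l⁻¹ • f (l • x)) F (𝓝 u) := by
    intro x
    by_cases hx : x = 0
    · exact ⟨0, fun h => (h hx).elim⟩
    have hlt : ∀ᶠ l in (F : Filter ℝ), |⟪l⁻¹ • f (l • x), l⁻¹ • f (l • x)⟫| < ‖x‖ ^ 2 + 1 := by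
      refine ((h₃ x x hx hx).mono_left hF).eventually_lt_const ?_
      simp
    have hmem : Metric.closedBall (0 : E) (‖x‖ + 1) ∈
        F.map (fun l : ℝ => l⁻¹ • f (l • x)) := by
      refine hlt.mono fun l hl => ?_
      rw [real_inner_self_eq_norm_sq, abs_of_nonneg (sq_nonneg _)] at hl
      refine mem_closedBall_zero_iff.2 ?_
      refine abs_le_of_sq_le_sq' ?_ (by positivity) |>.2
      nlinarith [norm_nonneg x]
    obtain ⟨u, -, hu⟩ := (isCompact_closedBall (0 : E) (‖x‖ + 1)).ultrafilter_le_nhds'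
      _ hmem
    exact ⟨u, fun _ => hu⟩
  choose U hU using hlim
  have hUU : ∀ x y, x ≠ 0 → y ≠ 0 → |⟪U x, U y⟫| = |⟪x, y⟫| := fun x y hx hy =>
    tendsto_nhds_unique ((hU x hx).inner (hU y hy)).abs ((h₃ x y hx hy).mono_left hF)
  have hUf : ∀ x y, x ≠ 0 → y ∈ D → |⟪U x, f y⟫| = |⟪x, y⟫| := fun x y hx hy =>
    tendsto_nhds_unique ((hU x hx).inner tendsto_const_nhds).abs ((h₂ x y hx hy).mono_left hF)
  have hnorm : ∀ y ∈ D, ‖f y‖ = ‖y‖ := fun y hy =>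
    norm_eq_of_abs_inner_eq hUU fun x hx => hUf x y hx hy
  have hsign : ∀ y ∈ D, y ≠ 0 → f y = U y ∨ f y = -U y := by
    intro y hy hy0
    have hUy : ‖U y‖ = ‖y‖ :=
      norm_eq_of_abs_inner_eq hUU fun x hx => hUU x y hx hy0
    refine eq_or_eq_neg_of_abs_inner_eq hUy (hnorm y hy) ?_
    rw [hUf y y hy0 hy, real_inner_self_eq_norm_mul_norm, abs_mul, abs_norm]
  refine ⟨hnorm, fun x hx hx0 y hy hy0 => ?_⟩
  rw [← hUU x y hx0 hy0]
  rcases hsign x hx hx0 with h | h <;> rcases hsign y hy hy0 with h' | h' <;> rw [h, h'] <;> simp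

end RescaledLimit

/-- The scale filter: `+∞` if `c < 1`, and `0⁺` otherwise. -/
lemma exists_scale_filter (c : ℝ) : ∃ L : Filter ℝ, L.NeBot ∧ (∀ᶠ l in L, 0 < l) ∧
    Tendsto (fun l => abs (Real.log |l|)) L atTop ∧
    (∀ T : ℝ, 1 < T → ∀ᶠ l in L, if c < 1 then T ≤ |l| else 0 < |l| ∧ |l| ≤ 1 / T) ∧
    (∀ d r : ℝ, 0 < d → 0 < r → ∀ᶠ l in L, if c < 1 then d ≤ l * r else l * r < d) := by
  by_cases hc : c < 1
  · refine ⟨atTop, inferInstance, eventually_gt_atTop 0, ?_, fun T _ => ?_, fun d r _ hr => ?_⟩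
    · exact tendsto_abs_atTop_atTop.comp (Real.tendsto_log_atTop.comp tendsto_abs_atTop_atTop)
    · simpa only [hc, if_true] using tendsto_abs_atTop_atTop.eventually_ge_atTop T
    · simpa only [hc, if_true, id] using
        ((tendsto_id (α := ℝ)).atTop_mul_const hr).eventually_ge_atTop d
  · refine ⟨𝓝[>] 0, inferInstance, eventually_mem_nhdsWithin, ?_, fun T hT => ?_,
      fun d r hd hr => ?_⟩
    · simp only [Real.log_abs]
      exact tendsto_abs_atBot_atTop.comp Real.tendsto_log_nhdsGT_zero
    · simp only [hc, if_false]
      filter_upwards [Ioo_mem_nhdsGT (show (0 : ℝ) < 1 / T by positivity)] with l hl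
      rw [abs_of_pos hl.1]
      exact ⟨hl.1, hl.2.le⟩
    · simp only [hc, if_false]
      filter_upwards [Ioo_mem_nhdsGT (show (0 : ℝ) < d / r by positivity)] with l hl
      exact (lt_div_iff₀ hr).1 hl.2

theorem stmt_8
    (n : ℕ) (hn : 2 ≤ n)
    (c d : ℝ) (hc : 0 < c) (hc1 : c ≠ 1) (hd : 0 < d)
    (D : Set (EuclideanSpace ℝ (Fin n)))
    (hD : D = if c < 1 then {x : EuclideanSpace ℝ (Fin n) | d ≤ ‖x‖} else {x : EuclideanSpace ℝ (Fin n) | ‖x‖ < d})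
    (φ : EuclideanSpace ℝ (Fin n) → EuclideanSpace ℝ (Fin n) → ℝ)
    (hφnonneg : ∀ x y, 0 ≤ φ x y)
    (hφsymm : ∀ x y, φ x y = φ y x)
    (hφi : ∃ φ₀ : ℝ → ℝ → ℝ, ∀ x y, φ x y = φ₀ ‖x‖ ‖y‖)
    (hφii : ∀ x y : EuclideanSpace ℝ (Fin n), ∃ C : ℝ, 0 < C ∧ ∃ T : ℝ, 1 < T ∧
      ∀ l : ℝ, (if c < 1 then T ≤ |l| else 0 < |l| ∧ |l| ≤ 1 / T) →
        (1 / |l|) * φ (l • x) y ≤ C / abs (Real.log |l|))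
    (hφiii : ∀ x y : EuclideanSpace ℝ (Fin n), ∃ C : ℝ, 0 < C ∧ ∃ T : ℝ, 1 < T ∧
      ∀ l m : ℝ, |l| ≠ 1 → |m| ≠ 1 →
        (if c < 1 then T ≤ |l * m| else 0 < |l * m| ∧ |l * m| ≤ 1 / T) →
        (1 / |l * m|) * φ (l • x) (m • y) ≤ C / (abs (Real.log |l|) * abs (Real.log |m|)))
    (f : EuclideanSpace ℝ (Fin n) → EuclideanSpace ℝ (Fin n))
    (hf : ∀ x ∈ D, ∀ y ∈ D, |abs ⟪f x, f y⟫ - abs ⟪x, y⟫| ≤ φ x y)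
 :
    ∀ x ∈ D, x ≠ 0 → ∀ y ∈ D, y ≠ 0 →
      ‖x‖ * ‖y‖ * |⟪f x, f y⟫| = ‖f x‖ * ‖f y‖ * |⟪x, y⟫| := by
  obtain ⟨L, hL, hpos, hlog, hT, hDr⟩ := exists_scale_filter c
  have hscale : ∀ x : EuclideanSpace ℝ (Fin n), x ≠ 0 → ∀ᶠ l in L, l • x ∈ D := by
    intro x hx
    filter_upwards [hDr d ‖x‖ hd (norm_pos_iff.2 hx), hpos] with l hl hl0
    rw [hD]
    split_ifs with h <;> simpa [h, norm_smul, abs_of_pos hl0] using hl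
  have h₂ : ∀ x y, x ≠ 0 → y ∈ D →
      Tendsto (fun l : ℝ => |⟪l⁻¹ • f (l • x), f y⟫|) L (𝓝 |⟪x, y⟫|) := by
    intro x y hx hy
    obtain ⟨C, -, T, hT1, hC⟩ := hφii x y
    refine tendsto_iff_dist_tendsto_zero.2 (squeeze_zero' (.of_forall fun _ => dist_nonneg) ?_
      (hlog.const_div_atTop C))
    filter_upwards [hpos, hscale x hx, hT T hT1] with l hl0 hlD hlT
    refine le_trans ?_ (hC l hlT)
    have h := mul_le_mul_of_nonneg_left (hf _ hlD y hy) (by positivity : 0 ≤ 1 / |l|)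
    refine le_of_eq_of_le ?_ h
    rw [Real.dist_eq, real_inner_smul_left, real_inner_smul_left, abs_mul, abs_mul, abs_inv]
    have := abs_pos.2 hl0.ne'
    have hq : 0 < 1 / |l| := by positivity
    rw [← abs_of_pos hq, ← abs_mul]
    congr 1
    field_simp
  have h₃ : ∀ x y, x ≠ 0 → y ≠ 0 →
      Tendsto (fun l : ℝ => |⟪l⁻¹ • f (l • x), l⁻¹ • f (l • y)⟫|) L (𝓝 |⟪x, y⟫|) := by
    intro x y hx hy
    obtain ⟨C, -, T, hT1, hC⟩ := hφiii x y
    refine tendsto_iff_dist_tendsto_zero.2 (squeeze_zero' (.of_forall fun _ => dist_nonneg) ?_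
      ((hlog.atTop_mul_atTop₀ hlog).const_div_atTop C))
    filter_upwards [hpos, hscale x hx, hscale y hy, hT T hT1,
      hlog.eventually_gt_atTop 0] with l hl0 hlx hly hlT hlog0
    have hl1 : |l| ≠ 1 := fun h => by simp [h] at hlog0
    have hll : if c < 1 then T ≤ |l * l| else 0 < |l * l| ∧ |l * l| ≤ 1 / T := by
      rw [abs_mul]
      split_ifs at hlT ⊢
      · nlinarith
      · have : 1 / T ≤ 1 := (div_le_one (by linarith)).2 hT1.le
        exact ⟨mul_pos hlT.1 hlT.1, by nlinarith⟩
    refine le_trans ?_ (hC l l hl1 hl1 hll)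
    have h := mul_le_mul_of_nonneg_left (hf _ hlx _ hly) (by positivity : 0 ≤ 1 / |l * l|)
    refine le_of_eq_of_le ?_ h
    rw [Real.dist_eq, real_inner_smul_left, real_inner_smul_right, real_inner_smul_left,
      real_inner_smul_right]
    simp only [abs_mul, abs_inv]
    have := abs_pos.2 hl0.ne'
    have hq : 0 < 1 / (|l| * |l|) := by positivity
    rw [← abs_of_pos hq, ← abs_mul]
    congr 1
    field_simp
  obtain ⟨hnorm, hinner⟩ := abs_inner_eq_of_tendsto_rescaled_s8 h₂ h₃
  intro x hx hx0 y hy hy0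
  rw [hinner x hx hx0 y hy hy0, hnorm x hx, hnorm y hy]
end

section
/- Suppose f : Dₙ → ℝⁿ satisfies inequality (1). Let e₁, …, eₙ be the canonical orthonormal basis of ℝⁿ, let k₀ be a nonnegative integer such that e′ᵢ := c^{−k₀}eᵢ ∈ Dₙ for all i = 1, …, n. Then there exists a linear isometric automorphism (orthogonal automorphism) ψ : ℝⁿ → ℝⁿ such that: (a) the composition f′ := ψ ∘ f again satisfies inequality (1), i.e. ||⟨f′(x),f′(y)⟩| − |⟨x,y⟩|| ≤ φ(x,y) for all x, y ∈ Dₙ; and (b) for each i = 1, …, n there is a real number λᵢ with 0 < λᵢ ≤ √(1 + c^{2k₀}·φ(e′ᵢ, e′ᵢ)) such that f′(e′ᵢ) = λᵢ·e′ᵢ. -/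
open scoped RealInnerProductSpace

open Filter Topology

/-- If the pairwise inner products of the sequences `v i` tend in absolute value to those of an
orthonormal family, then limits of the `v i` along an ultrafilter form an orthonormal family whose
inner products with the fixed vectors `z p` are, in absolute value, the limits of those of `v`. -/
lemma exists_orthonormal_of_tendsto_abs_inner {E ι κ : Type*} [NormedAddCommGroup E]
    [InnerProductSpace ℝ E] [FiniteDimensional ℝ E] [DecidableEq ι] (v : ι → ℕ → E) (z : κ → E)
    (t : κ → ι → ℝ)
    (hv : ∀ i j, Tendsto (fun k => |⟪v i k, v j k⟫|) atTop (𝓝 (if i = j then 1 else 0)))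
    (hz : ∀ p j, Tendsto (fun k => |⟪v j k, z p⟫|) atTop (𝓝 (t p j))) :
    ∃ w : ι → E, Orthonormal ℝ w ∧ ∀ p j, |⟪w j, z p⟫| = t p j := by
  have hle : ((hyperfilter ℕ : Ultrafilter ℕ) : Filter ℕ) ≤ atTop := Nat.hyperfilter_le_atTop
  have hlim : ∀ i, ∃ w, Tendsto (v i) (hyperfilter ℕ : Ultrafilter ℕ) (𝓝 w) := by
    intro i
    have hbdd : ∀ᶠ k in atTop, v i k ∈ Metric.closedBall (0 : E) 2 := by
      have h := hv i i
      rw [if_pos rfl] at h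
      filter_upwards [h.eventually (gt_mem_nhds (show (1 : ℝ) < 4 by norm_num))] with k hk
      rw [real_inner_self_eq_norm_sq, abs_of_nonneg (sq_nonneg _)] at hk
      rw [mem_closedBall_zero_iff]
      nlinarith [norm_nonneg (v i k)]
    obtain ⟨w, -, hw⟩ := (isCompact_closedBall (0 : E) 2).ultrafilter_le_nhds
      ((hyperfilter ℕ).map (v i)) (le_principal_iff.2 (hle hbdd))
    exact ⟨w, hw⟩
  choose w hw using hlim
  have hww : ∀ i j, |⟪w i, w j⟫| = if i = j then 1 else 0 := fun i j =>
    tendsto_nhds_unique ((hw i).inner (hw j)).abs ((hv i j).mono_left hle)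
  refine ⟨w, ⟨fun i => ?_, fun i j hij => ?_⟩, fun p j =>
    tendsto_nhds_unique ((hw j).inner tendsto_const_nhds).abs ((hz p j).mono_left hle)⟩
  · have h := hww i i
    rw [if_pos rfl, real_inner_self_eq_norm_sq, abs_of_nonneg (sq_nonneg _)] at h
    nlinarith [norm_nonneg (w i)]
  · have h := hww i j
    rwa [if_neg hij, abs_eq_zero] at h

/-- If each `z i` has inner product `±a` with `w i` and is orthogonal to the remaining vectors of
the orthonormal family `w`, some linear isometry sends every `z i` to `a` times the `i`-th
standard basis vector. -/
lemma exists_linearIsometryEquiv_map_eq_smul_single {n : ℕ}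
    {w : Fin n → EuclideanSpace ℝ (Fin n)} (hw : Orthonormal ℝ w)
    (z : Fin n → EuclideanSpace ℝ (Fin n)) {a : ℝ} (ha : 0 < a)
    (hz : ∀ i j, |⟪w j, z i⟫| = if i = j then a else 0) :
    ∃ ψ : EuclideanSpace ℝ (Fin n) ≃ₗᵢ[ℝ] EuclideanSpace ℝ (Fin n),
      ∀ i, ψ (z i) = a • EuclideanSpace.single i (1 : ℝ) := by
  have hcard : Module.finrank ℝ (EuclideanSpace ℝ (Fin n)) = Fintype.card (Fin n) := by simp
  let b : OrthonormalBasis (Fin n) ℝ (EuclideanSpace ℝ (Fin n)) :=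
    OrthonormalBasis.mk hw (hw.linearIndependent.span_eq_top_of_card_eq_finrank' hcard.symm).ge
  have hb : ∀ i, b i = w i := fun i => by simp [b]
  have hzw : ∀ i, z i = ⟪w i, z i⟫ • w i := by
    intro i
    conv_lhs => rw [← b.sum_repr' (z i)]
    rw [Finset.sum_eq_single i, hb]
    · intro j _ hj
      have h := hz i j
      rw [if_neg hj.symm, abs_eq_zero] at h
      rw [hb, h, zero_smul]
    · simp
  have hu : Orthonormal ℝ (fun i => a⁻¹ • z i) := by
    refine ⟨fun i => ?_, fun i j hij => ?_⟩
    · have h := hz i i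
      rw [if_pos rfl] at h
      show ‖a⁻¹ • z i‖ = 1
      rw [hzw i, norm_smul, norm_smul, hw.1 i, Real.norm_eq_abs ⟪_, _⟫, h, mul_one,
        Real.norm_of_nonneg (inv_nonneg.2 ha.le), inv_mul_cancel₀ ha.ne']
    · show ⟪a⁻¹ • z i, a⁻¹ • z j⟫ = 0
      rw [hzw i, hzw j]
      simp only [real_inner_smul_left, real_inner_smul_right, hw.2 hij, mul_zero]
  let u : OrthonormalBasis (Fin n) ℝ (EuclideanSpace ℝ (Fin n)) :=
    OrthonormalBasis.mk hu (hu.linearIndependent.span_eq_top_of_card_eq_finrank' hcard.symm).ge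
  refine ⟨u.repr, fun i => ?_⟩
  have hzu : z i = a • u i := by simp [u, smul_smul, ha.ne']
  rw [hzu, map_smul, u.repr_self]

/-- Rescaling an estimate of `|p| - |l q|` by `l⁻¹`. -/
lemma abs_abs_inv_mul_sub_abs_le {l p q e : ℝ} (hl : 0 < l) (h : |abs p - abs (l * q)| ≤ e) :
    |abs (l⁻¹ * p) - abs q| ≤ 1 / |l| * e := by
  have : |l⁻¹ * p| - |q| = l⁻¹ * (|p| - |l * q|) := by
    rw [abs_mul, abs_mul, abs_of_pos hl, abs_of_pos (inv_pos.2 hl)]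
    field_simp
  rw [this, abs_mul, abs_of_pos hl, abs_of_pos (inv_pos.2 hl), one_div]
  exact mul_le_mul_of_nonneg_left h (inv_pos.2 hl).le

theorem stmt_9
    (n : ℕ) (hn : 2 ≤ n)
    (c d : ℝ) (hc : 0 < c) (hc1 : c ≠ 1) (hd : 0 < d)
    (D : Set (EuclideanSpace ℝ (Fin n)))
    (hD : D = if c < 1 then {x : EuclideanSpace ℝ (Fin n) | d ≤ ‖x‖} else {x : EuclideanSpace ℝ (Fin n) | ‖x‖ < d})
    (φ : EuclideanSpace ℝ (Fin n) → EuclideanSpace ℝ (Fin n) → ℝ)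
    (hφnonneg : ∀ x y, 0 ≤ φ x y)
    (hφsymm : ∀ x y, φ x y = φ y x)
    (hφi : ∃ φ₀ : ℝ → ℝ → ℝ, ∀ x y, φ x y = φ₀ ‖x‖ ‖y‖)
    (hφii : ∀ x y : EuclideanSpace ℝ (Fin n), ∃ C : ℝ, 0 < C ∧ ∃ T : ℝ, 1 < T ∧
      ∀ l : ℝ, (if c < 1 then T ≤ |l| else 0 < |l| ∧ |l| ≤ 1 / T) →
        (1 / |l|) * φ (l • x) y ≤ C / abs (Real.log |l|))
    (hφiii : ∀ x y : EuclideanSpace ℝ (Fin n), ∃ C : ℝ, 0 < C ∧ ∃ T : ℝ, 1 < T ∧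
      ∀ l m : ℝ, |l| ≠ 1 → |m| ≠ 1 →
        (if c < 1 then T ≤ |l * m| else 0 < |l * m| ∧ |l * m| ≤ 1 / T) →
        (1 / |l * m|) * φ (l • x) (m • y) ≤ C / (abs (Real.log |l|) * abs (Real.log |m|)))
    (f : EuclideanSpace ℝ (Fin n) → EuclideanSpace ℝ (Fin n))
    (hf : ∀ x ∈ D, ∀ y ∈ D, |abs ⟪f x, f y⟫ - abs ⟪x, y⟫| ≤ φ x y)
    (k₀ : ℕ)
    (he' : ∀ i : Fin n, (c ^ k₀)⁻¹ • EuclideanSpace.single i (1 : ℝ) ∈ D) :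
    ∃ ψ : EuclideanSpace ℝ (Fin n) ≃ₗᵢ[ℝ] EuclideanSpace ℝ (Fin n),
      (∀ x ∈ D, ∀ y ∈ D,
        |abs ⟪ψ (f x), ψ (f y)⟫ - abs ⟪x, y⟫| ≤ φ x y) ∧
      (∀ i : Fin n, ∃ lam : ℝ, 0 < lam ∧
        lam ≤ Real.sqrt (1 + c ^ (2 * k₀) *
          φ ((c ^ k₀)⁻¹ • EuclideanSpace.single i (1 : ℝ))
            ((c ^ k₀)⁻¹ • EuclideanSpace.single i (1 : ℝ))) ∧
        ψ (f ((c ^ k₀)⁻¹ • EuclideanSpace.single i (1 : ℝ))) =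
          lam • ((c ^ k₀)⁻¹ • EuclideanSpace.single i (1 : ℝ))) := by
  have hL : ∀ k : ℕ, 0 < c⁻¹ ^ k := fun k => pow_pos (inv_pos.2 hc) k
  have hlog : Tendsto (fun k : ℕ => |Real.log (abs (c⁻¹ ^ k))|) atTop atTop := by
    have h0 : 0 < |Real.log c| := abs_pos.2 (Real.log_ne_zero_of_pos_of_ne_one hc hc1)
    have h : ∀ k : ℕ, |Real.log (abs (c⁻¹ ^ k))| = k * |Real.log c| := fun k => by
      rw [Real.log_abs, Real.log_pow, Real.log_inv, abs_mul, abs_neg, Nat.abs_cast]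
    simp only [h]
    exact tendsto_natCast_atTop_atTop.atTop_mul_const h0
  have hscale : ∀ T : ℝ, 1 < T → ∀ᶠ k : ℕ in atTop,
      if c < 1 then T ≤ |c⁻¹ ^ k| else 0 < |c⁻¹ ^ k| ∧ |c⁻¹ ^ k| ≤ 1 / T := by
    intro T hT
    split_ifs with h
    · filter_upwards [(tendsto_pow_atTop_atTop_of_one_lt
        ((one_lt_inv₀ hc).2 h)).eventually_ge_atTop T] with k hk
      exact hk.trans (le_abs_self _)
    · have h1 : 1 < c := lt_of_le_of_ne (not_lt.1 h) hc1.symm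
      filter_upwards [(tendsto_pow_atTop_nhds_zero_of_lt_one (inv_pos.2 hc).le
        (inv_lt_one_of_one_lt₀ h1)).eventually
        (ge_mem_nhds (show (0 : ℝ) < 1 / T by positivity))] with k hk
      rw [abs_of_pos (hL k)]
      exact ⟨hL k, hk⟩
  have hmem : ∀ i : Fin n, ∀ᶠ k : ℕ in atTop, c⁻¹ ^ k • EuclideanSpace.single i (1 : ℝ) ∈ D := by
    intro i
    have hnorm : ∀ k : ℕ, ‖c⁻¹ ^ k • EuclideanSpace.single i (1 : ℝ)‖ = c⁻¹ ^ k := fun k => by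
      rw [norm_smul, PiLp.norm_single, norm_one, mul_one, Real.norm_of_nonneg (hL k).le]
    rw [hD]
    split_ifs with h
    · filter_upwards [(tendsto_pow_atTop_atTop_of_one_lt
        ((one_lt_inv₀ hc).2 h)).eventually_ge_atTop d] with k hk
      simpa only [Set.mem_ofPred_eq, hnorm] using hk
    · have h1 : 1 < c := lt_of_le_of_ne (not_lt.1 h) hc1.symm
      filter_upwards [(tendsto_pow_atTop_nhds_zero_of_lt_one (inv_pos.2 hc).le
        (inv_lt_one_of_one_lt₀ h1)).eventually (gt_mem_nhds hd)] with k hk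
      simpa only [Set.mem_ofPred_eq, hnorm] using hk
  have hpos : ∀ i j : Fin n, ⟪EuclideanSpace.single i (1 : ℝ), EuclideanSpace.single j (1 : ℝ)⟫
      = if i = j then 1 else 0 := fun i j => by
    simpa using orthonormal_iff_ite.1 (EuclideanSpace.basisFun (Fin n) ℝ).orthonormal i j
  have ha : 0 < (c ^ k₀)⁻¹ := by positivity
  obtain ⟨w, hw, hwz⟩ := exists_orthonormal_of_tendsto_abs_inner
    (fun (i : Fin n) (k : ℕ) => (c⁻¹ ^ k)⁻¹ • f (c⁻¹ ^ k • EuclideanSpace.single i (1 : ℝ)))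
    (fun i : Fin n => f ((c ^ k₀)⁻¹ • EuclideanSpace.single i (1 : ℝ)))
    (fun i j => if i = j then (c ^ k₀)⁻¹ else 0)
    (by
      intro i j
      obtain ⟨C, -, T, hT, h⟩ :=
        hφiii (EuclideanSpace.single i (1 : ℝ)) (EuclideanSpace.single j (1 : ℝ))
      have hsq : Tendsto (fun k : ℕ => k * 2) atTop atTop :=
        tendsto_id.atTop_mul_const' (by norm_num)
      rw [tendsto_iff_norm_sub_tendsto_zero]
      refine squeeze_zero' (Eventually.of_forall fun _ => norm_nonneg _) ?_
        ((hlog.atTop_mul_atTop₀ hlog).const_div_atTop C)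
      filter_upwards [hmem i, hmem j, hsq.eventually (hscale T hT),
        hlog.eventually_gt_atTop 0] with k hki hkj hkT hk0
      have hne : |c⁻¹ ^ k| ≠ 1 := fun h1 => by
        rw [h1, Real.log_one, abs_zero] at hk0
        exact hk0.false
      rw [pow_mul, sq] at hkT
      refine le_trans ?_ (h _ _ hne hne hkT)
      have hfk := hf _ hki _ hkj
      rw [real_inner_smul_left (F := EuclideanSpace ℝ (Fin n)) (EuclideanSpace.single i (1 : ℝ)),
        real_inner_smul_right, hpos, ← mul_assoc] at hfk
      have := abs_abs_inv_mul_sub_abs_le (mul_pos (hL k) (hL k)) hfk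
      rw [real_inner_smul_left, real_inner_smul_right, ← mul_assoc, ← mul_inv, Real.norm_eq_abs]
      rwa [apply_ite abs, abs_one, abs_zero] at this)
    (by
      intro p j
      obtain ⟨C, -, T, hT, h⟩ := hφii (EuclideanSpace.single j (1 : ℝ))
        ((c ^ k₀)⁻¹ • EuclideanSpace.single p (1 : ℝ))
      rw [tendsto_iff_norm_sub_tendsto_zero]
      refine squeeze_zero' (Eventually.of_forall fun _ => norm_nonneg _) ?_
        (hlog.const_div_atTop C)
      filter_upwards [hmem j, hscale T hT] with k hkj hkT
      refine le_trans ?_ (h _ hkT)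
      have hfk := hf _ hkj _ (he' p)
      rw [real_inner_smul_left (F := EuclideanSpace ℝ (Fin n)) (EuclideanSpace.single j (1 : ℝ)),
        real_inner_smul_right, hpos] at hfk
      have := abs_abs_inv_mul_sub_abs_le (hL k) hfk
      rw [real_inner_smul_left, Real.norm_eq_abs]
      rwa [mul_ite, mul_one, mul_zero, apply_ite abs, abs_of_pos ha, abs_zero,
        if_congr eq_comm rfl rfl] at this)
  obtain ⟨ψ, hψ⟩ := exists_linearIsometryEquiv_map_eq_smul_single hw _ ha hwz
  refine ⟨ψ, fun x hx y hy => ?_, fun i => ⟨1, one_pos, ?_, ?_⟩⟩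
  · rw [ψ.inner_map_map]
    exact hf x hx y hy
  · rw [Real.one_le_sqrt]
    exact le_add_of_nonneg_right (mul_nonneg (pow_pos hc _).le (hφnonneg _ _))
  · rw [one_smul]
    exact hψ i
end

section
/- Let n = 2. If a function f : D₂ → ℝ² satisfies inequality (1) for all x, y ∈ D₂, then ‖f(x)‖ = ‖x‖ for every x ∈ D₂. -/
open scoped RealInnerProductSpace

open Filter Topology

/-- The norm of a planar vector in terms of its inner products with two vectors and their Gram
matrix. -/
lemma norm_sq_mul_gram_eq (u v w : EuclideanSpace ℝ (Fin 2)) :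
    ‖w‖ ^ 2 * (⟪u, u⟫ * ⟪v, v⟫ - ⟪u, v⟫ ^ 2) =
      ⟪u, w⟫ ^ 2 * ⟪v, v⟫ - 2 * (⟪u, w⟫ * ⟪v, w⟫ * ⟪u, v⟫) + ⟪v, w⟫ ^ 2 * ⟪u, u⟫ := by
  rw [← real_inner_self_eq_norm_sq]
  simp only [PiLp.inner_apply, Fin.sum_univ_two, RCLike.inner_apply, conj_trivial]
  ring

/-- If `u`, `v` become orthonormal in the limit and the absolute values of their inner products
with `w` tend to those of the coordinates of `x`, then `w` and `x` have the same norm. -/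
lemma norm_eq_of_tendsto_abs_inner {ι : Type*} {L : Filter ι} [L.NeBot]
    {u v : ι → EuclideanSpace ℝ (Fin 2)} {w x : EuclideanSpace ℝ (Fin 2)}
    (huu : Tendsto (fun l => |⟪u l, u l⟫|) L (𝓝 1))
    (hvv : Tendsto (fun l => |⟪v l, v l⟫|) L (𝓝 1))
    (huv : Tendsto (fun l => |⟪u l, v l⟫|) L (𝓝 0))
    (huw : Tendsto (fun l => |⟪u l, w⟫|) L (𝓝 |x 0|))
    (hvw : Tendsto (fun l => |⟪v l, w⟫|) L (𝓝 |x 1|)) : ‖w‖ = ‖x‖ := by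
  simp only [abs_of_nonneg (real_inner_self_nonneg)] at huu hvv
  have huv2 := huv.pow 2
  have huw2 := huw.pow 2
  have hvw2 := hvw.pow 2
  simp only [sq_abs] at huv2 huw2 hvw2
  have hcross : Tendsto (fun l => ⟪u l, w⟫ * ⟪v l, w⟫ * ⟪u l, v l⟫) L (𝓝 0) := by
    rw [tendsto_zero_iff_abs_tendsto_zero]
    simpa [Function.comp_def, abs_mul] using (huw.mul hvw).mul huv
  have hl := ((huu.mul hvv).sub huv2).const_mul (‖w‖ ^ 2)
  have hr := ((huw2.mul hvv).sub (hcross.const_mul 2)).add (hvw2.mul huu)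
  simp only [norm_sq_mul_gram_eq] at hl
  have h := tendsto_nhds_unique hl hr
  have hx : ‖x‖ ^ 2 = x 0 ^ 2 + x 1 ^ 2 := by
    simp [EuclideanSpace.norm_sq_eq, Fin.sum_univ_two]
  have hwx : ‖w‖ ^ 2 = ‖x‖ ^ 2 := by rw [hx]; linarith
  exact (sq_eq_sq₀ (norm_nonneg _) (norm_nonneg _)).1 hwx

/-- If `f` preserves absolute values of inner products on `D` up to an error `φ` that is negligible
along a filter of positive dilations, then `f` preserves norms on `D`. -/
lemma norm_eq_of_perturbed_abs_inner {L : Filter ℝ} [L.NeBot]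
    {D : Set (EuclideanSpace ℝ (Fin 2))}
    {φ : EuclideanSpace ℝ (Fin 2) → EuclideanSpace ℝ (Fin 2) → ℝ}
    {f : EuclideanSpace ℝ (Fin 2) → EuclideanSpace ℝ (Fin 2)}
    (hf : ∀ x ∈ D, ∀ y ∈ D, |abs ⟪f x, f y⟫ - abs ⟪x, y⟫| ≤ φ x y)
    (hpos : ∀ᶠ l in L, 0 < l)
    (hD : ∀ y : EuclideanSpace ℝ (Fin 2), y ≠ 0 → ∀ᶠ l in L, l • y ∈ D)
    (hone : ∀ x y, Tendsto (fun l : ℝ => (1 / |l|) * φ (l • x) y) L (𝓝 0))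
    (htwo : ∀ x y, Tendsto (fun l : ℝ => (1 / |l * l|) * φ (l • x) (l • y)) L (𝓝 0))
    {x : EuclideanSpace ℝ (Fin 2)} (hx : x ∈ D) : ‖f x‖ = ‖x‖ := by
  have lim_one (y) (hy : y ≠ 0) :
      Tendsto (fun l : ℝ => |⟪l⁻¹ • f (l • y), f x⟫|) L (𝓝 |⟪y, x⟫|) := by
    rw [tendsto_iff_dist_tendsto_zero]
    refine squeeze_zero' (.of_forall fun _ => dist_nonneg) ?_ (hone y x)
    filter_upwards [hpos, hD y hy] with l hl hly
    have h := mul_le_mul_of_nonneg_left (hf _ hly _ hx) (by positivity : 0 ≤ 1 / |l|)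
    refine le_of_eq_of_le ?_ h
    rw [← abs_of_nonneg (by positivity : 0 ≤ 1 / |l|), ← abs_mul, Real.dist_eq]
    simp only [real_inner_smul_left, abs_mul, abs_inv, abs_of_pos hl, abs_div, abs_one]
    field_simp
    rw [abs_div, abs_of_pos hl]
    field_simp
  have lim_two (y z) (hy : y ≠ 0) (hz : z ≠ 0) :
      Tendsto (fun l : ℝ => |⟪l⁻¹ • f (l • y), l⁻¹ • f (l • z)⟫|) L (𝓝 |⟪y, z⟫|) := by
    rw [tendsto_iff_dist_tendsto_zero]
    refine squeeze_zero' (.of_forall fun _ => dist_nonneg) ?_ (htwo y z)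
    filter_upwards [hpos, hD y hy, hD z hz] with l hl hly hlz
    have h := mul_le_mul_of_nonneg_left (hf _ hly _ hlz) (by positivity : 0 ≤ 1 / |l * l|)
    refine le_of_eq_of_le ?_ h
    rw [← abs_of_nonneg (by positivity : 0 ≤ 1 / |l * l|), ← abs_mul, Real.dist_eq]
    simp only [real_inner_smul_left, real_inner_smul_right, abs_mul, abs_inv, abs_of_pos hl,
      abs_div, abs_one]
    field_simp
    rw [abs_div, abs_of_pos (pow_pos hl 2)]
    field_simp
  have he (i : Fin 2) : EuclideanSpace.single i (1 : ℝ) ≠ 0 := by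
    simp
  apply norm_eq_of_tendsto_abs_inner
    (u := fun l : ℝ => l⁻¹ • f (l • EuclideanSpace.single 0 1))
    (v := fun l : ℝ => l⁻¹ • f (l • EuclideanSpace.single 1 1)) (L := L)
  · simpa using lim_two _ _ (he 0) (he 0)
  · simpa using lim_two _ _ (he 1) (he 1)
  · simpa [EuclideanSpace.inner_single_left] using lim_two _ _ (he 0) (he 1)
  · simpa [EuclideanSpace.inner_single_left] using lim_one _ (he 0)
  · simpa [EuclideanSpace.inner_single_left] using lim_one _ (he 1)

theorem stmt_11
    (c d : ℝ) (hc : 0 < c) (hc1 : c ≠ 1) (hd : 0 < d)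
    (D : Set (EuclideanSpace ℝ (Fin 2)))
    (hD : D = if c < 1 then {x : EuclideanSpace ℝ (Fin 2) | d ≤ ‖x‖} else {x : EuclideanSpace ℝ (Fin 2) | ‖x‖ < d})
    (φ : EuclideanSpace ℝ (Fin 2) → EuclideanSpace ℝ (Fin 2) → ℝ)
    (hφnonneg : ∀ x y, 0 ≤ φ x y)
    (hφsymm : ∀ x y, φ x y = φ y x)
    (hφi : ∃ φ₀ : ℝ → ℝ → ℝ, ∀ x y, φ x y = φ₀ ‖x‖ ‖y‖)
    (hφii : ∀ x y : EuclideanSpace ℝ (Fin 2), ∃ C : ℝ, 0 < C ∧ ∃ T : ℝ, 1 < T ∧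
      ∀ l : ℝ, (if c < 1 then T ≤ |l| else 0 < |l| ∧ |l| ≤ 1 / T) →
        (1 / |l|) * φ (l • x) y ≤ C / abs (Real.log |l|))
    (hφiii : ∀ x y : EuclideanSpace ℝ (Fin 2), ∃ C : ℝ, 0 < C ∧ ∃ T : ℝ, 1 < T ∧
      ∀ l m : ℝ, |l| ≠ 1 → |m| ≠ 1 →
        (if c < 1 then T ≤ |l * m| else 0 < |l * m| ∧ |l * m| ≤ 1 / T) →
        (1 / |l * m|) * φ (l • x) (m • y) ≤ C / (abs (Real.log |l|) * abs (Real.log |m|)))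
    (f : EuclideanSpace ℝ (Fin 2) → EuclideanSpace ℝ (Fin 2))
    (hf : ∀ x ∈ D, ∀ y ∈ D, |abs ⟪f x, f y⟫ - abs ⟪x, y⟫| ≤ φ x y)
 :
    ∀ x ∈ D, ‖f x‖ = ‖x‖ := by
  obtain ⟨L, hL, hpos, hDL, hlog, hrange⟩ : ∃ L : Filter ℝ, L.NeBot ∧ (∀ᶠ l in L, 0 < l) ∧
      (∀ y : EuclideanSpace ℝ (Fin 2), y ≠ 0 → ∀ᶠ l in L, l • y ∈ D) ∧
      Tendsto (fun l => abs (Real.log |l|)) L atTop ∧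
      ∀ T : ℝ, 1 < T → ∀ᶠ l in L,
        (if c < 1 then T ≤ |l| else 0 < |l| ∧ |l| ≤ 1 / T) ∧
        (if c < 1 then T ≤ |l * l| else 0 < |l * l| ∧ |l * l| ≤ 1 / T) := by
    by_cases h : c < 1
    · simp only [h, if_true] at hD ⊢
      refine ⟨atTop, inferInstance, eventually_gt_atTop 0, fun y hy => ?_, ?_, fun T hT => ?_⟩
      · have hy' := norm_pos_iff.2 hy
        filter_upwards [eventually_ge_atTop (d / ‖y‖), eventually_gt_atTop 0] with l hl hl0
        rw [hD, Set.mem_ofPred_eq, norm_smul, Real.norm_of_nonneg hl0.le]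
        exact (div_le_iff₀ hy').1 hl
      · simpa only [Real.log_abs, Function.comp_def] using tendsto_abs_atTop_atTop.comp Real.tendsto_log_atTop
      · filter_upwards [eventually_ge_atTop T] with l hl
        rw [abs_mul, abs_of_pos (by linarith)]
        exact ⟨hl, by nlinarith⟩
    · simp only [h, if_false] at hD ⊢
      refine ⟨𝓝[>] 0, inferInstance, eventually_mem_nhdsWithin, fun y hy => ?_, ?_,
        fun T hT => ?_⟩
      · have hy' := norm_pos_iff.2 hy
        filter_upwards [Ioo_mem_nhdsGT (div_pos hd hy')] with l hl
        rw [hD, Set.mem_ofPred_eq, norm_smul, Real.norm_of_nonneg hl.1.le]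
        exact (lt_div_iff₀ hy').1 hl.2
      · simpa only [Real.log_abs, Function.comp_def] using
          tendsto_abs_atBot_atTop.comp Real.tendsto_log_nhdsGT_zero
      · have hT0 : 0 < 1 / T := by positivity
        have hT1 : 1 / T < 1 := (div_lt_one (by linarith)).2 hT
        filter_upwards [Ioo_mem_nhdsGT hT0] with l hl
        have := hl.1
        have := hl.2
        rw [abs_mul, abs_of_pos hl.1]
        exact ⟨⟨hl.1, hl.2.le⟩, by positivity, by nlinarith⟩
  intro x hx
  refine norm_eq_of_perturbed_abs_inner hf hpos hDL (fun y z => ?_) (fun y z => ?_) hx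
  · obtain ⟨C, -, T, hT, hφ⟩ := hφii y z
    refine squeeze_zero' (.of_forall fun l => mul_nonneg (by positivity) (hφnonneg _ _)) ?_
      (hlog.const_div_atTop C)
    filter_upwards [hrange T hT] with l hl using hφ l hl.1
  · obtain ⟨C, -, T, hT, hφ⟩ := hφiii y z
    refine squeeze_zero' (.of_forall fun l => mul_nonneg (by positivity) (hφnonneg _ _)) ?_
      ((hlog.atTop_mul_atTop₀ hlog).const_div_atTop C)
    filter_upwards [hrange T hT, hlog.eventually_gt_atTop 0] with l hl hl0
    have hl1 : |l| ≠ 1 := fun h => by simp [h] at hl0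
    exact hφ l l hl1 hl1 hl.2
end

section
/- If a function f : Dₙ → ℝⁿ satisfies inequality (1) for all x, y ∈ Dₙ, then ‖f(x)‖ = ‖x‖ for every x ∈ Dₙ. -/
open scoped RealInnerProductSpace

open Filter Topology

/-- If vectors `v k i` are asymptotically orthonormal and their inner products with `z` approach, in
absolute value, the coordinates of `y` in an orthonormal basis, then `z` and `y` have equal norm. -/
theorem norm_eq_of_tendsto_abs_inner_s12 {n : ℕ} {y z : EuclideanSpace ℝ (Fin n)}
    (e : OrthonormalBasis (Fin n) ℝ (EuclideanSpace ℝ (Fin n)))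
    (v : ℕ → Fin n → EuclideanSpace ℝ (Fin n))
    (hv : ∀ i j, Tendsto (fun k => |⟪v k i, v k j⟫|) atTop (𝓝 |⟪e i, e j⟫|))
    (hz : ∀ i, Tendsto (fun k => |⟪v k i, z⟫|) atTop (𝓝 |⟪e i, y⟫|)) :
    ‖z‖ = ‖y‖ := by
  have hbdd : ∀ᶠ k in atTop, v k ∈ Metric.closedBall (0 : Fin n → EuclideanSpace ℝ (Fin n)) 2 := by
    have hlt : ∀ i, ∀ᶠ k in atTop, |⟪v k i, v k i⟫| < 4 := fun i =>
      (hv i i).eventually_lt_const (by simp)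
    filter_upwards [eventually_all.2 hlt] with k hk
    rw [mem_closedBall_zero_iff, pi_norm_le_iff_of_nonneg (by norm_num)]
    intro i
    have := hk i
    rw [real_inner_self_eq_norm_sq, abs_of_nonneg (sq_nonneg _)] at this
    nlinarith [norm_nonneg (v k i)]
  obtain ⟨u, -, s, hs, hu⟩ := tendsto_subseq_of_frequently_bounded Metric.isBounded_closedBall
    hbdd.frequently
  have hu' : ∀ i, Tendsto (fun k => v (s k) i) atTop (𝓝 (u i)) := fun i => tendsto_pi_nhds.1 hu i
  have huu : ∀ i j, |⟪u i, u j⟫| = |⟪e i, e j⟫| := fun i j =>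
    tendsto_nhds_unique ((hu' i).inner (hu' j)).abs ((hv i j).comp hs.tendsto_atTop)
  have huz : ∀ i, |⟪u i, z⟫| = |⟪e i, y⟫| := fun i =>
    tendsto_nhds_unique ((hu' i).inner tendsto_const_nhds).abs ((hz i).comp hs.tendsto_atTop)
  have hon : Orthonormal ℝ u := by
    refine ⟨fun i => ?_, fun i j hij => ?_⟩
    · have := huu i i
      rw [real_inner_self_eq_norm_sq, real_inner_self_eq_norm_sq, abs_sq, abs_sq,
        e.orthonormal.1 i] at this
      exact (sq_eq_sq₀ (norm_nonneg _) zero_le_one).1 this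
    · have := huu i j
      rwa [e.orthonormal.2 hij, abs_zero, abs_eq_zero] at this
  let b : OrthonormalBasis (Fin n) ℝ (EuclideanSpace ℝ (Fin n)) :=
    OrthonormalBasis.mk hon
      (hon.linearIndependent.span_eq_top_of_card_eq_finrank' (by simp)).ge
  have hsq : ‖z‖ ^ 2 = ‖y‖ ^ 2 := by
    rw [← b.sum_sq_norm_inner_right z, ← e.sum_sq_norm_inner_right y]
    refine Finset.sum_congr rfl fun i _ => ?_
    simp [b, Real.norm_eq_abs, huz i]
  exact (sq_eq_sq₀ (norm_nonneg _) (norm_nonneg _)).1 hsq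

/-- The defect of preserving absolute inner products, after rescaling both arguments. -/
theorem abs_abs_inner_inv_smul_sub_le {E : Type*} [NormedAddCommGroup E] [InnerProductSpace ℝ E]
    {a b p q : E} {l m r : ℝ} (hl : l ≠ 0) (hm : m ≠ 0)
    (h : |abs ⟪p, q⟫ - abs ⟪l • a, m • b⟫| ≤ r) :
    |abs ⟪l⁻¹ • p, m⁻¹ • q⟫ - abs ⟪a, b⟫| ≤ 1 / |l * m| * r := by
  have hlm : 0 < |l * m| := abs_pos.2 (mul_ne_zero hl hm)
  have heq : abs ⟪l⁻¹ • p, m⁻¹ • q⟫ - abs ⟪a, b⟫ =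
      1 / |l * m| * (abs ⟪p, q⟫ - abs ⟪l • a, m • b⟫) := by
    simp only [real_inner_smul_left, real_inner_smul_right, abs_mul, abs_inv]
    have := abs_ne_zero.2 hl
    have := abs_ne_zero.2 hm
    field_simp
  rw [heq, abs_mul, abs_of_pos (by positivity : 0 < 1 / |l * m|)]
  gcongr

/-- A sequence of scalars going to infinity or to zero, according to the type of the domain. -/
theorem exists_scaling_sequence {c d : ℝ} (hd : 0 < d) : ∃ t : ℕ → ℝ,
    (∀ k, 0 < t k) ∧ Tendsto (fun k => abs (Real.log |t k|)) atTop atTop ∧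
    (∀ᶠ k in atTop, if c < 1 then d ≤ t k else t k < d) ∧
    (∀ T > 1, ∀ᶠ k in atTop, if c < 1 then T ≤ |t k| else 0 < |t k| ∧ |t k| ≤ 1 / T) ∧
    (∀ T > 1, ∀ᶠ k in atTop,
      if c < 1 then T ≤ |t k * t k| else 0 < |t k * t k| ∧ |t k * t k| ≤ 1 / T) := by
  have hinf : Tendsto (fun k : ℕ => (k : ℝ) + 1) atTop atTop :=
    tendsto_atTop_add_const_right _ _ tendsto_natCast_atTop_atTop
  have hpos : ∀ k : ℕ, 0 < (k : ℝ) + 1 := fun k => by positivity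
  have hlog : Tendsto (fun k : ℕ => abs (Real.log |(k : ℝ) + 1|)) atTop atTop := by
    simp only [Real.log_abs]
    exact tendsto_abs_atTop_atTop.comp (Real.tendsto_log_atTop.comp hinf)
  by_cases hc : c < 1
  · refine ⟨fun k => k + 1, hpos, hlog, ?_, fun T _ => ?_, fun T _ => ?_⟩ <;> simp only [if_pos hc]
    · exact hinf.eventually_ge_atTop d
    · filter_upwards [hinf.eventually_ge_atTop T] with k hk
      exact hk.trans (le_abs_self _)
    · filter_upwards [(hinf.atTop_mul_atTop₀ hinf).eventually_ge_atTop T] with k hk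
      exact hk.trans (le_abs_self _)
  · have hzero := hinf.inv_tendsto_atTop
    have hzero' := hzero.mul hzero
    rw [mul_zero] at hzero'
    refine ⟨fun k => ((k : ℝ) + 1)⁻¹, fun k => inv_pos.2 (hpos k), ?_, ?_, fun T hT => ?_,
      fun T hT => ?_⟩ <;> simp only [if_neg hc]
    · simpa only [abs_inv, Real.log_inv, abs_neg] using hlog
    · exact hzero.eventually_lt_const hd
    · filter_upwards [hzero.eventually_le_const (by positivity : 0 < 1 / T)] with k hk
      have := inv_pos.2 (hpos k)
      rw [abs_of_pos this]
      exact ⟨this, hk⟩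
    · filter_upwards [hzero'.eventually_le_const (by positivity : 0 < 1 / T)] with k hk
      have := mul_pos (inv_pos.2 (hpos k)) (inv_pos.2 (hpos k))
      rw [abs_of_pos this]
      exact ⟨this, hk⟩

theorem stmt_12
    (n : ℕ) (hn : 2 ≤ n)
    (c d : ℝ) (hc : 0 < c) (hc1 : c ≠ 1) (hd : 0 < d)
    (D : Set (EuclideanSpace ℝ (Fin n)))
    (hD : D = if c < 1 then {x : EuclideanSpace ℝ (Fin n) | d ≤ ‖x‖} else {x : EuclideanSpace ℝ (Fin n) | ‖x‖ < d})
    (φ : EuclideanSpace ℝ (Fin n) → EuclideanSpace ℝ (Fin n) → ℝ)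
    (hφnonneg : ∀ x y, 0 ≤ φ x y)
    (hφsymm : ∀ x y, φ x y = φ y x)
    (hφi : ∃ φ₀ : ℝ → ℝ → ℝ, ∀ x y, φ x y = φ₀ ‖x‖ ‖y‖)
    (hφii : ∀ x y : EuclideanSpace ℝ (Fin n), ∃ C : ℝ, 0 < C ∧ ∃ T : ℝ, 1 < T ∧
      ∀ l : ℝ, (if c < 1 then T ≤ |l| else 0 < |l| ∧ |l| ≤ 1 / T) →
        (1 / |l|) * φ (l • x) y ≤ C / abs (Real.log |l|))
    (hφiii : ∀ x y : EuclideanSpace ℝ (Fin n), ∃ C : ℝ, 0 < C ∧ ∃ T : ℝ, 1 < T ∧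
      ∀ l m : ℝ, |l| ≠ 1 → |m| ≠ 1 →
        (if c < 1 then T ≤ |l * m| else 0 < |l * m| ∧ |l * m| ≤ 1 / T) →
        (1 / |l * m|) * φ (l • x) (m • y) ≤ C / (abs (Real.log |l|) * abs (Real.log |m|)))
    (f : EuclideanSpace ℝ (Fin n) → EuclideanSpace ℝ (Fin n))
    (hf : ∀ x ∈ D, ∀ y ∈ D, |abs ⟪f x, f y⟫ - abs ⟪x, y⟫| ≤ φ x y)
 :
    ∀ x ∈ D, ‖f x‖ = ‖x‖ := by
  intro y hy
  obtain ⟨t, htpos, htlog, htd, htT, httT⟩ := exists_scaling_sequence (c := c) hd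
  let e := EuclideanSpace.basisFun (Fin n) ℝ
  have hmem : ∀ᶠ k in atTop, ∀ i, t k • e i ∈ D := by
    filter_upwards [htd] with k hk i
    have hnorm : ‖t k • e i‖ = t k := by
      rw [norm_smul, e.orthonormal.1 i, mul_one, Real.norm_of_nonneg (htpos k).le]
    rw [hD]
    split_ifs at hk ⊢ <;> simpa only [Set.mem_ofPred_eq, hnorm] using hk
  refine norm_eq_of_tendsto_abs_inner_s12 e (fun k i => (t k)⁻¹ • f (t k • e i))
    (fun i j => ?_) fun i => ?_
  · obtain ⟨C, -, T, hT, h⟩ := hφiii (e i) (e j)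
    refine tendsto_iff_norm_sub_tendsto_zero.2 (squeeze_zero' (.of_forall fun _ => norm_nonneg _)
      ?_ ((htlog.atTop_mul_atTop₀ htlog).const_div_atTop C))
    filter_upwards [hmem, httT T hT, htlog.eventually_gt_atTop 0] with k hk hkT hlog
    have hne : |t k| ≠ 1 := by
      intro h1
      simp [h1] at hlog
    exact (abs_abs_inner_inv_smul_sub_le (htpos k).ne' (htpos k).ne'
      (hf _ (hk i) _ (hk j))).trans (h _ _ hne hne hkT)
  · obtain ⟨C, -, T, hT, h⟩ := hφii (e i) y
    refine tendsto_iff_norm_sub_tendsto_zero.2 (squeeze_zero' (.of_forall fun _ => norm_nonneg _)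
      ?_ (htlog.const_div_atTop C))
    filter_upwards [hmem, htT T hT] with k hk hkT
    have hfk : |abs ⟪f (t k • e i), f y⟫ - abs ⟪t k • e i, (1 : ℝ) • y⟫| ≤ φ (t k • e i) y := by
      simpa only [one_smul] using hf _ (hk i) _ hy
    have := abs_abs_inner_inv_smul_sub_le (htpos k).ne' one_ne_zero hfk
    rw [inv_one, one_smul, mul_one] at this
    exact this.trans (h _ hkT)
end

section
/- If a function f : Dₙ → ℝⁿ satisfies the inequality ||⟨f(x),f(y)⟩| − |⟨x,y⟩|| ≤ φ(x,y) for all x, y ∈ Dₙ, then f satisfies the generalized orthogonality equation |⟨f(x), f(y)⟩| = |⟨x, y⟩| for all x, y ∈ Dₙ. -/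
open scoped RealInnerProductSpace

open Filter Topology

/-- Two vectors of norm `r` whose inner product has absolute value `r ^ 2` agree up to sign. -/
lemma eq_or_eq_neg_of_abs_inner_eq_sq {E : Type*} [NormedAddCommGroup E] [InnerProductSpace ℝ E]
    {u v : E} {r : ℝ} (hu : ‖u‖ = r) (hv : ‖v‖ = r) (h : |⟪u, v⟫| = r ^ 2) : u = v ∨ u = -v := by
  have hsub := norm_sub_sq_real u v
  have hadd := norm_add_sq_real u v
  rw [hu, hv] at hsub hadd
  rcases abs_eq (sq_nonneg r) |>.mp h with h | h
  · left
    have : ‖u - v‖ ^ 2 = 0 := by rw [hsub, h]; ring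
    exact sub_eq_zero.mp (norm_eq_zero.mp (pow_eq_zero_iff two_ne_zero |>.mp this))
  · right
    have : ‖u + v‖ ^ 2 = 0 := by rw [hadd, h]; ring
    exact eq_neg_of_add_eq_zero_left (norm_eq_zero.mp (pow_eq_zero_iff two_ne_zero |>.mp this))

/-- If the vectors `u i` have the Gram matrix of `r • e i` up to signs, where `e` is the standard
basis, and `w` has the same inner products (up to sign) with `u i` as `y` has with `r • e i`,
then `w` and `y` have the same norm. -/
lemma norm_eq_of_abs_inner_eq_s13 {n : ℕ} {r : ℝ} (hr : 0 < r)
    (u : Fin n → EuclideanSpace ℝ (Fin n)) (w y : EuclideanSpace ℝ (Fin n))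
    (hu : ∀ i j, |⟪u i, u j⟫| = |⟪r • EuclideanSpace.basisFun (Fin n) ℝ i,
      r • EuclideanSpace.basisFun (Fin n) ℝ j⟫|)
    (hw : ∀ i, |⟪u i, w⟫| = |⟪r • EuclideanSpace.basisFun (Fin n) ℝ i, y⟫|) :
    ‖w‖ = ‖y‖ := by
  set e := EuclideanSpace.basisFun (Fin n) ℝ with he
  have hon : Orthonormal ℝ (fun i => r⁻¹ • u i) := by
    refine ⟨fun i => ?_, fun i j hij => ?_⟩
    · have h := hu i i
      rw [real_inner_self_eq_norm_sq, real_inner_self_eq_norm_sq, abs_of_nonneg (sq_nonneg _),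
        abs_of_nonneg (sq_nonneg _), sq_eq_sq₀ (norm_nonneg _) (norm_nonneg _), norm_smul,
        e.orthonormal.1 i, Real.norm_of_nonneg hr.le, mul_one] at h
      rw [norm_smul, h, norm_inv, Real.norm_of_nonneg hr.le, inv_mul_cancel₀ hr.ne']
    · have h := hu i j
      rw [real_inner_smul_left, real_inner_smul_right, e.orthonormal.2 hij] at h
      have h0 : ⟪u i, u j⟫ = 0 := by simpa using h
      change ⟪r⁻¹ • u i, r⁻¹ • u j⟫ = 0
      rw [real_inner_smul_left, real_inner_smul_right, h0, mul_zero, mul_zero]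
  have hspan : ⊤ ≤ Submodule.span ℝ (Set.range fun i => r⁻¹ • u i) :=
    (hon.linearIndependent.span_eq_top_of_card_eq_finrank' (by simp)).ge
  have hb := (OrthonormalBasis.mk hon hspan).sum_sq_norm_inner_right w
  have he' := e.sum_sq_norm_inner_right y
  rw [← sq_eq_sq₀ (norm_nonneg _) (norm_nonneg _), ← hb, ← he']
  refine Finset.sum_congr rfl fun i _ => ?_
  have h := hw i
  rw [real_inner_smul_left, abs_mul, abs_of_pos hr] at h
  rw [OrthonormalBasis.coe_mk, real_inner_smul_left, Real.norm_eq_abs, Real.norm_eq_abs, abs_mul,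
    abs_inv, abs_of_pos hr, h, inv_mul_cancel_left₀ hr.ne']

/-- A map whose inner products agree with those of the identity, up to sign and up to an error `φ`
that becomes negligible under rescaling by `Real.exp t` along the filter `L`, preserves
absolute values of inner products exactly. -/
lemma abs_inner_map_map_of_tendsto {n : ℕ} {L : Filter ℝ} [L.NeBot]
    {D : Set (EuclideanSpace ℝ (Fin n))}
    {φ : EuclideanSpace ℝ (Fin n) → EuclideanSpace ℝ (Fin n) → ℝ}
    {f : EuclideanSpace ℝ (Fin n) → EuclideanSpace ℝ (Fin n)} {r : ℝ} (hr : 0 < r)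
    (hrD : ∀ x, ‖x‖ = r → x ∈ D)
    (hD : ∀ x ∈ D, ∀ᶠ t in L, Real.exp t • x ∈ D)
    (hφ₁ : ∀ x y, Tendsto (fun t => (Real.exp t)⁻¹ * φ (Real.exp t • x) y) L (𝓝 0))
    (hφ₂ : ∀ x y, Tendsto (fun t => (Real.exp t)⁻¹ * (Real.exp t)⁻¹ *
      φ (Real.exp t • x) (Real.exp t • y)) L (𝓝 0))
    (hf : ∀ x ∈ D, ∀ y ∈ D, |(|⟪f x, f y⟫| - |⟪x, y⟫|)| ≤ φ x y) :
    ∀ x ∈ D, ∀ y ∈ D, |⟪f x, f y⟫| = |⟪x, y⟫| := by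
  set F : ℝ → EuclideanSpace ℝ (Fin n) → EuclideanSpace ℝ (Fin n) :=
    fun t x => (Real.exp t)⁻¹ • f (Real.exp t • x) with hF
  have hone : ∀ x ∈ D, ∀ y ∈ D, Tendsto (fun t => |⟪F t x, f y⟫|) L (𝓝 |⟪x, y⟫|) := by
    intro x hx y hy
    rw [tendsto_iff_dist_tendsto_zero]
    refine squeeze_zero' (.of_forall fun _ => dist_nonneg) ?_ (hφ₁ x y)
    filter_upwards [hD x hx] with t ht
    have ht0 := Real.exp_pos t
    have h := mul_le_mul_of_nonneg_left (hf _ ht y hy) (inv_pos.mpr ht0).le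
    refine le_of_eq_of_le ?_ h
    rw [Real.dist_eq, ← abs_of_pos (inv_pos.mpr ht0), ← abs_mul]
    refine congrArg abs ?_
    simp only [hF, real_inner_smul_left, abs_mul, abs_of_pos (inv_pos.mpr ht0), abs_of_pos ht0]
    field_simp
  have htwo : ∀ x ∈ D, ∀ y ∈ D, Tendsto (fun t => |⟪F t x, F t y⟫|) L (𝓝 |⟪x, y⟫|) := by
    intro x hx y hy
    rw [tendsto_iff_dist_tendsto_zero]
    refine squeeze_zero' (.of_forall fun _ => dist_nonneg) ?_ (hφ₂ x y)
    filter_upwards [hD x hx, hD y hy] with t ht ht'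
    have ht0 := Real.exp_pos t
    have hi := mul_pos (inv_pos.mpr ht0) (inv_pos.mpr ht0)
    have h := mul_le_mul_of_nonneg_left (hf _ ht _ ht') hi.le
    refine le_of_eq_of_le ?_ h
    rw [Real.dist_eq, ← abs_of_pos hi, ← abs_mul]
    refine congrArg abs ?_
    simp only [hF, real_inner_smul_left, real_inner_smul_right, abs_mul,
      abs_of_pos (inv_pos.mpr ht0), abs_of_pos ht0]
    field_simp
  have hlim : ∀ x ∈ D, ∃ z, Tendsto (fun t => F t x) (Ultrafilter.of L) (𝓝 z) := by
    intro x hx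
    have hev : ∀ᶠ t in L, F t x ∈ Metric.closedBall (0 : EuclideanSpace ℝ (Fin n))
        (|⟪x, x⟫| + 1) := by
      filter_upwards [(htwo x hx x hx).eventually_lt_const (lt_add_one _)] with t ht
      rw [real_inner_self_eq_norm_sq (F t x), abs_of_nonneg (sq_nonneg _)] at ht
      rw [mem_closedBall_zero_iff]
      nlinarith [abs_nonneg ⟪x, x⟫, norm_nonneg (F t x)]
    obtain ⟨z, -, hz⟩ := (isCompact_closedBall (0 : EuclideanSpace ℝ (Fin n))
      (|⟪x, x⟫| + 1)).ultrafilter_le_nhds ((Ultrafilter.of L).map fun t => F t x)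
      (le_principal_iff.mpr (Ultrafilter.of_le L hev))
    exact ⟨z, hz⟩
  choose! g hg using hlim
  have hgf : ∀ x ∈ D, ∀ y ∈ D, |⟪g x, f y⟫| = |⟪x, y⟫| := fun x hx y hy =>
    tendsto_nhds_unique ((hg x hx).inner tendsto_const_nhds).abs
      ((hone x hx y hy).mono_left (Ultrafilter.of_le L))
  have hgg : ∀ x ∈ D, ∀ y ∈ D, |⟪g x, g y⟫| = |⟪x, y⟫| := fun x hx y hy =>
    tendsto_nhds_unique ((hg x hx).inner (hg y hy)).abs
      ((htwo x hx y hy).mono_left (Ultrafilter.of_le L))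
  have heD : ∀ i, r • EuclideanSpace.basisFun (Fin n) ℝ i ∈ D := fun i => hrD _ (by
    rw [norm_smul, (EuclideanSpace.basisFun (Fin n) ℝ).orthonormal.1 i,
      Real.norm_of_nonneg hr.le, mul_one])
  have hgn : ∀ x ∈ D, ‖g x‖ = ‖x‖ := fun x hx =>
    norm_eq_of_abs_inner_eq_s13 hr (fun i => g (r • EuclideanSpace.basisFun (Fin n) ℝ i)) _ _
      (fun i j => hgg _ (heD i) _ (heD j)) fun i => hgg _ (heD i) x hx
  have hfn : ∀ x ∈ D, ‖f x‖ = ‖x‖ := fun x hx =>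
    norm_eq_of_abs_inner_eq_s13 hr (fun i => g (r • EuclideanSpace.basisFun (Fin n) ℝ i)) _ _
      (fun i j => hgg _ (heD i) _ (heD j)) fun i => hgf _ (heD i) x hx
  have hsign : ∀ x ∈ D, g x = f x ∨ g x = -f x := fun x hx =>
    eq_or_eq_neg_of_abs_inner_eq_sq (hgn x hx) (hfn x hx) (by
      rw [hgf x hx x hx, real_inner_self_eq_norm_sq, abs_of_nonneg (sq_nonneg _)])
  intro x hx y hy
  rw [← hgf x hx y hy]
  rcases hsign x hx with h | h <;> simp [h]

/-- Rescaled error terms vanish along a filter on which `|t|` tends to infinity, when they are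
bounded as in the hypotheses on `φ`. -/
lemma tendsto_zero_of_le_div_abs {L : Filter ℝ} (hL : Tendsto (fun t : ℝ => |t|) L atTop)
    {u : ℝ → ℝ} {C : ℝ} {k : ℕ} (hk : k ≠ 0) (hu0 : ∀ t, 0 ≤ u t)
    (hu : ∀ᶠ t in L, u t ≤ C / |t| ^ k) : Tendsto u L (𝓝 0) :=
  squeeze_zero' (.of_forall hu0) hu
    (((tendsto_pow_atTop hk).comp hL).const_div_atTop C)

theorem stmt_13
    (n : ℕ) (hn : 2 ≤ n)
    (c d : ℝ) (hc : 0 < c) (hc1 : c ≠ 1) (hd : 0 < d)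
    (D : Set (EuclideanSpace ℝ (Fin n)))
    (hD : D = if c < 1 then {x : EuclideanSpace ℝ (Fin n) | d ≤ ‖x‖} else {x : EuclideanSpace ℝ (Fin n) | ‖x‖ < d})
    (φ : EuclideanSpace ℝ (Fin n) → EuclideanSpace ℝ (Fin n) → ℝ)
    (hφnonneg : ∀ x y, 0 ≤ φ x y)
    (hφsymm : ∀ x y, φ x y = φ y x)
    (hφi : ∃ φ₀ : ℝ → ℝ → ℝ, ∀ x y, φ x y = φ₀ ‖x‖ ‖y‖)
    (hφii : ∀ x y : EuclideanSpace ℝ (Fin n), ∃ C : ℝ, 0 < C ∧ ∃ T : ℝ, 1 < T ∧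
      ∀ l : ℝ, (if c < 1 then T ≤ |l| else 0 < |l| ∧ |l| ≤ 1 / T) →
        (1 / |l|) * φ (l • x) y ≤ C / abs (Real.log |l|))
    (hφiii : ∀ x y : EuclideanSpace ℝ (Fin n), ∃ C : ℝ, 0 < C ∧ ∃ T : ℝ, 1 < T ∧
      ∀ l m : ℝ, |l| ≠ 1 → |m| ≠ 1 →
        (if c < 1 then T ≤ |l * m| else 0 < |l * m| ∧ |l * m| ≤ 1 / T) →
        (1 / |l * m|) * φ (l • x) (m • y) ≤ C / (abs (Real.log |l|) * abs (Real.log |m|)))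
    (f : EuclideanSpace ℝ (Fin n) → EuclideanSpace ℝ (Fin n))
    (hf : ∀ x ∈ D, ∀ y ∈ D, |abs ⟪f x, f y⟫ - abs ⟪x, y⟫| ≤ φ x y)
 :
    ∀ x ∈ D, ∀ y ∈ D, |⟪f x, f y⟫| = |⟪x, y⟫| := by
  have key : ∀ L : Filter ℝ, L.NeBot → Tendsto (fun t : ℝ => |t|) L atTop →
      (∀ T : ℝ, 1 < T → ∀ᶠ t in L, if c < 1 then T ≤ Real.exp t
        else 0 < Real.exp t ∧ Real.exp t ≤ 1 / T) →
      (∀ x ∈ D, ∀ᶠ t in L, Real.exp t • x ∈ D) →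
      ∀ r : ℝ, 0 < r → (∀ x, ‖x‖ = r → x ∈ D) →
      ∀ x ∈ D, ∀ y ∈ D, |⟪f x, f y⟫| = |⟪x, y⟫| := by
    intro L hne hL hT hLD r hr hrD
    refine abs_inner_map_map_of_tendsto hr hrD hLD (fun x y => ?_) (fun x y => ?_) hf
    · obtain ⟨C, -, T, hT1, h⟩ := hφii x y
      refine tendsto_zero_of_le_div_abs hL one_ne_zero (C := C)
        (fun t => mul_nonneg (inv_pos.mpr (Real.exp_pos t)).le (hφnonneg _ _)) ?_
      filter_upwards [hT T hT1] with t ht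
      have := h (Real.exp t) (by rwa [Real.abs_exp])
      rwa [Real.abs_exp, Real.log_exp, one_div, ← pow_one |t|] at this
    · obtain ⟨C, -, T, hT1, h⟩ := hφiii x y
      refine tendsto_zero_of_le_div_abs hL two_ne_zero (C := C)
        (fun t => mul_nonneg (mul_pos (inv_pos.mpr (Real.exp_pos t))
          (inv_pos.mpr (Real.exp_pos t))).le (hφnonneg _ _)) ?_
      filter_upwards [hT T hT1, hL.eventually_gt_atTop 0] with t ht ht0
      have hne1 : |Real.exp t| ≠ 1 := by
        rw [Real.abs_exp, Ne, Real.exp_eq_one_iff]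
        exact abs_pos.mp ht0
      have := h (Real.exp t) (Real.exp t) hne1 hne1 (by
        rw [abs_mul, Real.abs_exp]
        split_ifs at ht ⊢ with hlt
        · nlinarith
        · have hT' : 1 / T ≤ 1 := by rw [div_le_one (by linarith)]; exact hT1.le
          exact ⟨mul_pos ht.1 ht.1, by nlinarith [ht.1, ht.2]⟩)
      rwa [abs_mul, Real.abs_exp, Real.log_exp, one_div, mul_inv, ← sq |t|] at this
  by_cases hlt : c < 1
  · simp only [if_pos hlt] at hD key
    subst hD
    refine key atTop inferInstance tendsto_abs_atTop_atTop
      (fun T _ => Real.tendsto_exp_atTop.eventually_ge_atTop T) (fun x hx => ?_) d hd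
      (fun x hx => hx.ge)
    filter_upwards [eventually_ge_atTop 0] with t ht
    rw [norm_smul, Real.norm_eq_abs, Real.abs_exp]
    exact le_trans hx (le_mul_of_one_le_left (norm_nonneg x) (Real.one_le_exp ht))
  · simp only [if_neg hlt] at hD key
    subst hD
    refine key atBot inferInstance tendsto_abs_atBot_atTop (fun T hT => ?_) (fun x hx => ?_)
      (d / 2) (half_pos hd) (fun x hx => hx.trans_lt (half_lt_self hd))
    · filter_upwards [Real.tendsto_exp_atBot.eventually_le_const
        (show (0 : ℝ) < 1 / T by positivity)] with t ht
      exact ⟨Real.exp_pos t, ht⟩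
    · filter_upwards [eventually_le_atBot 0] with t ht
      rw [norm_smul, Real.norm_eq_abs, Real.abs_exp]
      exact (mul_le_of_le_one_left (norm_nonneg x) (Real.exp_le_one_iff.mpr ht)).trans_lt hx
end

section
/- Let ε ≥ 0 and p > 1 be real numbers. If a function f : B → ℝⁿ satisfies ||⟨f(x), f(y)⟩| − |⟨x, y⟩|| ≤ ε·‖x‖^p·‖y‖^p for all x, y ∈ B, then f satisfies the generalized orthogonality equation |⟨f(x), f(y)⟩| = |⟨x, y⟩| for all x, y ∈ B. -/
open scoped RealInnerProductSpace
open Filter Topology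

section

variable {E : Type*} [NormedAddCommGroup E] [InnerProductSpace ℝ E]

/-- If `f` preserves inner products on the ball up to sign and an error `ε ‖x‖ ^ p ‖y‖ ^ p`, then
rescaling one argument by `s` improves the error by a factor `s ^ (p - 1)`. -/
lemma abs_abs_inner_rescale_sub_le {d ε p : ℝ} {f : E → E}
    (hf : ∀ x y : E, ‖x‖ < d → ‖y‖ < d →
      |abs ⟪f x, f y⟫ - abs ⟪x, y⟫| ≤ ε * ‖x‖ ^ p * ‖y‖ ^ p)
    {x y : E} {s : ℝ} (hs : 0 < s) (hx : ‖x‖ < d) (hy : ‖s • y‖ < d) :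
    |abs ⟪f x, s⁻¹ • f (s • y)⟫ - abs ⟪x, y⟫| ≤ ε * ‖x‖ ^ p * ‖y‖ ^ p * s ^ (p - 1) := by
  have h := hf x (s • y) hx hy
  rw [norm_smul, Real.norm_of_nonneg hs.le, Real.mul_rpow hs.le (norm_nonneg y),
    real_inner_smul_right, abs_mul, abs_of_pos hs] at h
  rw [real_inner_smul_right, abs_mul, abs_of_pos (inv_pos.2 hs), Real.rpow_sub_one hs.ne']
  have e : s⁻¹ * |⟪f x, f (s • y)⟫| - |⟪x, y⟫|
      = s⁻¹ * (|⟪f x, f (s • y)⟫| - s * |⟪x, y⟫|) := by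
    field_simp
  rw [e, abs_mul, abs_of_pos (inv_pos.2 hs)]
  calc s⁻¹ * |(|⟪f x, f (s • y)⟫| - s * |⟪x, y⟫|)|
      ≤ s⁻¹ * (ε * ‖x‖ ^ p * (s ^ p * ‖y‖ ^ p)) := by gcongr
    _ = ε * ‖x‖ ^ p * ‖y‖ ^ p * (s ^ p / s) := by ring

lemma eventually_norm_smul_lt {d : ℝ} (hd : 0 < d) (y : E) :
    ∀ᶠ s : ℝ in 𝓝[>] 0, ‖s • y‖ < d := by
  have h : Tendsto (fun s : ℝ => ‖s • y‖) (𝓝 0) (𝓝 0) := by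
    have : Continuous fun s : ℝ => ‖s • y‖ := by fun_prop
    simpa using this.tendsto 0
  exact (h.mono_left nhdsWithin_le_nhds).eventually_lt_const hd

lemma eventually_norm_rescale_le {d ε p : ℝ} (hd : 0 < d) (hε : 0 ≤ ε) (hp : 1 < p) {f : E → E}
    (hf : ∀ x y : E, ‖x‖ < d → ‖y‖ < d →
      |abs ⟪f x, f y⟫ - abs ⟪x, y⟫| ≤ ε * ‖x‖ ^ p * ‖y‖ ^ p) (y : E) :
    ∀ᶠ s : ℝ in 𝓝[>] 0,
      ‖s⁻¹ • f (s • y)‖ ≤ √(‖y‖ ^ 2 + ε * ‖y‖ ^ p * ‖y‖ ^ p) := by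
  filter_upwards [eventually_norm_smul_lt hd y, Ioo_mem_nhdsGT (zero_lt_one' ℝ)]
    with s hsy ⟨hs, hs1⟩
  apply Real.le_sqrt_of_sq_le
  have h := (abs_le.1 (abs_abs_inner_rescale_sub_le hf hs hsy hsy)).2
  rw [real_inner_smul_left, real_inner_smul_right, real_inner_self_eq_norm_sq,
    real_inner_self_eq_norm_sq, abs_of_nonneg (by positivity : 0 ≤ s⁻¹ * ‖f (s • y)‖ ^ 2),
    abs_of_nonneg (by positivity : 0 ≤ s * ‖y‖ ^ 2), norm_smul, Real.norm_of_nonneg hs.le,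
    Real.mul_rpow hs.le (norm_nonneg y)] at h
  rw [norm_smul, Real.norm_of_nonneg (inv_pos.2 hs).le]
  have hq : s ^ (p - 1) ≤ 1 := Real.rpow_le_one hs.le hs1.le (by linarith)
  have hq0 : 0 ≤ s ^ (p - 1) := Real.rpow_nonneg hs.le _
  have hsp : s ^ p = s ^ (p - 1) * s := by
    rw [Real.rpow_sub_one hs.ne']; field_simp
  rw [hsp] at h
  have h2 : s⁻¹ * (s⁻¹ * ‖f (s • y)‖ ^ 2) ≤
      s⁻¹ * (s * ‖y‖ ^ 2 + ε * (s ^ (p - 1) * s * ‖y‖ ^ p) * ‖y‖ ^ p * s ^ (p - 1)) :=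
    mul_le_mul_of_nonneg_left (by linarith) (inv_pos.2 hs).le
  calc (s⁻¹ * ‖f (s • y)‖) ^ 2 = s⁻¹ * (s⁻¹ * ‖f (s • y)‖ ^ 2) := by ring
    _ ≤ _ := h2
    _ = ‖y‖ ^ 2 + ε * ‖y‖ ^ p * ‖y‖ ^ p * (s ^ (p - 1) * s ^ (p - 1)) := by field_simp
    _ ≤ ‖y‖ ^ 2 + ε * ‖y‖ ^ p * ‖y‖ ^ p * 1 := by
        gcongr
        exact mul_le_one₀ hq hq0 hq
    _ = _ := by ring

variable [FiniteDimensional ℝ E]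

/-- A subsequential blow-up `g` of `f` at the origin preserves inner products up to sign, both
against itself and against `f`. -/
lemma exists_blowup_abs_inner_eq {d ε p : ℝ} (hd : 0 < d) (hε : 0 ≤ ε) (hp : 1 < p) {f : E → E}
    (hf : ∀ x y : E, ‖x‖ < d → ‖y‖ < d →
      |abs ⟪f x, f y⟫ - abs ⟪x, y⟫| ≤ ε * ‖x‖ ^ p * ‖y‖ ^ p) :
    ∃ g : E → E, (∀ x y, ‖x‖ < d → |⟪f x, g y⟫| = |⟪x, y⟫|) ∧
      ∀ x y, |⟪g x, g y⟫| = |⟪x, y⟫| := by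
  let U : Ultrafilter ℝ := Ultrafilter.of (𝓝[>] 0)
  have hU : (U : Filter ℝ) ≤ 𝓝[>] 0 := Ultrafilter.of_le _
  have hlim : ∀ y : E, ∃ v, Tendsto (fun s : ℝ => s⁻¹ • f (s • y)) U (𝓝 v) := by
    intro y
    obtain ⟨v, -, hv⟩ := (isCompact_closedBall (0 : E) _).ultrafilter_le_nhds
      (U.map fun s : ℝ => s⁻¹ • f (s • y)) (by
        rw [le_principal_iff]
        refine hU ((eventually_norm_rescale_le hd hε hp hf y).mono fun s hs => ?_)
        simpa using hs)
    exact ⟨v, hv⟩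
  choose g hg using hlim
  have hfg : ∀ x y, ‖x‖ < d → |⟪f x, g y⟫| = |⟪x, y⟫| := by
    intro x y hx
    have h1 : Tendsto (fun s : ℝ => |⟪f x, s⁻¹ • f (s • y)⟫|) U (𝓝 |⟪f x, g y⟫|) :=
      (tendsto_const_nhds.inner (hg y)).abs
    have h0 : Tendsto (fun s : ℝ => ε * ‖x‖ ^ p * ‖y‖ ^ p * s ^ (p - 1)) U (𝓝 0) := by
      have := (Real.continuousAt_rpow_const 0 (p - 1) (Or.inr (by linarith))).tendsto
      rw [Real.zero_rpow (by linarith)] at this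
      simpa using (this.mono_left (hU.trans nhdsWithin_le_nhds)).const_mul
        (ε * ‖x‖ ^ p * ‖y‖ ^ p)
    have h2 : Tendsto (fun s : ℝ => |⟪f x, s⁻¹ • f (s • y)⟫| - |⟪x, y⟫|) U (𝓝 0) := by
      refine squeeze_zero_norm' ?_ h0
      filter_upwards [hU (eventually_norm_smul_lt hd y), hU self_mem_nhdsWithin] with s hsy hs
      exact abs_abs_inner_rescale_sub_le hf hs hx hsy
    exact sub_eq_zero.1 (tendsto_nhds_unique (h1.sub_const _) h2)
  refine ⟨g, hfg, fun x y => ?_⟩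
  have h1 : Tendsto (fun s : ℝ => |⟪s⁻¹ • f (s • x), g y⟫|) U (𝓝 |⟪g x, g y⟫|) :=
    ((hg x).inner tendsto_const_nhds).abs
  refine tendsto_nhds_unique h1 (tendsto_const_nhds.congr' ?_)
  filter_upwards [hU (eventually_norm_smul_lt hd x), hU self_mem_nhdsWithin] with s hsx hs
  have hs : 0 < s := hs
  rw [real_inner_smul_left, abs_mul, hfg _ _ hsx, real_inner_smul_left, abs_mul, ← mul_assoc,
    ← abs_mul, inv_mul_cancel₀ hs.ne', abs_one, one_mul]

/-- A vector whose inner products with the image of a map `g` preserving inner products up to sign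
agree up to sign with those of `x` is `g x` or `-g x`. -/
lemma eq_or_eq_neg_of_abs_inner_eq_s14 {g : E → E} (hg : ∀ x y, |⟪g x, g y⟫| = |⟪x, y⟫|) {v x : E}
    (hv : ∀ y, |⟪v, g y⟫| = |⟪x, y⟫|) : v = g x ∨ v = -g x := by
  let b := stdOrthonormalBasis ℝ E
  have hng : ∀ y, ‖g y‖ = ‖y‖ := fun y => by
    have := hg y y
    rw [real_inner_self_eq_norm_sq, real_inner_self_eq_norm_sq, abs_of_nonneg (by positivity),
      abs_of_nonneg (by positivity)] at this
    exact (sq_eq_sq₀ (norm_nonneg _) (norm_nonneg _)).1 this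
  have ho : Orthonormal ℝ fun i => g (b i) := by
    refine ⟨fun i => by rw [hng]; exact b.orthonormal.1 i, fun i j hij => ?_⟩
    have := hg (b i) (b j)
    rwa [b.orthonormal.2 hij, abs_zero, abs_eq_zero] at this
  let b' := OrthonormalBasis.mk ho
    (ho.linearIndependent.span_eq_top_of_card_eq_finrank' (by simp)).ge
  have hb' : ∀ i, b' i = g (b i) := fun i => by simp [b']
  have hnv : ‖v‖ ^ 2 = ‖x‖ ^ 2 := by
    rw [← b'.sum_sq_norm_inner_left v, ← b.sum_sq_norm_inner_left x]
    refine Finset.sum_congr rfl fun i _ => ?_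
    rw [hb', Real.norm_eq_abs, Real.norm_eq_abs, hv]
  have hx := hv x
  rw [real_inner_self_eq_norm_sq, abs_of_nonneg (by positivity : 0 ≤ ‖x‖ ^ 2)] at hx
  rcases eq_or_eq_neg_of_abs_eq hx with h | h
  · left
    have := norm_sub_sq_real v (g x)
    rw [h, hnv, hng] at this
    exact sub_eq_zero.1 (norm_eq_zero.1 (pow_eq_zero_iff two_ne_zero |>.1 (by linarith)))
  · right
    have := norm_add_sq_real v (g x)
    rw [h, hnv, hng] at this
    exact eq_neg_of_add_eq_zero_left
      (norm_eq_zero.1 (pow_eq_zero_iff two_ne_zero |>.1 (by linarith)))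

end

theorem stmt_14 (n : ℕ) (hn : 2 ≤ n) (d : ℝ) (hd : 0 < d)
    (ε p : ℝ) (hε : 0 ≤ ε) (hp : 1 < p)
    (B : Set (EuclideanSpace ℝ (Fin n))) (hB : B = {x : EuclideanSpace ℝ (Fin n) | ‖x‖ < d})
    (f : EuclideanSpace ℝ (Fin n) → EuclideanSpace ℝ (Fin n))
    (hf : ∀ x ∈ B, ∀ y ∈ B,
      |abs ⟪f x, f y⟫ - abs ⟪x, y⟫| ≤ ε * ‖x‖ ^ p * ‖y‖ ^ p) :
    ∀ x ∈ B, ∀ y ∈ B, |⟪f x, f y⟫| = |⟪x, y⟫| := by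
  subst hB
  obtain ⟨g, hfg, hg⟩ := exists_blowup_abs_inner_eq hd hε hp fun x y hx hy => hf x hx y hy
  intro x hx y hy
  rcases eq_or_eq_neg_of_abs_inner_eq_s14 hg fun z => hfg y z hy with h | h <;>
    simp [h, hfg x y hx]
end

section
/- Suppose f : Dₙ → ℝⁿ satisfies inequality (2). Then for all x, y ∈ Dₙ with x ≠ 0 and y ≠ 0, the cosines of the angles agree: ‖x‖·‖y‖·⟨f(x), f(y)⟩ = ‖f(x)‖·‖f(y)‖·⟨x, y⟩ (equivalently, cos A(f(x), f(y)) = cos A(x, y), where A denotes the angle between two nonzero vectors). -/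
open scoped RealInnerProductSpace
open Filter Topology

/-- If almost orthonormal families `v k` have inner products with every `g a` tending to the
coordinates of `p a`, then `g` has the same Gram matrix as `p`. -/
theorem inner_eq_inner_of_tendsto_gram {ι α : Type*} [Fintype ι]
    (g p : α → EuclideanSpace ℝ ι) (v : ℕ → ι → EuclideanSpace ℝ ι)
    (hnorm : ∀ i, Tendsto (fun k => ⟪v k i, v k i⟫) atTop (𝓝 1))
    (horth : ∀ i j, i ≠ j → Tendsto (fun k => ⟪v k i, v k j⟫) atTop (𝓝 0))
    (hcoord : ∀ i a, Tendsto (fun k => ⟪v k i, g a⟫) atTop (𝓝 (p a i))) (a b : α) :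
    ⟪g a, g b⟫ = ⟪p a, p b⟫ := by
  classical
  have hbdd : ∀ i, ∃ R, ∀ k, v k i ∈ Metric.closedBall (0 : EuclideanSpace ℝ ι) R := by
    intro i
    obtain ⟨M, hM⟩ := (hnorm i).bddAbove_range
    refine ⟨√M, fun k => ?_⟩
    rw [mem_closedBall_zero_iff]
    apply Real.le_sqrt_of_sq_le
    rw [← real_inner_self_eq_norm_sq]
    exact hM ⟨k, rfl⟩
  choose R hR using hbdd
  obtain ⟨u, -, s, hs, hu⟩ :=
    (isCompact_univ_pi fun i => isCompact_closedBall (0 : EuclideanSpace ℝ ι) (R i)).tendsto_subseq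
      (x := v) (fun k i _ => hR i k)
  have hui : ∀ i, Tendsto (fun k => v (s k) i) atTop (𝓝 (u i)) := fun i => tendsto_pi_nhds.1 hu i
  have hst := hs.tendsto_atTop
  have hon : Orthonormal ℝ u := by
    refine ⟨fun i => ?_, fun i j hij => ?_⟩
    · have h := tendsto_nhds_unique ((hui i).inner (𝕜 := ℝ) (hui i)) ((hnorm i).comp hst)
      rw [real_inner_self_eq_norm_sq] at h
      exact (pow_eq_one_iff_of_nonneg (norm_nonneg _) two_ne_zero).1 h
    · exact tendsto_nhds_unique ((hui i).inner (𝕜 := ℝ) (hui j)) ((horth i j hij).comp hst)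
  have hug : ∀ i a, ⟪u i, g a⟫ = p a i := fun i a =>
    tendsto_nhds_unique ((hui i).inner (𝕜 := ℝ) tendsto_const_nhds) ((hcoord i a).comp hst)
  have hspan : ⊤ ≤ Submodule.span ℝ (Set.range u) :=
    (hon.linearIndependent.span_eq_top_of_card_eq_finrank' (by simp)).ge
  let B := OrthonormalBasis.mk hon hspan
  rw [← B.sum_inner_mul_inner (g a) (g b), PiLp.inner_apply]
  refine Finset.sum_congr rfl fun i _ => ?_
  simp only [B, OrthonormalBasis.coe_mk, real_inner_comm (u i) (g a), hug]
  simp [mul_comm]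

/-- A map that asymptotically preserves inner products along the scales `l k`, with relative
errors controlled by the logarithm of the scale, preserves inner products. -/
theorem inner_map_eq_inner_of_scales {n : ℕ} (D : Set (EuclideanSpace ℝ (Fin n)))
    (φ : EuclideanSpace ℝ (Fin n) → EuclideanSpace ℝ (Fin n) → ℝ)
    (f : EuclideanSpace ℝ (Fin n) → EuclideanSpace ℝ (Fin n))
    (hf : ∀ x ∈ D, ∀ y ∈ D, |⟪f x, f y⟫ - ⟪x, y⟫| ≤ φ x y)
    (l : ℕ → ℝ) (hl : ∀ k, 0 < l k)
    (hlog : Tendsto (fun k => abs (Real.log |l k|)) atTop atTop)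
    (hD : ∀ x, x ≠ 0 → ∀ᶠ k in atTop, l k • x ∈ D)
    (hone : ∀ x y, ∃ C : ℝ, ∀ᶠ k in atTop,
      (1 / |l k|) * φ (l k • x) y ≤ C / abs (Real.log |l k|))
    (htwo : ∀ x y, ∃ C : ℝ, ∀ᶠ k in atTop,
      (1 / |l k * l k|) * φ (l k • x) (l k • y) ≤ C / (abs (Real.log |l k|) * abs (Real.log |l k|)))
    {x y : EuclideanSpace ℝ (Fin n)} (hx : x ∈ D) (hy : y ∈ D) : ⟪f x, f y⟫ = ⟪x, y⟫ := by
  have hgram : ∀ x y, x ≠ 0 → y ≠ 0 → Tendsto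
      (fun k => ⟪(l k)⁻¹ • f (l k • x), (l k)⁻¹ • f (l k • y)⟫) atTop (𝓝 ⟪x, y⟫) := by
    intro x y hx hy
    obtain ⟨C, hC⟩ := htwo x y
    rw [tendsto_iff_norm_sub_tendsto_zero]
    refine squeeze_zero' (.of_forall fun _ => norm_nonneg _) ?_
      ((hlog.atTop_mul_atTop₀ hlog).const_div_atTop C)
    filter_upwards [hC, hD x hx, hD y hy] with k hk hkx hky
    refine le_trans ?_ hk
    have hlk := hl k
    have : ⟪(l k)⁻¹ • f (l k • x), (l k)⁻¹ • f (l k • y)⟫ - ⟪x, y⟫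
        = (1 / (l k * l k)) * (⟪f (l k • x), f (l k • y)⟫ - ⟪l k • x, l k • y⟫) := by
      simp only [real_inner_smul_left, real_inner_smul_right]
      field_simp
    rw [this, norm_mul, Real.norm_eq_abs, Real.norm_eq_abs, abs_div, abs_one]
    gcongr
    exact hf _ hkx _ hky
  have hmixed : ∀ x, x ≠ 0 → ∀ y ∈ D, Tendsto
      (fun k => ⟪(l k)⁻¹ • f (l k • x), f y⟫) atTop (𝓝 ⟪x, y⟫) := by
    intro x hx y hy
    obtain ⟨C, hC⟩ := hone x y
    rw [tendsto_iff_norm_sub_tendsto_zero]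
    refine squeeze_zero' (.of_forall fun _ => norm_nonneg _) ?_ (hlog.const_div_atTop C)
    filter_upwards [hC, hD x hx] with k hk hkx
    refine le_trans ?_ hk
    have hlk := hl k
    have : ⟪(l k)⁻¹ • f (l k • x), f y⟫ - ⟪x, y⟫
        = (1 / l k) * (⟪f (l k • x), f y⟫ - ⟪l k • x, y⟫) := by
      simp only [real_inner_smul_left]
      field_simp
    rw [this, norm_mul, Real.norm_eq_abs, Real.norm_eq_abs, abs_div, abs_one]
    gcongr
    exact hf _ hkx _ hy
  let e := EuclideanSpace.basisFun (Fin n) ℝ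
  have he : ∀ i, e i ≠ 0 := fun i => e.orthonormal.ne_zero i
  refine inner_eq_inner_of_tendsto_gram (α := D) (fun a => f a) (fun a => a)
    (fun k i => (l k)⁻¹ • f (l k • e i)) (fun i => ?_) (fun i j hij => ?_) (fun i a => ?_)
    ⟨x, hx⟩ ⟨y, hy⟩
  · simpa [e.orthonormal.1 i] using hgram (e i) (e i) (he i) (he i)
  · rw [← e.orthonormal.2 hij]
    exact hgram (e i) (e j) (he i) (he j)
  · have h := hmixed (e i) (he i) a a.2
    rwa [← e.repr_apply_apply, EuclideanSpace.basisFun_repr] at h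

theorem stmt_16
    (n : ℕ) (hn : 2 ≤ n)
    (c d : ℝ) (hc : 0 < c) (hc1 : c ≠ 1) (hd : 0 < d)
    (D : Set (EuclideanSpace ℝ (Fin n)))
    (hD : D = if c < 1 then {x : EuclideanSpace ℝ (Fin n) | d ≤ ‖x‖} else {x : EuclideanSpace ℝ (Fin n) | ‖x‖ < d})
    (φ : EuclideanSpace ℝ (Fin n) → EuclideanSpace ℝ (Fin n) → ℝ)
    (hφnonneg : ∀ x y, 0 ≤ φ x y)
    (hφsymm : ∀ x y, φ x y = φ y x)
    (hφi : ∃ φ₀ : ℝ → ℝ → ℝ, ∀ x y, φ x y = φ₀ ‖x‖ ‖y‖)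
    (hφii : ∀ x y : EuclideanSpace ℝ (Fin n), ∃ C : ℝ, 0 < C ∧ ∃ T : ℝ, 1 < T ∧
      ∀ l : ℝ, (if c < 1 then T ≤ |l| else 0 < |l| ∧ |l| ≤ 1 / T) →
        (1 / |l|) * φ (l • x) y ≤ C / abs (Real.log |l|))
    (hφiii : ∀ x y : EuclideanSpace ℝ (Fin n), ∃ C : ℝ, 0 < C ∧ ∃ T : ℝ, 1 < T ∧
      ∀ l m : ℝ, |l| ≠ 1 → |m| ≠ 1 →
        (if c < 1 then T ≤ |l * m| else 0 < |l * m| ∧ |l * m| ≤ 1 / T) →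
        (1 / |l * m|) * φ (l • x) (m • y) ≤ C / (abs (Real.log |l|) * abs (Real.log |m|)))
    (f : EuclideanSpace ℝ (Fin n) → EuclideanSpace ℝ (Fin n))
    (hf : ∀ x ∈ D, ∀ y ∈ D, |⟪f x, f y⟫ - ⟪x, y⟫| ≤ φ x y)
 :
    ∀ x ∈ D, x ≠ 0 → ∀ y ∈ D, y ≠ 0 →
      ‖x‖ * ‖y‖ * ⟪f x, f y⟫ = ‖f x‖ * ‖f y‖ * ⟪x, y⟫ := by
  intro x hx _ y hy _
  have key : ∀ x ∈ D, ∀ y ∈ D, ⟪f x, f y⟫ = ⟪x, y⟫ := by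
    intro x hx y hy
    have hnat : Tendsto (fun k : ℕ => (k : ℝ) + 2) atTop atTop :=
      tendsto_atTop_add_const_right _ _ tendsto_natCast_atTop_atTop
    have hpos : ∀ k : ℕ, (0 : ℝ) < (k : ℝ) + 2 := fun k => by positivity
    have hgt : ∀ k : ℕ, (1 : ℝ) < (k : ℝ) + 2 := fun k => by
      have := k.cast_nonneg (α := ℝ)
      linarith
    have hlog : Tendsto (fun k : ℕ => abs (Real.log |(k : ℝ) + 2|)) atTop atTop := by
      simp only [Real.log_abs]
      exact tendsto_abs_atTop_atTop.comp (Real.tendsto_log_atTop.comp hnat)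
    by_cases hlt : c < 1
    · simp only [hlt, if_true] at hD hφii hφiii
      subst hD
      refine inner_map_eq_inner_of_scales _ φ f hf (fun k : ℕ => (k : ℝ) + 2) hpos hlog
        (fun x hx => ?_) (fun x y => ?_) (fun x y => ?_) hx hy
      · filter_upwards [(hnat.atTop_mul_const (norm_pos_iff.2 hx)).eventually_ge_atTop d] with k hk
        simpa only [Set.mem_ofPred_eq, norm_smul, Real.norm_eq_abs, abs_of_pos (hpos k)] using hk
      · obtain ⟨C, -, T, -, h⟩ := hφii x y
        refine ⟨C, ?_⟩
        filter_upwards [hnat.eventually_ge_atTop T] with k hk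
        exact h _ (by rwa [abs_of_pos (hpos k)])
      · obtain ⟨C, -, T, -, h⟩ := hφiii x y
        refine ⟨C, ?_⟩
        filter_upwards [hnat.eventually_ge_atTop T] with k hk
        have hne : |(k : ℝ) + 2| ≠ 1 := by rw [abs_of_pos (hpos k)]; exact (hgt k).ne'
        refine h _ _ hne hne ?_
        rw [abs_of_pos (mul_pos (hpos k) (hpos k))]
        nlinarith [hgt k]
    · simp only [hlt, if_false] at hD hφii hφiii
      subst hD
      have hinv : Tendsto (fun k : ℕ => ((k : ℝ) + 2)⁻¹) atTop (𝓝 0) := hnat.inv_tendsto_atTop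
      have hipos : ∀ k : ℕ, 0 < ((k : ℝ) + 2)⁻¹ := fun k => inv_pos.2 (hpos k)
      have hilt : ∀ k : ℕ, ((k : ℝ) + 2)⁻¹ < 1 := fun k => inv_lt_one_of_one_lt₀ (hgt k)
      refine inner_map_eq_inner_of_scales _ φ f hf (fun k : ℕ => ((k : ℝ) + 2)⁻¹) hipos
        (by simpa only [abs_inv, Real.log_inv, abs_neg] using hlog)
        (fun x _ => ?_) (fun x y => ?_) (fun x y => ?_) hx hy
      · have h := hinv.mul_const ‖x‖
        rw [zero_mul] at h
        filter_upwards [h.eventually_lt_const hd] with k hk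
        simpa only [Set.mem_ofPred_eq, norm_smul, Real.norm_eq_abs, abs_of_pos (hipos k)] using hk
      · obtain ⟨C, -, T, hT, h⟩ := hφii x y
        refine ⟨C, ?_⟩
        filter_upwards [hinv.eventually_le_const (show 0 < 1 / T by positivity)] with k hk
        exact h _ (by rw [abs_of_pos (hipos k)]; exact ⟨hipos k, hk⟩)
      · obtain ⟨C, -, T, hT, h⟩ := hφiii x y
        refine ⟨C, ?_⟩
        filter_upwards [hinv.eventually_le_const (show 0 < 1 / T by positivity)] with k hk
        have hne : |((k : ℝ) + 2)⁻¹| ≠ 1 := by rw [abs_of_pos (hipos k)]; exact (hilt k).ne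
        refine h _ _ hne hne ?_
        rw [abs_of_pos (mul_pos (hipos k) (hipos k))]
        exact ⟨mul_pos (hipos k) (hipos k),
          (mul_le_of_le_one_left (hipos k).le (hilt k).le).trans hk⟩
  have hnorm : ∀ x ∈ D, ‖f x‖ = ‖x‖ := fun x hx => by
    have h := key x hx x hx
    rw [real_inner_self_eq_norm_sq, real_inner_self_eq_norm_sq] at h
    exact (pow_left_inj₀ (norm_nonneg _) (norm_nonneg _) two_ne_zero).1 h
  rw [key x hx y hy, hnorm x hx, hnorm y hy]
end

section
/- If a function f : Dₙ → ℝⁿ satisfies the inequality |⟨f(x),f(y)⟩ − ⟨x,y⟩| ≤ φ(x,y) for all x, y ∈ Dₙ, then f satisfies the orthogonality equation ⟨f(x), f(y)⟩ = ⟨x, y⟩ for all x, y ∈ Dₙ. -/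
open scoped RealInnerProductSpace

open Filter Topology

/-- If `f` preserves inner products up to an error `φ` that vanishes asymptotically along the
dilations by `a k`, then `f` preserves inner products exactly. -/
lemma inner_eq_of_asymptotic_error {ι E : Type*} [Fintype ι] [NormedAddCommGroup E]
    [InnerProductSpace ℝ E] [FiniteDimensional ℝ E] (b : OrthonormalBasis ι ℝ E)
    (D : Set E) (φ : E → E → ℝ) (f : E → E)
    (hf : ∀ x ∈ D, ∀ y ∈ D, |⟪f x, f y⟫ - ⟪x, y⟫| ≤ φ x y)
    (s : ℝ) (hs : s ≠ 0) (hsD : ∀ i, s • b i ∈ D)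
    (a : ℕ → ℝ) (ha : ∀ k, 0 < a k) (haD : ∀ k, ∀ x ∈ D, a k • x ∈ D)
    (h1 : ∀ x y, Tendsto (fun k => 1 / a k * φ (a k • x) y) atTop (𝓝 0))
    (h2 : ∀ x y, Tendsto (fun p : ℕ × ℕ => 1 / (a p.1 * a p.2) * φ (a p.1 • x) (a p.2 • y))
      atTop (𝓝 0)) :
    ∀ x ∈ D, ∀ y ∈ D, ⟪f x, f y⟫ = ⟪x, y⟫ := by
  classical
  have hG2 : ∀ x ∈ D, ∀ y ∈ D, Tendsto (fun p : ℕ × ℕ =>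
      ⟪(a p.1)⁻¹ • f (a p.1 • x), (a p.2)⁻¹ • f (a p.2 • y)⟫) atTop (𝓝 ⟪x, y⟫) := by
    intro x hx y hy
    rw [tendsto_iff_norm_sub_tendsto_zero]
    refine squeeze_zero (fun _ => norm_nonneg _) (fun p => ?_) (h2 x y)
    have hk := ha p.1
    have hl := ha p.2
    have h := hf _ (haD p.1 x hx) _ (haD p.2 y hy)
    have e : ⟪(a p.1)⁻¹ • f (a p.1 • x), (a p.2)⁻¹ • f (a p.2 • y)⟫ - ⟪x, y⟫ =
        1 / (a p.1 * a p.2) * (⟪f (a p.1 • x), f (a p.2 • y)⟫ - ⟪a p.1 • x, a p.2 • y⟫) := by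
      simp only [real_inner_smul_left, real_inner_smul_right]
      field_simp
    rw [e, Real.norm_eq_abs, abs_mul, abs_of_pos (by positivity : 0 < 1 / (a p.1 * a p.2))]
    gcongr
  have hG1 : ∀ x ∈ D, ∀ y ∈ D, Tendsto (fun k =>
      ⟪(a k)⁻¹ • f (a k • x), f y⟫) atTop (𝓝 ⟪x, y⟫) := by
    intro x hx y hy
    rw [tendsto_iff_norm_sub_tendsto_zero]
    refine squeeze_zero (fun _ => norm_nonneg _) (fun k => ?_) (h1 x y)
    have hk := ha k
    have h := hf _ (haD k x hx) _ hy
    have e : ⟪(a k)⁻¹ • f (a k • x), f y⟫ - ⟪x, y⟫ =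
        1 / a k * (⟪f (a k • x), f y⟫ - ⟪a k • x, y⟫) := by
      simp only [real_inner_smul_left]
      field_simp
    rw [e, Real.norm_eq_abs, abs_mul, abs_of_pos (by positivity : 0 < 1 / a k)]
    gcongr
  have hdiag : Tendsto (fun k : ℕ => (k, k)) atTop atTop := tendsto_atTop_diagonal
  have hlim : ∀ x : E, ∃ z : E, x ∈ D → Tendsto (fun k => (a k)⁻¹ • f (a k • x)) atTop (𝓝 z) := by
    intro x
    by_cases hx : x ∈ D
    · suffices CauchySeq (fun k => (a k)⁻¹ • f (a k • x)) by
        obtain ⟨z, hz⟩ := cauchySeq_tendsto_of_complete this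
        exact ⟨z, fun _ => hz⟩
      rw [cauchySeq_iff_tendsto_dist_atTop_0]
      have hd := (hG2 x hx x hx).comp hdiag
      have hfst : Tendsto (Prod.fst : ℕ × ℕ → ℕ) atTop atTop := by
        rw [← prod_atTop_atTop_eq]; exact tendsto_fst
      have hsnd : Tendsto (Prod.snd : ℕ × ℕ → ℕ) atTop atTop := by
        rw [← prod_atTop_atTop_eq]; exact tendsto_snd
      have h := (((hd.comp hfst).sub ((hG2 x hx x hx).const_mul 2)).add (hd.comp hsnd)).sqrt
      rw [show ⟪x, x⟫ - 2 * ⟪x, x⟫ + ⟪x, x⟫ = (0 : ℝ) by ring, Real.sqrt_zero] at h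
      refine h.congr fun p => ?_
      rw [dist_eq_norm, ← Real.sqrt_sq (norm_nonneg (_ - _)), norm_sub_sq_real]
      simp only [Function.comp, real_inner_self_eq_norm_sq]
    · exact ⟨0, fun h => absurd h hx⟩
  choose g hg using hlim
  have hgg : ∀ x ∈ D, ∀ y ∈ D, ⟪g x, g y⟫ = ⟪x, y⟫ := fun x hx y hy =>
    tendsto_nhds_unique ((hg x hx).inner (hg y hy)) ((hG2 x hx y hy).comp hdiag)
  have hgf : ∀ x ∈ D, ∀ y ∈ D, ⟪g x, f y⟫ = ⟪x, y⟫ := fun x hx y hy =>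
    tendsto_nhds_unique ((hg x hx).inner tendsto_const_nhds) (hG1 x hx y hy)
  have hon : Orthonormal ℝ (fun i => s⁻¹ • g (s • b i)) := by
    rw [orthonormal_iff_ite]
    intro i j
    rw [real_inner_smul_left, real_inner_smul_right, hgg _ (hsD i) _ (hsD j),
      real_inner_smul_left, real_inner_smul_right, orthonormal_iff_ite.1 b.orthonormal i j]
    field_simp
  have hspan : (⊤ : Submodule ℝ E) ≤ Submodule.span ℝ (Set.range fun i => s⁻¹ • g (s • b i)) :=
    (hon.linearIndependent.span_eq_top_of_card_eq_finrank'
      (Module.finrank_eq_card_basis b.toBasis).symm).ge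
  have hfg : ∀ y ∈ D, f y = g y := by
    intro y hy
    refine (OrthonormalBasis.mk hon hspan).repr.injective (PiLp.ext fun i => ?_)
    simp only [OrthonormalBasis.repr_apply_apply, OrthonormalBasis.coe_mk, real_inner_smul_left,
      hgf _ (hsD i) y hy, hgg _ (hsD i) y hy]
  intro x hx y hy
  rw [hfg x hx, hfg y hy, hgg x hx y hy]

theorem stmt_17
    (n : ℕ) (hn : 2 ≤ n)
    (c d : ℝ) (hc : 0 < c) (hc1 : c ≠ 1) (hd : 0 < d)
    (D : Set (EuclideanSpace ℝ (Fin n)))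
    (hD : D = if c < 1 then {x : EuclideanSpace ℝ (Fin n) | d ≤ ‖x‖} else {x : EuclideanSpace ℝ (Fin n) | ‖x‖ < d})
    (φ : EuclideanSpace ℝ (Fin n) → EuclideanSpace ℝ (Fin n) → ℝ)
    (hφnonneg : ∀ x y, 0 ≤ φ x y)
    (hφsymm : ∀ x y, φ x y = φ y x)
    (hφi : ∃ φ₀ : ℝ → ℝ → ℝ, ∀ x y, φ x y = φ₀ ‖x‖ ‖y‖)
    (hφii : ∀ x y : EuclideanSpace ℝ (Fin n), ∃ C : ℝ, 0 < C ∧ ∃ T : ℝ, 1 < T ∧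
      ∀ l : ℝ, (if c < 1 then T ≤ |l| else 0 < |l| ∧ |l| ≤ 1 / T) →
        (1 / |l|) * φ (l • x) y ≤ C / abs (Real.log |l|))
    (hφiii : ∀ x y : EuclideanSpace ℝ (Fin n), ∃ C : ℝ, 0 < C ∧ ∃ T : ℝ, 1 < T ∧
      ∀ l m : ℝ, |l| ≠ 1 → |m| ≠ 1 →
        (if c < 1 then T ≤ |l * m| else 0 < |l * m| ∧ |l * m| ≤ 1 / T) →
        (1 / |l * m|) * φ (l • x) (m • y) ≤ C / (abs (Real.log |l|) * abs (Real.log |m|)))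
    (f : EuclideanSpace ℝ (Fin n) → EuclideanSpace ℝ (Fin n))
    (hf : ∀ x ∈ D, ∀ y ∈ D, |⟪f x, f y⟫ - ⟪x, y⟫| ≤ φ x y)
 :
    ∀ x ∈ D, ∀ y ∈ D, ⟪f x, f y⟫ = ⟪x, y⟫ := by
  have hlog2 : 0 < Real.log 2 := Real.log_pos one_lt_two
  obtain ⟨a, ha, haD, hlog, hP, s, hs, hsD⟩ : ∃ a : ℕ → ℝ, (∀ k, 0 < a k) ∧
      (∀ k, ∀ x ∈ D, a k • x ∈ D) ∧ (∀ k, |Real.log (a k)| = (k + 1) * Real.log 2) ∧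
      (∀ T : ℝ, 1 < T → ∃ N, ∀ k ≥ N,
        (if c < 1 then T ≤ a k else 0 < a k ∧ a k ≤ 1 / T) ∧
        ∀ l, (if c < 1 then T ≤ a k * a l else 0 < a k * a l ∧ a k * a l ≤ 1 / T)) ∧
      ∃ s : ℝ, s ≠ 0 ∧ ∀ u : EuclideanSpace ℝ (Fin n), ‖u‖ = 1 → s • u ∈ D := by
    by_cases h : c < 1
    · simp only [if_pos h] at hD ⊢
      subst hD
      have h1 : ∀ k : ℕ, (1 : ℝ) ≤ 2 ^ (k + 1) := fun k => one_le_pow₀ one_le_two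
      refine ⟨fun k => 2 ^ (k + 1), fun k => by positivity, fun k x hx => ?_, fun k => ?_,
        fun T hT => ?_, d, hd.ne', fun u hu => ?_⟩
      · simp only [Set.mem_ofPred_eq] at hx ⊢
        rw [norm_smul, Real.norm_of_nonneg (by positivity)]
        nlinarith [h1 k, norm_nonneg x]
      · rw [Real.log_pow, abs_of_nonneg (by positivity)]
        push_cast
        ring
      · obtain ⟨N, hN⟩ := pow_unbounded_of_one_lt T (one_lt_two : (1 : ℝ) < 2)
        refine ⟨N, fun k hk => ?_⟩
        have hTk : T ≤ 2 ^ (k + 1) :=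
          hN.le.trans (pow_le_pow_right₀ one_le_two (by omega))
        exact ⟨hTk, fun l => by nlinarith [h1 l, h1 k]⟩
      · simp [norm_smul, hu, abs_of_pos hd]
    · simp only [if_neg h] at hD ⊢
      subst hD
      have h0 : ∀ k : ℕ, (0 : ℝ) < (1 / 2) ^ (k + 1) := fun k => by positivity
      have h1 : ∀ k : ℕ, ((1 : ℝ) / 2) ^ (k + 1) ≤ 1 := fun k =>
        pow_le_one₀ (by norm_num) (by norm_num)
      refine ⟨fun k => (1 / 2) ^ (k + 1), h0, fun k x hx => ?_, fun k => ?_,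
        fun T hT => ?_, d / 2, by positivity, fun u hu => ?_⟩
      · simp only [Set.mem_ofPred_eq] at hx ⊢
        rw [norm_smul, Real.norm_of_nonneg (h0 k).le]
        nlinarith [h1 k, norm_nonneg x]
      · rw [Real.log_pow, one_div, Real.log_inv, mul_neg, abs_neg, abs_of_nonneg (by positivity)]
        push_cast
        ring
      · obtain ⟨N, hN⟩ := exists_pow_lt_of_lt_one (by positivity : 0 < 1 / T)
          (by norm_num : (1 : ℝ) / 2 < 1)
        refine ⟨N, fun k hk => ?_⟩
        have hTk : ((1 : ℝ) / 2) ^ (k + 1) ≤ 1 / T :=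
          (pow_le_pow_of_le_one (by norm_num) (by norm_num) (by omega)).trans hN.le
        exact ⟨⟨h0 k, hTk⟩, fun l => ⟨mul_pos (h0 k) (h0 l), by nlinarith [h1 l, h0 k]⟩⟩
      · simp only [Set.mem_ofPred_eq, norm_smul, hu, Real.norm_of_nonneg (half_pos hd).le]
        linarith
  have ha1 : ∀ k, |a k| ≠ 1 := fun k h => by
    have := hlog k
    rw [← Real.log_abs, h, Real.log_one, abs_zero] at this
    have : 0 < ((k : ℝ) + 1) * Real.log 2 := by positivity
    linarith
  have hinf : Tendsto (fun k => |Real.log (a k)|) atTop atTop := by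
    simp only [hlog]
    exact (tendsto_atTop_add_const_right _ _ tendsto_natCast_atTop_atTop).atTop_mul_const hlog2
  refine inner_eq_of_asymptotic_error (EuclideanSpace.basisFun (Fin n) ℝ) D φ f hf s hs
    (fun i => hsD _ (OrthonormalBasis.norm_eq_one _ i)) a ha haD (fun x y => ?_) (fun x y => ?_)
  · obtain ⟨C, -, T, hT, h⟩ := hφii x y
    obtain ⟨N, hN⟩ := hP T hT
    refine squeeze_zero' (.of_forall fun k => mul_nonneg (one_div_nonneg.2 (ha k).le)
      (hφnonneg _ _)) ?_ (hinf.const_div_atTop C)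
    filter_upwards [eventually_ge_atTop N] with k hk
    simpa only [abs_of_pos (ha k)] using
      h (a k) (by simpa only [abs_of_pos (ha k)] using (hN k hk).1)
  · obtain ⟨C, -, T, hT, h⟩ := hφiii x y
    obtain ⟨N, hN⟩ := hP T hT
    have hprod : Tendsto (fun p : ℕ × ℕ => |Real.log (a p.1)| * |Real.log (a p.2)|)
        atTop atTop := by
      rw [← prod_atTop_atTop_eq]
      exact (hinf.comp tendsto_fst).atTop_mul_atTop₀ (hinf.comp tendsto_snd)
    refine squeeze_zero' (.of_forall fun p => mul_nonneg
      (one_div_nonneg.2 (mul_pos (ha _) (ha _)).le) (hφnonneg _ _)) ?_ (hprod.const_div_atTop C)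
    filter_upwards [eventually_ge_atTop (N, 0)] with p hp
    have := h (a p.1) (a p.2) (ha1 _) (ha1 _) (by
      simpa only [abs_of_pos (mul_pos (ha p.1) (ha p.2))] using (hN p.1 hp.1).2 p.2)
    simpa only [abs_of_pos (mul_pos (ha p.1) (ha p.2)), abs_of_pos (ha _)] using this
end

section
/- Let ε ≥ 0 and p > 1 be real numbers. If a function f : B → ℝⁿ satisfies |⟨f(x), f(y)⟩ − ⟨x, y⟩| ≤ ε·‖x‖^p·‖y‖^p for all x, y ∈ B, then f satisfies the orthogonality equation ⟨f(x), f(y)⟩ = ⟨x, y⟩ for all x, y ∈ B. -/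
open scoped RealInnerProductSpace

open Filter Topology

/-- In a finite-dimensional real inner product space, a map on the ball of radius `d` which
preserves inner products up to an error `ε * ‖x‖ ^ p * ‖y‖ ^ p` with `1 < p` preserves them
exactly. -/
theorem inner_map_map_of_abs_inner_sub_le {E : Type*} [NormedAddCommGroup E]
    [InnerProductSpace ℝ E] [FiniteDimensional ℝ E] {d ε p : ℝ} (hd : 0 < d) (hε : 0 ≤ ε)
    (hp : 1 < p) {f : E → E}
    (hf : ∀ x y : E, ‖x‖ < d → ‖y‖ < d →
      |⟪f x, f y⟫ - ⟪x, y⟫| ≤ ε * ‖x‖ ^ p * ‖y‖ ^ p)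
    {x y : E} (hx : ‖x‖ < d) (hy : ‖y‖ < d) : ⟪f x, f y⟫ = ⟪x, y⟫ := by
  let b := stdOrthonormalBasis ℝ E
  let t : ℕ → ℝ := fun k => d / (k + 2)
  have ht0 : ∀ k, 0 < t k := fun k => by positivity
  have htd : ∀ k, t k < d := fun k => by
    have : (0 : ℝ) ≤ k := k.cast_nonneg
    exact div_lt_self hd (by linarith)
  have ht : Tendsto t atTop (𝓝 0) :=
    tendsto_const_nhds.div_atTop
      (tendsto_atTop_add_const_right _ _ tendsto_natCast_atTop_atTop)
  let r : ℕ → ℝ := fun k => t k ^ (p - 1)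
  have hr0 : ∀ k, 0 ≤ r k := fun k => Real.rpow_nonneg (ht0 k).le _
  have hr : Tendsto r atTop (𝓝 0) := by
    have h := ht.rpow_const (p := p - 1) (Or.inr (by linarith))
    rwa [Real.zero_rpow (by linarith)] at h
  have hrt : ∀ k, t k ^ p = r k * t k := fun k => by
    change _ = t k ^ (p - 1) * t k
    rw [Real.rpow_sub_one (ht0 k).ne', div_mul_cancel₀ _ (ht0 k).ne']
  have hnorm : ∀ k i, ‖t k • b i‖ = t k := fun k i => by
    rw [norm_smul, b.norm_eq_one, mul_one, Real.norm_of_nonneg (ht0 k).le]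
  let v : ℕ → Fin (Module.finrank ℝ E) → E := fun k i => (t k)⁻¹ • f (t k • b i)
  have hmap : ∀ z, ‖z‖ < d → ∀ k i,
      |⟪f z, v k i⟫ - ⟪z, b i⟫| ≤ ε * ‖z‖ ^ p * r k := fun z hz k i => by
    have h := hf z (t k • b i) hz ((hnorm k i).trans_lt (htd k))
    rw [hnorm, hrt, ← mul_assoc] at h
    refine le_of_mul_le_mul_right (le_trans (le_of_eq ?_) h) (ht0 k)
    rw [← abs_of_pos (ht0 k), ← abs_mul, abs_of_pos (ht0 k), real_inner_smul_right,
      real_inner_smul_right, sub_mul]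
    congr 2
    · field_simp [(ht0 k).ne']
    · ring
  have hgram : ∀ k i j, |⟪v k i, v k j⟫ - ⟪b i, b j⟫| ≤ ε * r k * r k := fun k i j => by
    have h := hmap (t k • b i) ((hnorm k i).trans_lt (htd k)) k j
    rw [hnorm, hrt] at h
    refine le_of_mul_le_mul_right (h.trans' (le_of_eq ?_) |>.trans (le_of_eq ?_)) (ht0 k)
    · rw [← abs_of_pos (ht0 k), ← abs_mul, abs_of_pos (ht0 k)]
      change |(⟪(t k)⁻¹ • f (t k • b i), v k j⟫ - _) * _| = _
      rw [real_inner_smul_left, real_inner_smul_left, sub_mul]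
      congr 2
      · field_simp [(ht0 k).ne']
      · ring
    · ring
  obtain ⟨R, hR⟩ := hr.bddAbove_range
  have hbdd : ∀ k, v k ∈ Metric.closedBall 0 (1 + ε * R * R) := fun k => by
    have hrR : r k ≤ R := hR ⟨k, rfl⟩
    have hR0 : 0 ≤ R := (hr0 k).trans hrR
    rw [mem_closedBall_zero_iff, pi_norm_le_iff_of_nonneg (by positivity)]
    intro i
    have h := (abs_le.1 (hgram k i i)).2
    rw [real_inner_self_eq_norm_sq, real_inner_self_eq_norm_sq, b.norm_eq_one] at h
    have h' : ε * r k * r k ≤ ε * R * R := by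
      have := hr0 k
      gcongr
    have : 0 ≤ ε * R * R := by positivity
    nlinarith [norm_nonneg (v k i)]
  obtain ⟨a, -, φ, hφ, ha⟩ := tendsto_subseq_of_bounded Metric.isBounded_closedBall hbdd
  have hai : ∀ i, Tendsto (fun k => v (φ k) i) atTop (𝓝 (a i)) := tendsto_pi_nhds.1 ha
  have hrφ := hr.comp hφ.tendsto_atTop
  have hmap_lim : ∀ z, ‖z‖ < d → ∀ i, ⟪f z, a i⟫ = ⟪z, b i⟫ := fun z hz i => by
    refine tendsto_nhds_unique ((tendsto_const_nhds (x := f z)).inner (hai i))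
      (tendsto_iff_norm_sub_tendsto_zero.2 ?_)
    refine squeeze_zero (fun _ => norm_nonneg _) (fun k => hmap z hz (φ k) i) ?_
    simpa using hrφ.const_mul (ε * ‖z‖ ^ p)
  have hgram_lim : ∀ i j, ⟪a i, a j⟫ = ⟪b i, b j⟫ := fun i j => by
    refine tendsto_nhds_unique ((hai i).inner (hai j))
      (tendsto_iff_norm_sub_tendsto_zero.2 ?_)
    refine squeeze_zero (fun _ => norm_nonneg _) (fun k => hgram (φ k) i j) ?_
    simpa using (hrφ.const_mul ε).mul hrφ
  have hon : Orthonormal ℝ a := by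
    rw [orthonormal_iff_ite]
    intro i j
    rw [hgram_lim, orthonormal_iff_ite.1 b.orthonormal]
  let c : OrthonormalBasis _ ℝ E := OrthonormalBasis.mk hon
    (hon.linearIndependent.span_eq_top_of_card_eq_finrank' (by simp)).ge
  have hc : ∀ i, c i = a i := fun i => by simp [c]
  rw [← c.sum_inner_mul_inner, ← b.sum_inner_mul_inner]
  refine Finset.sum_congr rfl fun i _ => ?_
  rw [hc, hmap_lim x hx, real_inner_comm (f y), hmap_lim y hy, real_inner_comm y]

theorem stmt_18 (n : ℕ) (hn : 2 ≤ n) (d : ℝ) (hd : 0 < d)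
    (ε p : ℝ) (hε : 0 ≤ ε) (hp : 1 < p)
    (B : Set (EuclideanSpace ℝ (Fin n))) (hB : B = {x : EuclideanSpace ℝ (Fin n) | ‖x‖ < d})
    (f : EuclideanSpace ℝ (Fin n) → EuclideanSpace ℝ (Fin n))
    (hf : ∀ x ∈ B, ∀ y ∈ B,
      |⟪f x, f y⟫ - ⟪x, y⟫| ≤ ε * ‖x‖ ^ p * ‖y‖ ^ p) :
    ∀ x ∈ B, ∀ y ∈ B, ⟪f x, f y⟫ = ⟪x, y⟫ := by
  subst hB
  intro x hx y hy
  exact inner_map_map_of_abs_inner_sub_le hd hε hp (fun x y hx hy => hf x hx y hy) hx hy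
end
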